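/- arXiv:1808.04466 — 3 statements merged into one kernel-verified Lean document; each statement's English description precedes it below -/
import Mathlib

section
/- Let E be a directed graph with E⁰ finite and K a field, and let L = L_K(E) be the (unital) Leavitt path algebra. Then E satisfies Condition (K) if and only if L is left and right weakly regular, i.e., I² = I for every left ideal I of L and J² = J for every right ideal J of L (where I² denotes the additive span of products xy with x, y ∈ I). -/
/-- Generators for the Leavitt path algebra of a directed graph: one generator for each
vertex `v`, each edge `e`, and each ghost edge `e*`. -/
inductive LPAGen (V E : Type) : Type
  | vertex : V → LPAGen V E
  | edge : E → LPAGen V E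
  | ghost : E → LPAGen V E

/-- The defining relations of the (unital) Leavitt path algebra of a directed graph
`(V, E, s, r)` with finitely many vertices, imposed on the free unital `K`-algebra on the
generators; the relation `unit` makes the identity equal to the sum of the vertices. -/
inductive LPARel (K : Type) [Field K] (V E : Type) [Fintype V] (s r : E → V) :
    FreeAlgebra K (LPAGen V E) → FreeAlgebra K (LPAGen V E) → Prop
  | vertex_orth (v w : V) (h : v ≠ w) :
      LPARel K V E s r (FreeAlgebra.ι K (LPAGen.vertex v) * FreeAlgebra.ι K (LPAGen.vertex w)) 0
  | vertex_idem (v : V) :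
      LPARel K V E s r (FreeAlgebra.ι K (LPAGen.vertex v) * FreeAlgebra.ι K (LPAGen.vertex v))
        (FreeAlgebra.ι K (LPAGen.vertex v))
  | edge_src (e : E) :
      LPARel K V E s r (FreeAlgebra.ι K (LPAGen.vertex (s e)) * FreeAlgebra.ι K (LPAGen.edge e))
        (FreeAlgebra.ι K (LPAGen.edge e))
  | edge_rng (e : E) :
      LPARel K V E s r (FreeAlgebra.ι K (LPAGen.edge e) * FreeAlgebra.ι K (LPAGen.vertex (r e)))
        (FreeAlgebra.ι K (LPAGen.edge e))
  | ghost_rng (e : E) :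
      LPARel K V E s r (FreeAlgebra.ι K (LPAGen.vertex (r e)) * FreeAlgebra.ι K (LPAGen.ghost e))
        (FreeAlgebra.ι K (LPAGen.ghost e))
  | ghost_src (e : E) :
      LPARel K V E s r (FreeAlgebra.ι K (LPAGen.ghost e) * FreeAlgebra.ι K (LPAGen.vertex (s e)))
        (FreeAlgebra.ι K (LPAGen.ghost e))
  | ck1_distinct (e f : E) (h : e ≠ f) :
      LPARel K V E s r (FreeAlgebra.ι K (LPAGen.ghost e) * FreeAlgebra.ι K (LPAGen.edge f)) 0
  | ck1_same (e : E) :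
      LPARel K V E s r (FreeAlgebra.ι K (LPAGen.ghost e) * FreeAlgebra.ι K (LPAGen.edge e))
        (FreeAlgebra.ι K (LPAGen.vertex (r e)))
  | ck2 (v : V) (h : {e : E | s e = v}.Finite) (hne : {e : E | s e = v}.Nonempty) :
      LPARel K V E s r (FreeAlgebra.ι K (LPAGen.vertex v))
        (∑ e ∈ h.toFinset, FreeAlgebra.ι K (LPAGen.edge e) * FreeAlgebra.ι K (LPAGen.ghost e))
  | unit :
      LPARel K V E s r 1 (∑ v : V, FreeAlgebra.ι K (LPAGen.vertex v))

/-- The unital Leavitt path algebra `L_K(E)` of a directed graph with finitely many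
vertices, as the quotient of the free unital `K`-algebra on the generators by the
defining relations. -/
abbrev LeavittPathAlgebra (K : Type) [Field K] (V E : Type) [Fintype V] (s r : E → V) :=
  RingQuot (LPARel K V E s r)

/-- A list of edges is a path chain if the range of each edge is the source of the next. -/
def IsPathChain {V E : Type} (s r : E → V) (es : List E) : Prop :=
  ∀ (i : ℕ) (h : i + 1 < es.length), r (es[i]'(by omega)) = s (es[i+1]'h)

/-- A nonempty list of edges is a cycle if it is a closed path chain whose sources are
pairwise distinct. -/
def IsCycle {V E : Type} (s r : E → V) (es : List E) : Prop :=
  ∃ hne : es ≠ [], IsPathChain s r es ∧ r (es.getLast hne) = s (es.head hne) ∧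
    (es.map s).Nodup

/-- A path (given as a list of edges) has an exit if some edge `f` has the same source as
one of the edges of the path but differs from it. -/
def HasExit {V E : Type} (s r : E → V) (es : List E) : Prop :=
  ∃ (f : E) (i : ℕ) (h : i < es.length), s f = s (es[i]'h) ∧ f ≠ es[i]'h


/-- A simple closed path based at the vertex `v`: a closed path `e₁ ⋯ eₙ` with
`s(e₁) = v` and `s(eᵢ) ≠ v` for all `2 ≤ i ≤ n`. -/
def IsSimpleClosedPathAt {V E : Type} (s r : E → V) (v : V) (es : List E) : Prop :=
  ∃ hne : es ≠ [], IsPathChain s r es ∧ r (es.getLast hne) = s (es.head hne) ∧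
    s (es.head hne) = v ∧ ∀ (i : ℕ) (hi : i < es.length), 0 < i → s (es[i]'hi) ≠ v

/-- Condition (K): every vertex which is the base of a simple closed path is the base of
at least two distinct simple closed paths. -/
def ConditionK {V E : Type} (s r : E → V) : Prop :=
  ∀ v : V, (∃ es : List E, IsSimpleClosedPathAt s r v es) →
    ∃ es₁ es₂ : List E, es₁ ≠ es₂ ∧
      IsSimpleClosedPathAt s r v es₁ ∧ IsSimpleClosedPathAt s r v es₂

/-! ### Paths -/

/-- `IsP s r u l w`: the list `l` is a path from `u` to `w`. -/
def IsP {V E : Type} (s r : E → V) : V → List E → V → Prop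
  | u, [], w => u = w
  | u, e :: l, w => u = s e ∧ IsP s r (r e) l w

theorem IsP.end_unique {V E : Type} {s r : E → V} {u w w' : V} {l : List E}
    (h : IsP s r u l w) (h' : IsP s r u l w') : w = w' := by
  induction l generalizing u with
  | nil => exact h.symm.trans h'
  | cons e l ih => exact ih h.2 h'.2

theorem isP_append {V E : Type} {s r : E → V} {u w : V} {a b : List E} :
    IsP s r u (a ++ b) w ↔ ∃ x, IsP s r u a x ∧ IsP s r x b w := by
  induction a generalizing u with
  | nil => simp [IsP]
  | cons e a ih => simp [IsP, ih, and_assoc]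

/-- Simple closed paths, in a convenient form. -/
def SC {V E : Type} (s r : E → V) (w : V) (l : List E) : Prop :=
  IsP s r w l w ∧ l ≠ [] ∧ ∀ f ∈ l.tail, s f ≠ w

theorem isP_iff {V E : Type} {s r : E → V} {u w : V} {l : List E} (hne : l ≠ []) :
    IsP s r u l w ↔ IsPathChain s r l ∧ s (l.head hne) = u ∧ r (l.getLast hne) = w := by
  have hc : ∀ l : List E, IsPathChain s r l ↔ l.IsChain (fun a b => r a = s b) := by
    intro l
    rw [List.isChain_iff_getElem]
    rfl
  induction l generalizing u with
  | nil => exact absurd rfl hne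
  | cons e l ih =>
    cases l with
    | nil => simp [IsP, hc, eq_comm]
    | cons f l =>
      have ih' := ih (u := r e) (List.cons_ne_nil f l)
      refine (and_congr_right fun _ => ih').trans ?_
      simp only [hc, List.isChain_cons_cons, List.head_cons]
      rw [List.getLast_cons (List.cons_ne_nil f l)]
      constructor
      · rintro ⟨h1, h2, h3, h4⟩; exact ⟨⟨h3.symm, h2⟩, h1.symm, h4⟩
      · rintro ⟨⟨h3, h2⟩, h1, h4⟩; exact ⟨h1.symm, h2, h3.symm, h4⟩

theorem sc_iff {V E : Type} {s r : E → V} {w : V} {l : List E} :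
    SC s r w l ↔ IsSimpleClosedPathAt s r w l := by
  unfold SC IsSimpleClosedPathAt
  constructor
  · rintro ⟨h1, hne, h2⟩
    rw [isP_iff hne] at h1
    refine ⟨hne, h1.1, h1.2.2.trans h1.2.1.symm, h1.2.1, ?_⟩
    intro i hi h0
    apply h2
    rw [List.mem_iff_getElem]
    refine ⟨i - 1, by simp; omega, ?_⟩
    simp only [List.getElem_tail]
    congr 1; omega
  · rintro ⟨hne, h1, h2, h3, h4⟩
    refine ⟨(isP_iff hne).2 ⟨h1, h3, h2.trans h3⟩, hne, ?_⟩
    intro f hf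
    rw [List.mem_iff_getElem] at hf
    obtain ⟨i, hi, rfl⟩ := hf
    simp only [List.getElem_tail]
    exact h4 _ _ (by omega)

theorem sc_append {V E : Type} {s r : E → V} {w : V} {a b : List E} (ha : SC s r w a)
    (hab : SC s r w (a ++ b)) : b = [] := by
  obtain ⟨x, h1, h2⟩ := isP_append.1 hab.1
  obtain rfl := h1.end_unique ha.1
  cases b with
  | nil => rfl
  | cons f b =>
    exfalso
    have := hab.2.2 f (by
      obtain ⟨e, a, rfl⟩ := List.exists_cons_of_ne_nil ha.2.1
      simp)
    exact this h2.1.symm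

/-- First return decomposition. -/
theorem first_return {V E : Type} {s r : E → V} {w u : V} {l : List E} (h : IsP s r u l w) :
    ∃ a b, l = a ++ b ∧ IsP s r u a w ∧ IsP s r w b w ∧ ∀ f ∈ a, s f ≠ w := by
  induction l generalizing u with
  | nil => exact ⟨[], [], rfl, h, rfl, by simp⟩
  | cons e l ih =>
    by_cases hu : u = w
    · subst hu
      exact ⟨[], e :: l, rfl, rfl, h, by simp⟩
    · obtain ⟨a, b, rfl, h1, h2, h3⟩ := ih h.2
      refine ⟨e :: a, b, rfl, ⟨h.1, h1⟩, h2, ?_⟩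
      intro f hf
      rcases List.mem_cons.1 hf with rfl | hf
      · rw [← h.1]; exact hu
      · exact h3 f hf

theorem exists_sc_prefix {V E : Type} {s r : E → V} {w : V} {l : List E} (h : IsP s r w l w)
    (hne : l ≠ []) : ∃ a b, l = a ++ b ∧ SC s r w a ∧ IsP s r w b w := by
  obtain ⟨e, l, rfl⟩ := List.exists_cons_of_ne_nil hne
  obtain ⟨a, b, rfl, h1, h2, h3⟩ := first_return h.2
  exact ⟨e :: a, b, rfl, ⟨⟨h.1, h1⟩, by simp, h3⟩, h2⟩

/-! ### Families satisfying the relations (except the second Cuntz-Krieger relation) -/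

/-- A family in a ring satisfying the Leavitt path algebra relations except (4). -/
structure LFam {V E : Type} [Fintype V] (s r : E → V) (A : Type) [Ring A] where
  v : V → A
  e : E → A
  g : E → A
  vv : ∀ u, v u * v u = v u
  vw : ∀ u w, u ≠ w → v u * v w = 0
  se : ∀ f, v (s f) * e f = e f
  er : ∀ f, e f * v (r f) = e f
  rg : ∀ f, v (r f) * g f = g f
  gs : ∀ f, g f * v (s f) = g f
  ge : ∀ f, g f * e f = v (r f)
  gne : ∀ f f', f ≠ f' → g f * e f' = 0
  one : (1 : A) = ∑ u, v u

namespace LFam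

variable {V E : Type} [Fintype V] {s r : E → V} {A : Type} [Ring A] (F : LFam s r A)

theorem ve_ne {u : V} {f : E} (h : u ≠ s f) : F.v u * F.e f = 0 := by
  rw [← F.se, ← mul_assoc, F.vw _ _ h, zero_mul]
theorem ev_ne {u : V} {f : E} (h : r f ≠ u) : F.e f * F.v u = 0 := by
  rw [← F.er, mul_assoc, F.vw _ _ h, mul_zero]
theorem vg_ne {u : V} {f : E} (h : u ≠ r f) : F.v u * F.g f = 0 := by
  rw [← F.rg, ← mul_assoc, F.vw _ _ h, zero_mul]
theorem gv_ne {u : V} {f : E} (h : s f ≠ u) : F.g f * F.v u = 0 := by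
  rw [← F.gs, mul_assoc, F.vw _ _ h, mul_zero]

/-- product of the edges of a list -/
def P : List E → A
  | [] => 1
  | f :: l => F.e f * P l

/-- product of the ghost edges of a list, reversed -/
def S : List E → A
  | [] => 1
  | f :: l => S l * F.g f

theorem P_append (a b : List E) : F.P (a ++ b) = F.P a * F.P b := by
  induction a with
  | nil => simp [P]
  | cons f a ih => simp [P, ih, mul_assoc]

theorem S_append (a b : List E) : F.S (a ++ b) = F.S b * F.S a := by
  induction a with
  | nil => simp [S]
  | cons f a ih => simp [S, ih, mul_assoc]

theorem vPv_zero {u w : V} {l : List E} (h : ¬ IsP s r u l w) : F.v u * F.P l * F.v w = 0 := by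
  induction l generalizing u with
  | nil => simpa [P] using F.vw _ _ h
  | cons f l ih =>
    by_cases hu : u = s f
    · have : ¬ IsP s r (r f) l w := fun h' => h ⟨hu, h'⟩
      have h2 := ih this
      rw [hu, P, ← mul_assoc, F.se, ← F.er, mul_assoc (F.e f), mul_assoc (F.e f), h2, mul_zero]
    · rw [P, ← mul_assoc, F.ve_ne hu]; simp

theorem vSv_zero {u w : V} {l : List E} (h : ¬ IsP s r u l w) : F.v w * F.S l * F.v u = 0 := by
  induction l generalizing u with
  | nil => simpa [S] using F.vw _ _ (fun h' => h h'.symm)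
  | cons f l ih =>
    by_cases hu : u = s f
    · have : ¬ IsP s r (r f) l w := fun h' => h ⟨hu, h'⟩
      have h2 := ih this
      rw [hu, S, mul_assoc, mul_assoc, F.gs, ← F.rg, ← mul_assoc, ← mul_assoc, h2, zero_mul]
    · rw [S, mul_assoc, mul_assoc, F.gv_ne (fun h => hu h.symm)]; simp

theorem vP {u w : V} {l : List E} (h : IsP s r u l w) : F.v u * F.P l = F.P l * F.v w := by
  induction l generalizing u with
  | nil => cases h; simp [P]
  | cons f l ih =>
    rw [h.1, P, ← mul_assoc, F.se, mul_assoc, ← ih h.2, ← mul_assoc, F.er]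

theorem vS {u w : V} {l : List E} (h : IsP s r u l w) : F.v w * F.S l = F.S l * F.v u := by
  induction l generalizing u with
  | nil => cases h; simp [S]
  | cons f l ih =>
    rw [h.1, S, ← mul_assoc, ih h.2, mul_assoc, F.rg, mul_assoc, F.gs]

theorem SvP {u w : V} {l : List E} (h : IsP s r u l w) : F.S l * F.v u * F.P l = F.v w := by
  induction l generalizing u with
  | nil => cases h; simp [P, S]
  | cons f l ih =>
    rw [h.1, S, P, ← mul_assoc, mul_assoc _ _ (F.e f), mul_assoc _ _ (_ * F.e f), F.se,
      F.ge, ih h.2]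

theorem dich (l : List E) (w : V) : (∃ u, IsP s r u l w) ∨
    (F.P l * F.v w = 0 ∧ F.v w * F.S l = 0) := by
  by_cases h : ∃ u, IsP s r u l w
  · exact Or.inl h
  · push Not at h
    right
    constructor
    · rw [← one_mul (F.P l), F.one, Finset.sum_mul, Finset.sum_mul]
      exact Finset.sum_eq_zero fun u _ => F.vPv_zero (h u)
    · rw [← mul_one (_ * F.S l), F.one, Finset.mul_sum]
      exact Finset.sum_eq_zero fun u _ => F.vSv_zero (h u)

theorem SvP_cases {u w : V} {a b : List E} (h : IsP s r u a w) :
    F.S a * F.v u * F.P b = 0 ∨ (∃ t, b = a ++ t ∧ F.S a * F.v u * F.P b = F.v w * F.P t) ∨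
      (∃ t, t ≠ [] ∧ a = b ++ t) := by
  induction a generalizing u b with
  | nil =>
    cases h
    exact Or.inr (Or.inl ⟨b, rfl, by simp [S]⟩)
  | cons f a ih =>
    cases b with
    | nil => exact Or.inr (Or.inr ⟨f :: a, by simp, rfl⟩)
    | cons f' b =>
      by_cases hf : f = f'
      · subst hf
        have key : F.S (f :: a) * F.v u * F.P (f :: b) = F.S a * F.v (r f) * F.P b := by
          rw [h.1, S, P, ← mul_assoc, mul_assoc _ _ (F.e f), mul_assoc _ _ (_ * F.e f), F.se,
            F.ge]
        rw [key]
        rcases ih (b := b) h.2 with h0 | ⟨t, rfl, ht⟩ | ⟨t, h1, rfl⟩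
        · exact Or.inl h0
        · exact Or.inr (Or.inl ⟨t, rfl, ht⟩)
        · exact Or.inr (Or.inr ⟨t, h1, rfl⟩)
      · left
        rw [h.1, S, P, mul_assoc _ (F.g f), F.gs, mul_assoc, ← mul_assoc (F.g f), F.gne _ _ hf]
        simp

theorem sc_orth {w : V} {a b : List E} (ha : SC s r w a) (hb : SC s r w b) (hab : a ≠ b) :
    F.S a * F.v w * F.P b = 0 := by
  rcases F.SvP_cases (b := b) ha.1 with h | ⟨t, rfl, -⟩ | ⟨t, ht, rfl⟩
  · exact h
  · obtain rfl := sc_append ha hb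
    simp at hab
  · exact absurd (sc_append hb ha) ht

/-! #### The condition (K) step -/

theorem strip {w : V} {c : List E} (hc : SC s r w c) (n : ℕ) :
    ∀ (t : List E) (N : ℕ), t.length ≤ n → t.length ≤ N →
      (F.S c * F.v w) ^ N * (F.v w * F.P t * F.v w) = 0 ∨
      ∃ m, m ≤ N ∧ (t ≠ [] → 1 ≤ m) ∧
        (F.S c * F.v w) ^ N * (F.v w * F.P t * F.v w) = (F.S c * F.v w) ^ (N - m) * F.v w := by
  induction n with
  | zero =>
    intro t N ht _
    obtain rfl : t = [] := by simpa using ht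
    exact Or.inr ⟨0, by simp, by simp, by simp [P, F.vv]⟩
  | succ n ih =>
    intro t N ht htN
    by_cases hne : t = []
    · subst hne
      exact Or.inr ⟨0, by simp, by simp, by simp [P, F.vv]⟩
    by_cases hp : IsP s r w t w
    · obtain ⟨a, b, rfl, ha, hb⟩ := exists_sc_prefix hp hne
      have hal : 1 ≤ a.length := List.length_pos_iff.2 ha.2.1
      rw [List.length_append] at ht htN
      have hN : N = (N - 1) + 1 := by omega
      have e1 : F.v w * F.P (a ++ b) * F.v w =
          F.v w * (F.P a) * (F.v w * F.P b * F.v w) := by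
        have : F.v w * F.P a * F.v w = F.v w * F.P a := by
          rw [F.vP ha.1, mul_assoc, F.vv]
        rw [← mul_assoc, ← mul_assoc, this, F.P_append, ← mul_assoc]
      by_cases hac : c = a
      · subst hac
        have e2 : (F.S c * F.v w) ^ N * (F.v w * F.P (c ++ b) * F.v w) =
            (F.S c * F.v w) ^ (N - 1) * (F.v w * F.P b * F.v w) := by
          rw [e1, hN, pow_succ, Nat.add_sub_cancel]
          have : F.S c * F.v w * (F.v w * F.P c) = F.v w := by
            rw [← mul_assoc, mul_assoc (F.S c), F.vv, F.SvP hc.1]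
          rw [mul_assoc, ← mul_assoc (F.S c * F.v w), this, ← mul_assoc (F.v w),
            ← mul_assoc (F.v w), F.vv]
        rw [e2]
        rcases ih b (N - 1) (by omega) (by omega) with h0 | ⟨m, hm, -, h⟩
        · exact Or.inl h0
        · refine Or.inr ⟨m + 1, by omega, by omega, ?_⟩
          rw [h]; congr 2; omega
      · left
        rw [e1, hN, pow_succ, mul_assoc, ← mul_assoc (F.S c * F.v w), ← mul_assoc (F.S c * F.v w),
          mul_assoc (F.S c), F.vv, F.sc_orth hc ha hac]
        simp
    · left
      rw [F.vPv_zero hp, mul_zero]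

theorem conj_zero {w : V} {c d : List E} (hc : SC s r w c) (hd : SC s r w d) (hcd : c ≠ d)
    {t : List E} (ht : t ≠ []) {N : ℕ} (hN : t.length ≤ N) :
    (F.S d * F.v w) * (F.S c * F.v w) ^ N * (F.v w * F.P t * F.v w) *
      ((F.v w * F.P c) ^ N * (F.v w * F.P d)) = 0 := by
  have hGG : ∀ k m, (F.S c * F.v w) ^ k * F.v w * (F.v w * F.P c) ^ (k + m) =
      F.v w * (F.v w * F.P c) ^ m := by
    intro k m
    induction k with
    | zero => simp
    | succ k ih =>
      have : F.S c * F.v w * F.v w * (F.v w * F.P c) = F.v w * F.v w := by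
        rw [F.vv, mul_assoc (F.S c), F.vv, ← mul_assoc, mul_assoc (F.S c), F.vv, F.SvP hc.1]
      rw [pow_succ, show k + 1 + m = (k + m) + 1 by omega, pow_succ' _ (k + m),
        ← mul_assoc, mul_assoc _ (F.S c * F.v w), mul_assoc _ (F.S c * F.v w * F.v w), this,
        F.vv, ih]
  rw [mul_assoc (F.S d * F.v w)]
  rcases F.strip hc t.length t N le_rfl hN with h0 | ⟨m, hm, h1, h⟩
  · rw [h0]; simp
  · rw [h]
    have := hGG (N - m) m
    rw [Nat.sub_add_cancel hm] at this
    rw [mul_assoc, ← mul_assoc (_ * F.v w) (_ ^ N), this]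
    obtain ⟨m, rfl⟩ : ∃ k, m = k + 1 := ⟨m - 1, by have := h1 ht; omega⟩
    rw [pow_succ', ← mul_assoc (F.v w), ← mul_assoc (F.v w), F.vv, ← mul_assoc, ← mul_assoc,
      ← mul_assoc, ← mul_assoc, mul_assoc (F.S d), F.vv,
      F.sc_orth hd hc (Ne.symm hcd)]
    simp

theorem conj_one {w : V} {c d : List E} (hc : SC s r w c) (hd : SC s r w d) (N : ℕ) :
    (F.S d * F.v w) * (F.S c * F.v w) ^ N * F.v w *
      ((F.v w * F.P c) ^ N * (F.v w * F.P d)) = F.v w := by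
  induction N with
  | zero =>
    simp only [pow_zero, mul_one, one_mul]
    rw [← mul_assoc, mul_assoc (F.S d), F.vv, mul_assoc (F.S d), F.vv, F.SvP hd.1]
  | succ N ih =>
    have : F.S c * F.v w * F.v w * (F.v w * F.P c) = F.v w * F.v w := by
      rw [F.vv, mul_assoc (F.S c), F.vv, ← mul_assoc, mul_assoc (F.S c), F.vv, F.SvP hc.1]
    rw [F.vv] at this
    rw [pow_succ, pow_succ']
    calc _ = F.S d * F.v w * (F.S c * F.v w) ^ N * (F.S c * F.v w * F.v w * (F.v w * F.P c)) *
        ((F.v w * F.P c) ^ N * (F.v w * F.P d)) := by simp only [mul_assoc]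
      _ = _ := by rw [this, ih]

end LFam

namespace LFam

variable {V E : Type} [Fintype V] {s r : E → V} {A : Type} [Ring A] (F : LFam s r A)

/-- The idempotents `u (1 - ∑ f f*)`. -/
def q (u : V) (T : Finset E) : A := F.v u * (1 - ∑ f ∈ T, F.e f * F.g f)

theorem v_q (u : V) (T : Finset E) : F.v u * F.q u T = F.q u T := by
  rw [q, ← mul_assoc, F.vv]

theorem v_comm_eg (u : V) (f : E) : F.v u * (F.e f * F.g f) = F.e f * F.g f * F.v u := by
  by_cases h : u = s f
  · rw [h, ← mul_assoc, F.se, mul_assoc, F.gs]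
  · rw [← mul_assoc, F.ve_ne h, mul_assoc, F.gv_ne (Ne.symm h)]; simp

theorem q_eq (u : V) (T : Finset E) : F.q u T = (1 - ∑ f ∈ T, F.e f * F.g f) * F.v u := by
  rw [q, mul_sub, sub_mul, Finset.mul_sum, Finset.sum_mul, mul_one, one_mul]
  congr 1
  exact Finset.sum_congr rfl fun f _ => F.v_comm_eg u f

theorem q_v (u : V) (T : Finset E) : F.q u T * F.v u = F.q u T := by
  rw [q_eq, mul_assoc, F.vv]

theorem q_e_mem {u : V} {T : Finset E} {f : E} (hf : f ∈ T) : F.q u T * F.e f = 0 := by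
  rw [q, mul_assoc, sub_mul, Finset.sum_mul, Finset.sum_eq_single f]
  · rw [mul_assoc, F.ge, F.er]; simp
  · intro b _ hb
    rw [mul_assoc, F.gne _ _ hb, mul_zero]
  · exact fun h => absurd hf h

theorem q_e_not_mem {u : V} {T : Finset E} {f : E} (hf : f ∉ T) :
    F.q u T * F.e f = F.v u * F.e f := by
  rw [q, mul_assoc, sub_mul, Finset.sum_mul, Finset.sum_eq_zero]
  · simp
  · intro b hb
    have hbf : b ≠ f := by
      rintro rfl
      exact hf hb
    rw [mul_assoc, F.gne _ _ hbf, mul_zero]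

theorem g_q_mem {u : V} {T : Finset E} {f : E} (hf : f ∈ T) : F.g f * F.q u T = 0 := by
  rw [q_eq, ← mul_assoc, mul_sub, Finset.mul_sum, Finset.sum_eq_single f]
  · rw [← mul_assoc, F.ge, F.rg]; simp
  · intro b _ hb
    rw [← mul_assoc, F.gne _ _ (Ne.symm hb), zero_mul]
  · exact fun h => absurd hf h

theorem q_q (u : V) (T : Finset E) : F.q u T * F.q u T = F.q u T := by
  have h1 : F.q u T * F.q u T = (1 - ∑ f ∈ T, F.e f * F.g f) * F.q u T := by
    calc F.q u T * F.q u T = ((1 - ∑ f ∈ T, F.e f * F.g f) * F.v u) * F.q u T := by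
          rw [← F.q_eq u T]
      _ = _ := by rw [mul_assoc, F.v_q]
  rw [h1, sub_mul, one_mul, Finset.sum_mul, Finset.sum_eq_zero, sub_zero]
  intro f hf
  rw [mul_assoc, F.g_q_mem hf, mul_zero]

variable {K : Type} [Field K] [Algebra K A]

theorem lemmaD (hK : ConditionK s r) (J : Submodule K A) (hl : ∀ x y, y ∈ J → x * y ∈ J)
    (hr : ∀ x y, x ∈ J → x * y ∈ J) (w : V) (z : A)
    (hz : z ∈ Submodule.span K {y | ∃ t : List E, t ≠ [] ∧ y = F.v w * F.P t * F.v w})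
    (h : F.v w + z ∈ J) : F.v w ∈ J := by
  by_cases hc : ∃ es, IsSimpleClosedPathAt s r w es
  · obtain ⟨c, d, hcd, hc, hd⟩ := hK w hc
    rw [← sc_iff] at hc hd
    have key : ∃ N0, ∀ N, N0 ≤ N → (F.S d * F.v w) * (F.S c * F.v w) ^ N * z *
        ((F.v w * F.P c) ^ N * (F.v w * F.P d)) = 0 := by
      clear h
      induction hz using Submodule.span_induction with
      | mem x hx =>
        obtain ⟨t, ht, rfl⟩ := hx
        exact ⟨t.length, fun N hN => F.conj_zero hc hd hcd ht hN⟩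
      | zero => exact ⟨0, fun N _ => by simp⟩
      | add x y _ _ hx hy =>
        obtain ⟨N1, h1⟩ := hx
        obtain ⟨N2, h2⟩ := hy
        refine ⟨max N1 N2, fun N hN => ?_⟩
        rw [mul_add, add_mul, h1 N (le_trans (le_max_left _ _) hN),
          h2 N (le_trans (le_max_right _ _) hN), add_zero]
      | smul a x _ hx =>
        obtain ⟨N1, h1⟩ := hx
        refine ⟨N1, fun N hN => ?_⟩
        rw [mul_smul_comm, smul_mul_assoc, h1 N hN, smul_zero]
    obtain ⟨N, hN⟩ := key
    have := hr _ ((F.v w * F.P c) ^ N * (F.v w * F.P d))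
      (hl ((F.S d * F.v w) * (F.S c * F.v w) ^ N) _ h)
    rwa [mul_add, add_mul, F.conj_one hc hd N, hN N le_rfl, add_zero] at this
  · have : z = 0 := by
      clear h
      induction hz using Submodule.span_induction with
      | mem x hx =>
        obtain ⟨t, ht, rfl⟩ := hx
        apply F.vPv_zero
        intro hp
        obtain ⟨a, b, -, ha, -⟩ := exists_sc_prefix hp ht
        exact hc ⟨a, sc_iff.1 ha⟩
      | zero => rfl
      | add x y _ _ hx hy => rw [hx, hy, add_zero]
      | smul a x _ hx => rw [hx, smul_zero]
    rwa [this, add_zero] at h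

theorem lemmaC (hK : ConditionK s r) (J : Submodule K A) (hl : ∀ x y, y ∈ J → x * y ∈ J)
    (hr : ∀ x y, x ∈ J → x * y ∈ J) (u : V) (T : Finset E) (z : A)
    (hz : z ∈ Submodule.span K {y | ∃ t : List E, t ≠ [] ∧ y = F.v u * F.P t * F.q u T})
    (h : F.q u T + z ∈ J) : F.q u T ∈ J := by
  by_cases hc : ∃ f, f ∉ T ∧ s f = u ∧ F.v (r f) ∉ J
  · obtain ⟨f, hfT, rfl, hf⟩ := hc
    exfalso
    apply hf
    have hqe : F.q (s f) T * F.e f = F.e f := by rw [F.q_e_not_mem hfT, F.se]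
    have h1 := hr _ (F.e f) (hl (F.g f) _ h)
    rw [mul_add, add_mul, mul_assoc _ _ (F.e f), hqe, F.ge] at h1
    refine F.lemmaD hK J hl hr (r f) _ ?_ h1
    clear h h1
    induction hz using Submodule.span_induction with
    | mem x hx =>
      obtain ⟨t, ht, rfl⟩ := hx
      obtain ⟨f', t, rfl⟩ := List.exists_cons_of_ne_nil ht
      rw [← mul_assoc, ← mul_assoc, F.gs, mul_assoc _ _ (F.e f), hqe, P]
      by_cases hff : f = f'
      · subst hff
        refine Submodule.subset_span ⟨t ++ [f], by simp, ?_⟩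
        rw [← mul_assoc, F.ge, F.P_append, P, P, mul_one, mul_assoc, mul_assoc, mul_assoc, F.er]
      · rw [← mul_assoc, F.gne _ _ hff]; simp
    | zero => simp
    | add x y _ _ hx hy => rw [mul_add, add_mul]; exact add_mem hx hy
    | smul a x _ hx => rw [mul_smul_comm, smul_mul_assoc]; exact Submodule.smul_mem _ _ hx
  · push Not at hc
    have h1 := hl (F.q u T) _ h
    rw [mul_add, F.q_q] at h1
    have h2 : F.q u T * z ∈ J := by
      clear h h1
      induction hz using Submodule.span_induction with
      | mem x hx =>
        obtain ⟨t, ht, rfl⟩ := hx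
        obtain ⟨f, t, rfl⟩ := List.exists_cons_of_ne_nil ht
        rw [← mul_assoc, ← mul_assoc, F.q_v, P, ← mul_assoc]
        apply hr
        apply hr
        by_cases hfT : f ∈ T
        · rw [F.q_e_mem hfT]; exact zero_mem _
        · rw [F.q_e_not_mem hfT]
          by_cases hs : s f = u
          · rw [← F.er, ← mul_assoc]
            exact hl _ _ (hc f hfT hs)
          · rw [F.ve_ne (Ne.symm hs)]; exact zero_mem _
      | zero => simp
      | add x y _ _ hx hy => rw [mul_add]; exact add_mem hx hy
      | smul a x _ hx => rw [mul_smul_comm]; exact Submodule.smul_mem _ _ hx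
    simpa using sub_mem h1 h2

/-- The part of `J` spanned by monomials built on idempotents of `J`. -/
def J0 (J : Submodule K A) : Submodule K A :=
  Submodule.span K {x | ∃ a b u T, F.q u T ∈ J ∧ x = F.P a * F.q u T * F.S b}

/-- Span of monomials with bounded ghost length. -/
def W (K : Type) [Field K] [Algebra K A] (n : ℕ) : Submodule K A :=
  Submodule.span K {x | ∃ a b u, b.length ≤ n ∧ x = F.P a * F.v u * F.S b}

theorem claimB (hK : ConditionK s r) (J : Submodule K A) (hl : ∀ x y, y ∈ J → x * y ∈ J)
    (hr : ∀ x y, x ∈ J → x * y ∈ J) (u : V) (T : Finset E) (y : A) (hy : y ∈ F.W K 0)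
    (h : y * F.q u T ∈ J) : y * F.q u T ∈ F.J0 J := by
  classical
  have hrep : ∃ c : List E →₀ K, y * F.q u T = c.sum fun a k => k • (F.P a * F.q u T) := by
    clear h
    induction hy using Submodule.span_induction with
    | mem x hx =>
      obtain ⟨a, b, w, hb, rfl⟩ := hx
      obtain rfl : b = [] := by simpa using hb
      by_cases hw : w = u
      · subst hw
        refine ⟨Finsupp.single a 1, ?_⟩
        rw [Finsupp.sum_single_index (by simp), S, mul_one, mul_assoc, F.v_q, one_smul]
      · refine ⟨0, ?_⟩
        rw [← F.v_q, S, mul_one, mul_assoc, ← mul_assoc (F.v w), F.vw _ _ hw]; simp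
    | zero => exact ⟨0, by simp⟩
    | add x y _ _ hx hy =>
      obtain ⟨c, hc⟩ := hx
      obtain ⟨d, hd⟩ := hy
      refine ⟨c + d, ?_⟩
      rw [Finsupp.sum_add_index' (by simp) (by intros; rw [add_smul]), add_mul, hc, hd]
    | smul k x _ hx =>
      obtain ⟨c, hc⟩ := hx
      refine ⟨k • c, ?_⟩
      rw [Finsupp.sum_smul_index (by simp), smul_mul_assoc, hc, Finsupp.smul_sum]
      simp only [mul_smul]
  obtain ⟨c, hc⟩ := hrep
  by_cases hq : F.q u T ∈ J
  · rw [hc]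
    refine Submodule.sum_mem _ fun a _ => Submodule.smul_mem _ _ (Submodule.subset_span ?_)
    exact ⟨a, [], u, T, hq, by simp [S]⟩
  -- otherwise the element vanishes
  set D := c.support.filter (fun a => ∃ w, IsP s r w a u) with hD
  have hsum : y * F.q u T = ∑ a ∈ D, c a • (F.P a * F.q u T) := by
    rw [hc, Finsupp.sum, hD, Finset.sum_filter]
    refine Finset.sum_congr rfl fun a _ => ?_
    split_ifs with hp
    · rfl
    · rcases F.dich a u with h' | h'
      · exact absurd h' hp
      · rw [← F.v_q, ← mul_assoc, h'.1]; simp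
  by_cases hDe : D = ∅
  · rw [hsum, hDe]; simp
  exfalso
  apply hq
  obtain ⟨a, haD, hmin⟩ := Finset.exists_min_image D List.length (Finset.nonempty_iff_ne_empty.2 hDe)
  have haD' := haD
  rw [hD, Finset.mem_filter] at haD'
  obtain ⟨hac, w, hw⟩ := haD'
  have hca : c a ≠ 0 := by simpa using hac
  have h1 := Submodule.smul_mem _ (c a)⁻¹ (hl (F.S a * F.v w) _ h)
  have h2 : (c a)⁻¹ • (F.S a * F.v w * (y * F.q u T)) = F.q u T +
      ∑ b ∈ D.erase a, ((c a)⁻¹ * c b) • (F.S a * F.v w * F.P b * F.q u T) := by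
    rw [hsum, ← Finset.add_sum_erase _ _ haD, mul_add, smul_add, Finset.mul_sum, Finset.smul_sum]
    congr 1
    · rw [mul_smul_comm, smul_smul, inv_mul_cancel₀ hca, one_smul, ← mul_assoc, F.SvP hw, F.v_q]
    · refine Finset.sum_congr rfl fun b _ => ?_
      rw [mul_smul_comm, smul_smul, ← mul_assoc]
  rw [h2] at h1
  refine F.lemmaC hK J hl hr u T _ ?_ h1
  refine Submodule.sum_mem _ fun b hb => Submodule.smul_mem _ _ ?_
  rw [Finset.mem_erase] at hb
  rcases F.SvP_cases (b := b) hw with h0 | ⟨t, rfl, ht⟩ | ⟨t, ht, rfl⟩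
  · rw [h0]; simp
  · refine Submodule.subset_span ⟨t, ?_, by rw [ht]⟩
    rintro rfl
    simp at hb
  · have := hmin b hb.2
    rw [List.length_append] at this
    have := List.length_pos_iff.2 ht
    omega

theorem W_mul_e (n : ℕ) (f : E) (x : A) (hx : x ∈ F.W K (n + 1)) : x * F.e f ∈ F.W K n := by
  induction hx using Submodule.span_induction with
  | mem x hx =>
    obtain ⟨a, b, u, hb, rfl⟩ := hx
    cases b with
    | nil =>
      rw [S, mul_one, mul_assoc]
      by_cases hu : u = s f
      · refine Submodule.subset_span ⟨a ++ [f], [], r f, by simp, ?_⟩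
        rw [hu, F.se, F.P_append, P, P, S, mul_one, mul_one, mul_assoc, F.er]
      · rw [F.ve_ne hu]; simp
    | cons f' b =>
      rw [S, mul_assoc, mul_assoc (F.S b)]
      by_cases hf : f' = f
      · subst hf
        rw [F.ge]
        rw [List.length_cons] at hb
        by_cases hp : IsP s r (r f') b u
        · refine Submodule.subset_span ⟨a, b, u, by omega, ?_⟩
          rw [← F.vS hp, mul_assoc, mul_assoc, ← mul_assoc (F.v u), F.vv]
        · rw [mul_assoc, ← mul_assoc (F.v u), F.vSv_zero hp]; simp
      · rw [F.gne _ _ hf]; simp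
  | zero => simp
  | add x y _ _ hx hy => rw [add_mul]; exact add_mem hx hy
  | smul k x _ hx => rw [smul_mul_assoc]; exact Submodule.smul_mem _ _ hx

theorem W_q (n : ℕ) (u : V) (x : A) (hx : x ∈ F.W K n) :
    ∃ T0 : Finset E, ∃ y ∈ F.W K 0, ∀ T, T0 ⊆ T → x * F.q u T = y * F.q u T := by
  classical
  induction hx using Submodule.span_induction with
  | mem x hx =>
    obtain ⟨a, b, w, hb, rfl⟩ := hx
    cases b with
    | nil => exact ⟨∅, _, Submodule.subset_span ⟨a, [], w, by simp, rfl⟩, fun _ _ => rfl⟩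
    | cons f b =>
      refine ⟨{f}, 0, zero_mem _, fun T hT => ?_⟩
      rw [S, mul_assoc, mul_assoc (F.S b), F.g_q_mem (f := f) (hT (by simp))]; simp
  | zero => exact ⟨∅, 0, zero_mem _, fun _ _ => rfl⟩
  | add x y _ _ hx hy =>
    obtain ⟨T1, y1, h1, h1'⟩ := hx
    obtain ⟨T2, y2, h2, h2'⟩ := hy
    refine ⟨T1 ∪ T2, y1 + y2, add_mem h1 h2, fun T hT => ?_⟩
    rw [add_mul, add_mul, h1' T (Finset.union_subset_left hT),
      h2' T (Finset.union_subset_right hT)]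
  | smul k x _ hx =>
    obtain ⟨T1, y1, h1, h1'⟩ := hx
    refine ⟨T1, k • y1, Submodule.smul_mem _ _ h1, fun T hT => ?_⟩
    rw [smul_mul_assoc, smul_mul_assoc, h1' T hT]

theorem J0_mul_g (J : Submodule K A) (f : E) (x : A) (hx : x ∈ F.J0 J) :
    x * F.g f ∈ F.J0 J := by
  induction hx using Submodule.span_induction with
  | mem x hx =>
    obtain ⟨a, b, u, T, hq, rfl⟩ := hx
    exact Submodule.subset_span ⟨a, f :: b, u, T, hq, by simp only [S, mul_assoc]⟩
  | zero => simp
  | add x y _ _ hx hy => rw [add_mul]; exact add_mem hx hy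
  | smul k x _ hx => rw [smul_mul_assoc]; exact Submodule.smul_mem _ _ hx

theorem claimA (hK : ConditionK s r) (J : Submodule K A) (hl : ∀ x y, y ∈ J → x * y ∈ J)
    (hr : ∀ x y, x ∈ J → x * y ∈ J) (n : ℕ) (x : A) (hx : x ∈ F.W K n)
    (h : x ∈ J) : x ∈ F.J0 J := by
  induction n generalizing x with
  | zero =>
    rw [← mul_one x, F.one, Finset.mul_sum]
    refine Submodule.sum_mem _ fun u _ => ?_
    have : F.v u = F.q u ∅ := by simp [q]
    rw [this]
    exact F.claimB hK J hl hr u ∅ x hx (hr _ _ h)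
  | succ n ih =>
    rw [← mul_one x, F.one, Finset.mul_sum]
    refine Submodule.sum_mem _ fun u _ => ?_
    obtain ⟨T, y, hy, hT⟩ := F.W_q (n + 1) u x hx
    have e1 : x * F.v u = x * F.q u T + ∑ f ∈ T, x * F.v u * F.e f * F.g f := by
      rw [q, mul_sub, mul_sub, Finset.mul_sum, Finset.mul_sum, mul_one]
      simp only [mul_assoc, sub_add_cancel]
    rw [e1]
    refine add_mem ?_ (Submodule.sum_mem _ fun f _ => F.J0_mul_g J f _ ?_)
    · have h1 := hr _ (F.q u T) h
      rw [hT T subset_rfl] at h1 ⊢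
      exact F.claimB hK J hl hr u T y hy h1
    · by_cases hu : u = s f
      · rw [mul_assoc, hu, F.se]
        exact ih _ (F.W_mul_e n f x hx) (hr _ _ h)
      · rw [mul_assoc, F.ve_ne hu]; simp

/-! #### Local units -/

/-- diagonal monomials -/
def m (u : V) : List E → A
  | [] => F.v u
  | f :: b => F.e f * m u b * F.g f

theorem m_eq (u : V) (b : List E) : F.m u b = F.P b * F.v u * F.S b := by
  induction b with
  | nil => simp [m, P, S]
  | cons f b ih => rw [m, ih, P, S]; simp only [mul_assoc]

theorem m_v (u w : V) (b : List E) : F.v w * F.m u b = F.m u b * F.v w := by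
  cases b with
  | nil =>
    rw [m]
    by_cases h : u = w
    · rw [h]
    · rw [F.vw _ _ h, F.vw _ _ (Ne.symm h)]
  | cons f b =>
    rw [m]
    by_cases h : w = s f
    · rw [h, ← mul_assoc, ← mul_assoc, F.se, mul_assoc _ _ (F.v _), F.gs]
    · rw [← mul_assoc, ← mul_assoc, F.ve_ne h, mul_assoc _ _ (F.v _), F.gv_ne (Ne.symm h)]
      simp

theorem m_comm (u w : V) (a b : List E) : F.m u a * F.m w b = F.m w b * F.m u a := by
  induction a generalizing b with
  | nil => exact F.m_v w u b
  | cons f a ih =>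
    cases b with
    | nil => exact (F.m_v u w (f :: a)).symm
    | cons f' b =>
      have e1 : ∀ (f f' : E) (x y : A), F.e f * x * F.g f * (F.e f' * y * F.g f') =
          F.e f * x * (F.g f * F.e f') * y * F.g f' := by
        intros; simp only [mul_assoc]
      rw [m, m, e1, e1]
      by_cases h : f = f'
      · subst h
        rw [F.ge, mul_assoc _ _ (F.v _), mul_assoc _ _ (F.v _), ← F.m_v, ← F.m_v,
          mul_assoc (F.e f), mul_assoc (F.e f) (_ * _) (F.m u a), mul_assoc (F.v _),
          mul_assoc (F.v _), ih]
      · rw [F.gne _ _ h, F.gne _ _ (Ne.symm h)]; simp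

/-- the diagonal subring -/
def C : Subring A := Subring.closure {x | ∃ u b, x = F.m u b}

theorem C_comm {x y : A} (hx : x ∈ F.C) (hy : y ∈ F.C) : x * y = y * x := by
  have h1 : F.C ≤ Subring.centralizer {x | ∃ u b, x = F.m u b} := by
    refine Subring.closure_le.2 ?_
    rintro _ ⟨u, b, rfl⟩
    rw [SetLike.mem_coe, Subring.mem_centralizer_iff]
    rintro _ ⟨w, c, rfl⟩
    exact F.m_comm _ _ _ _
  have h2 : F.C ≤ Subring.centralizer (F.C : Set A) := by
    refine Subring.closure_le.2 ?_
    rintro _ ⟨u, b, rfl⟩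
    rw [SetLike.mem_coe, Subring.mem_centralizer_iff]
    intro z hz
    exact ((Subring.mem_centralizer_iff.1 (h1 hz)) _ ⟨u, b, rfl⟩).symm
  exact ((Subring.mem_centralizer_iff.1 (h2 hx)) _ hy).symm

theorem PqS_mem_C (b : List E) (u : V) (T : Finset E) : F.P b * F.q u T * F.S b ∈ F.C := by
  rw [q, mul_sub, mul_one, mul_sub, sub_mul, ← F.m_eq, Finset.mul_sum, Finset.mul_sum,
    Finset.sum_mul]
  refine sub_mem (Subring.subset_closure ⟨u, b, rfl⟩) (sum_mem fun f _ => ?_)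
  by_cases h : u = s f
  · refine Subring.subset_closure ⟨r f, b ++ [f], ?_⟩
    rw [m_eq, F.P_append, F.S_append, P, S, P, S, ← mul_assoc (F.v u), h, F.se, one_mul, mul_one,
      mul_assoc _ (F.e f) (F.v _), F.er]
    simp only [mul_assoc]
  · rw [← mul_assoc (F.v u), F.ve_ne h]; simp

theorem unit_right (J : Submodule K A) (hl : ∀ x y, y ∈ J → x * y ∈ J)
    (hr : ∀ x y, x ∈ J → x * y ∈ J) (x : A) (hx : x ∈ F.J0 J) :
    ∃ z ∈ J, z ∈ F.C ∧ x * z = x := by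
  induction hx using Submodule.span_induction with
  | mem x hx =>
    obtain ⟨a, b, u, T, hq, rfl⟩ := hx
    refine ⟨F.P b * F.q u T * F.S b, hr _ _ (hl _ _ hq), F.PqS_mem_C b u T, ?_⟩
    rcases F.dich b u with ⟨w, hw⟩ | ⟨-, h⟩
    · have e1 : F.S b * F.P b * F.q u T = F.q u T := by
        rw [← F.v_q, ← mul_assoc, mul_assoc (F.S b), ← F.vP hw, ← mul_assoc (F.S b), F.SvP hw,
          F.v_q]
      calc _ = F.P a * F.q u T * (F.S b * F.P b * F.q u T) * F.S b := by simp only [mul_assoc]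
        _ = _ := by rw [e1, mul_assoc (F.P a), F.q_q]
    · have : F.P a * F.q u T * F.S b = 0 := by
        rw [← F.q_v, mul_assoc, mul_assoc, h]; simp
      rw [this, zero_mul]
  | zero => exact ⟨0, zero_mem _, zero_mem _, by simp⟩
  | add x y _ _ hx hy =>
    obtain ⟨z, h1, h2, h3⟩ := hx
    obtain ⟨z', h1', h2', h3'⟩ := hy
    refine ⟨z + z' - z * z', sub_mem (add_mem h1 h1') (hr _ _ h1),
      sub_mem (add_mem h2 h2') (mul_mem h2 h2'), ?_⟩
    have e1 : x * (z + z' - z * z') = x := by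
      rw [mul_sub, mul_add, ← mul_assoc, h3]; simp
    have e2 : y * (z + z' - z * z') = y := by
      rw [F.C_comm h2 h2', mul_sub, mul_add, ← mul_assoc, h3']; simp
    rw [add_mul, e1, e2]
  | smul k x _ hx =>
    obtain ⟨z, h1, h2, h3⟩ := hx
    exact ⟨z, h1, h2, by rw [smul_mul_assoc, h3]⟩

theorem unit_left (J : Submodule K A) (hl : ∀ x y, y ∈ J → x * y ∈ J)
    (hr : ∀ x y, x ∈ J → x * y ∈ J) (x : A) (hx : x ∈ F.J0 J) :
    ∃ z ∈ J, z ∈ F.C ∧ z * x = x := by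
  induction hx using Submodule.span_induction with
  | mem x hx =>
    obtain ⟨b, a, u, T, hq, rfl⟩ := hx
    refine ⟨F.P b * F.q u T * F.S b, hr _ _ (hl _ _ hq), F.PqS_mem_C b u T, ?_⟩
    rcases F.dich b u with ⟨w, hw⟩ | ⟨h, -⟩
    · have e1 : F.S b * F.P b * F.q u T = F.q u T := by
        rw [← F.v_q, ← mul_assoc, mul_assoc (F.S b), ← F.vP hw, ← mul_assoc (F.S b), F.SvP hw,
          F.v_q]
      calc _ = F.P b * F.q u T * (F.S b * F.P b * F.q u T) * F.S a := by simp only [mul_assoc]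
        _ = _ := by rw [e1, mul_assoc (F.P b), F.q_q]
    · have : F.P b * F.q u T * F.S a = 0 := by
        rw [← F.v_q, ← mul_assoc, h]; simp
      rw [this, mul_zero]
  | zero => exact ⟨0, zero_mem _, zero_mem _, by simp⟩
  | add x y _ _ hx hy =>
    obtain ⟨z, h1, h2, h3⟩ := hx
    obtain ⟨z', h1', h2', h3'⟩ := hy
    refine ⟨z + z' - z * z', sub_mem (add_mem h1 h1') (hr _ _ h1),
      sub_mem (add_mem h2 h2') (mul_mem h2 h2'), ?_⟩
    have e2 : (z + z' - z * z') * y = y := by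
      rw [sub_mul, add_mul, mul_assoc, h3']; simp
    have e1 : (z + z' - z * z') * x = x := by
      rw [F.C_comm h2 h2', sub_mul, add_mul, mul_assoc, h3]; simp
    rw [mul_add, e1, e2]
  | smul k x _ hx =>
    obtain ⟨z, h1, h2, h3⟩ := hx
    exact ⟨z, h1, h2, by rw [mul_smul_comm, h3]⟩

/-! #### Spanning -/

/-- Span of all monomials. -/
def WT (K : Type) [Field K] [Algebra K A] : Submodule K A :=
  Submodule.span K {x | ∃ a b u, x = F.P a * F.v u * F.S b}

theorem WT_le (x : A) (hx : x ∈ F.WT K) : ∃ n, x ∈ F.W K n := by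
  have mono : ∀ {n k}, n ≤ k → F.W K n ≤ F.W K k := by
    intro n k h
    refine Submodule.span_mono ?_
    rintro _ ⟨a, b, u, hb, rfl⟩
    exact ⟨a, b, u, hb.trans h, rfl⟩
  induction hx using Submodule.span_induction with
  | mem x hx =>
    obtain ⟨a, b, u, rfl⟩ := hx
    exact ⟨b.length, Submodule.subset_span ⟨a, b, u, le_rfl, rfl⟩⟩
  | zero => exact ⟨0, zero_mem _⟩
  | add x y _ _ hx hy =>
    obtain ⟨n, hn⟩ := hx
    obtain ⟨k, hk⟩ := hy
    exact ⟨max n k, add_mem (mono (le_max_left _ _) hn) (mono (le_max_right _ _) hk)⟩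
  | smul k x _ hx =>
    obtain ⟨n, hn⟩ := hx
    exact ⟨n, Submodule.smul_mem _ _ hn⟩

theorem one_mem_WT : (1 : A) ∈ F.WT K := by
  rw [F.one]
  exact Submodule.sum_mem _ fun u _ => Submodule.subset_span ⟨[], [], u, by simp [P, S]⟩

theorem WT_mul_v (w : V) (x : A) (hx : x ∈ F.WT K) : x * F.v w ∈ F.WT K := by
  induction hx using Submodule.span_induction with
  | mem x hx =>
    obtain ⟨a, b, u, rfl⟩ := hx
    by_cases hp : IsP s r w b u
    · refine Submodule.subset_span ⟨a, b, u, ?_⟩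
      rw [mul_assoc, ← F.vS hp, mul_assoc, ← mul_assoc (F.v u), F.vv, mul_assoc]
    · rw [mul_assoc, mul_assoc, ← mul_assoc (F.v u), F.vSv_zero hp]; simp
  | zero => simp
  | add x y _ _ hx hy => rw [add_mul]; exact add_mem hx hy
  | smul k x _ hx => rw [smul_mul_assoc]; exact Submodule.smul_mem _ _ hx

theorem WT_mul_g (f : E) (x : A) (hx : x ∈ F.WT K) : x * F.g f ∈ F.WT K := by
  induction hx using Submodule.span_induction with
  | mem x hx =>
    obtain ⟨a, b, u, rfl⟩ := hx
    exact Submodule.subset_span ⟨a, f :: b, u, by simp only [S, mul_assoc]⟩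
  | zero => simp
  | add x y _ _ hx hy => rw [add_mul]; exact add_mem hx hy
  | smul k x _ hx => rw [smul_mul_assoc]; exact Submodule.smul_mem _ _ hx

theorem WT_mul_e (f : E) (x : A) (hx : x ∈ F.WT K) : x * F.e f ∈ F.WT K := by
  obtain ⟨n, hn⟩ := F.WT_le x hx
  have h1 : F.W K n ≤ F.W K (n + 1) := by
    refine Submodule.span_mono ?_
    rintro _ ⟨a, b, u, hb, rfl⟩
    exact ⟨a, b, u, by omega, rfl⟩
  have h2 : F.W K n ≤ F.WT K := by
    refine Submodule.span_mono ?_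
    rintro _ ⟨a, b, u, hb, rfl⟩
    exact ⟨a, b, u, rfl⟩
  exact h2 (F.W_mul_e n f x (h1 hn))

/-- The algebraic heart of the forward implication. -/
theorem main (hK : ConditionK s r)
    (hgen : ∀ W : Submodule K A, (∀ u, ∀ x ∈ W, x * F.v u ∈ W) → (∀ f, ∀ x ∈ W, x * F.e f ∈ W) →
      (∀ f, ∀ x ∈ W, x * F.g f ∈ W) → ∀ y, ∀ x ∈ W, x * y ∈ W) (a : A) :
    ∃ z ∈ Submodule.span K {z | ∃ x y, z = x * a * y}, ∃ z' ∈ Submodule.span K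
      {z | ∃ x y, z = x * a * y}, z * a = a ∧ a * z' = a := by
  set J := Submodule.span K {z | ∃ x y, z = x * a * y} with hJ
  have hl : ∀ x y, y ∈ J → x * y ∈ J := by
    intro x y hy
    induction hy using Submodule.span_induction with
    | mem y hy =>
      obtain ⟨b, c, rfl⟩ := hy
      exact Submodule.subset_span ⟨x * b, c, by simp only [mul_assoc]⟩
    | zero => simp
    | add y z _ _ hy hz => rw [mul_add]; exact add_mem hy hz
    | smul k y _ hy => rw [mul_smul_comm]; exact Submodule.smul_mem _ _ hy
  have hr : ∀ x y, x ∈ J → x * y ∈ J := by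
    intro x y hy
    induction hy using Submodule.span_induction with
    | mem z hy =>
      obtain ⟨b, c, rfl⟩ := hy
      exact Submodule.subset_span ⟨b, c * y, by simp only [mul_assoc]⟩
    | zero => simp
    | add y z _ _ hy hz => rw [add_mul]; exact add_mem hy hz
    | smul k y _ hy => rw [smul_mul_assoc]; exact Submodule.smul_mem _ _ hy
  have haJ : a ∈ J := Submodule.subset_span ⟨1, 1, by simp⟩
  have haW : a ∈ F.WT K := by
    have := hgen (F.WT K) F.WT_mul_v F.WT_mul_e F.WT_mul_g a 1 F.one_mem_WT
    rwa [one_mul] at this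
  obtain ⟨n, hn⟩ := F.WT_le a haW
  have ha0 := F.claimA hK J hl hr n a hn haJ
  obtain ⟨z, hz, -, hz'⟩ := F.unit_left J hl hr a ha0
  obtain ⟨y, hy, -, hy'⟩ := F.unit_right J hl hr a ha0
  exact ⟨z, hz, y, hy, hz', hy'⟩

end LFam

/-! ### The family in the Leavitt path algebra -/

/-- The canonical family in the Leavitt path algebra. -/
noncomputable def lpaFam (K V E : Type) [Field K] [Fintype V] (s r : E → V) :
    LFam s r (LeavittPathAlgebra K V E s r) where
  v u := RingQuot.mkAlgHom K (LPARel K V E s r) (FreeAlgebra.ι K (LPAGen.vertex u))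
  e f := RingQuot.mkAlgHom K (LPARel K V E s r) (FreeAlgebra.ι K (LPAGen.edge f))
  g f := RingQuot.mkAlgHom K (LPARel K V E s r) (FreeAlgebra.ι K (LPAGen.ghost f))
  vv u := by rw [← map_mul]; exact RingQuot.mkAlgHom_rel K (LPARel.vertex_idem u)
  vw u w h := by
    rw [← map_mul, ← map_zero (RingQuot.mkAlgHom K (LPARel K V E s r))]
    exact RingQuot.mkAlgHom_rel K (LPARel.vertex_orth u w h)
  se f := by rw [← map_mul]; exact RingQuot.mkAlgHom_rel K (LPARel.edge_src f)
  er f := by rw [← map_mul]; exact RingQuot.mkAlgHom_rel K (LPARel.edge_rng f)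
  rg f := by rw [← map_mul]; exact RingQuot.mkAlgHom_rel K (LPARel.ghost_rng f)
  gs f := by rw [← map_mul]; exact RingQuot.mkAlgHom_rel K (LPARel.ghost_src f)
  ge f := by rw [← map_mul]; exact RingQuot.mkAlgHom_rel K (LPARel.ck1_same f)
  gne f f' h := by
    rw [← map_mul, ← map_zero (RingQuot.mkAlgHom K (LPARel K V E s r))]
    exact RingQuot.mkAlgHom_rel K (LPARel.ck1_distinct f f' h)
  one := by
    rw [← map_sum, ← map_one (RingQuot.mkAlgHom K (LPARel K V E s r))]
    exact RingQuot.mkAlgHom_rel K LPARel.unit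

theorem lpa_forward (K V E : Type) [Field K] [Fintype V] (s r : E → V) (hK : ConditionK s r)
    (a : LeavittPathAlgebra K V E s r) :
    ∃ z ∈ Submodule.span K {z | ∃ x y, z = x * a * y}, ∃ z' ∈ Submodule.span K
      {z | ∃ x y, z = x * a * y}, z * a = a ∧ a * z' = a := by
  refine (lpaFam K V E s r).main hK ?_ a
  intro W hv he hg y
  obtain ⟨y, rfl⟩ := RingQuot.mkAlgHom_surjective K (LPARel K V E s r) y
  induction y using FreeAlgebra.induction with
  | grade0 k =>
    intro x hx
    rw [AlgHom.commutes, ← Algebra.commutes, ← Algebra.smul_def]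
    exact W.smul_mem _ hx
  | grade1 y =>
    cases y with
    | vertex u => exact hv u
    | edge f => exact he f
    | ghost f => exact hg f
  | mul b c hb hc =>
    intro x hx
    rw [map_mul, ← mul_assoc]
    exact hc _ (hb _ hx)
  | add b c hb hc =>
    intro x hx
    rw [map_add, mul_add]
    exact add_mem (hb _ hx) (hc _ hx)

theorem lpa_forward_left (K V E : Type) [Field K] [Fintype V] (s r : E → V)
    (hK : ConditionK s r)
    (I : Submodule (LeavittPathAlgebra K V E s r) (LeavittPathAlgebra K V E s r)) :
    AddSubgroup.closure {z | ∃ x ∈ I, ∃ y ∈ I, z = x * y} = I.toAddSubgroup := by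
  apply le_antisymm
  · rw [AddSubgroup.closure_le]
    rintro _ ⟨x, _, y, hy, rfl⟩
    exact I.smul_mem x hy
  · intro a ha
    obtain ⟨z, hz, -, -, hza, -⟩ := lpa_forward K V E s r hK a
    rw [← hza]
    clear hza
    have ha' : a ∈ I := ha
    have hk : ∀ k : K, k • a ∈ I := by
      intro k
      rw [Algebra.smul_def]
      exact I.smul_mem _ ha'
    have key : ∀ k : K, k • z * a ∈ AddSubgroup.closure {z | ∃ x ∈ I, ∃ y ∈ I, z = x * y} := by
      induction hz using Submodule.span_induction with
      | mem z hz =>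
        intro k
        obtain ⟨x, y, rfl⟩ := hz
        refine AddSubgroup.subset_closure ⟨x * (k • a), I.smul_mem x (hk k), y * a,
          I.smul_mem y ha', ?_⟩
        rw [mul_smul_comm, smul_mul_assoc, smul_mul_assoc, mul_assoc]
      | zero => intro k; rw [smul_zero, zero_mul]; exact zero_mem _
      | add x y _ _ hx hy => intro k; rw [smul_add, add_mul]; exact add_mem (hx k) (hy k)
      | smul c x _ hx => intro k; rw [smul_smul]; exact hx _
    simpa using key 1

theorem lpa_forward_right (K V E : Type) [Field K] [Fintype V] (s r : E → V)
    (hK : ConditionK s r)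
    (I : Submodule (LeavittPathAlgebra K V E s r)ᵐᵒᵖ (LeavittPathAlgebra K V E s r)) :
    AddSubgroup.closure {z | ∃ x ∈ I, ∃ y ∈ I, z = x * y} = I.toAddSubgroup := by
  have hmul : ∀ x ∈ I, ∀ y, x * y ∈ I := fun x hx y => I.smul_mem (MulOpposite.op y) hx
  apply le_antisymm
  · rw [AddSubgroup.closure_le]
    rintro _ ⟨x, hx, y, _, rfl⟩
    exact hmul x hx y
  · intro a ha
    obtain ⟨-, -, z, hz, -, hza⟩ := lpa_forward K V E s r hK a
    rw [← hza]
    clear hza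
    have ha' : a ∈ I := ha
    have hk : ∀ k : K, k • a ∈ I := by
      intro k
      rw [Algebra.smul_def, Algebra.commutes]
      exact hmul _ ha' _
    have key : ∀ k : K, a * k • z ∈ AddSubgroup.closure {z | ∃ x ∈ I, ∃ y ∈ I, z = x * y} := by
      induction hz using Submodule.span_induction with
      | mem z hz =>
        intro k
        obtain ⟨x, y, rfl⟩ := hz
        refine AddSubgroup.subset_closure ⟨a * x, hmul _ ha' _, k • a * y,
          hmul _ (hk k) _, ?_⟩
        rw [mul_smul_comm, smul_mul_assoc, mul_smul_comm]
        simp only [mul_assoc]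
      | zero => intro k; rw [smul_zero, mul_zero]; exact zero_mem _
      | add x y _ _ hx hy => intro k; rw [smul_add, mul_add]; exact add_mem (hx k) (hy k)
      | smul c x _ hx => intro k; rw [smul_smul]; exact hx _
    simpa using key 1

/-! ### The reverse implication: a representation on infinite paths -/

/-- Infinite paths which visit `v₀` infinitely often. -/
def IPath {V E : Type} (s r : E → V) (v₀ : V) : Type :=
  {p : ℕ → E // (∀ i, r (p i) = s (p (i + 1))) ∧ ∀ n, ∃ k, n ≤ k ∧ s (p k) = v₀}

namespace IPath

variable {V E : Type} {s r : E → V} {v₀ : V}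

/-- remove the first edge -/
def tail (p : IPath s r v₀) : IPath s r v₀ :=
  ⟨fun i => p.1 (i + 1), fun i => p.2.1 (i + 1), fun n => by
    obtain ⟨k, hk, h⟩ := p.2.2 (n + 1)
    refine ⟨k - 1, by omega, ?_⟩
    show s (p.1 (k - 1 + 1)) = v₀
    rw [Nat.sub_add_cancel (by omega)]
    exact h⟩

/-- prepend an edge -/
def cons (e : E) (p : IPath s r v₀) (h : r e = s (p.1 0)) : IPath s r v₀ :=
  ⟨fun i => Nat.casesOn i e p.1, fun i => by
    cases i with
    | zero => exact h
    | succ i => exact p.2.1 i, fun n => by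
    obtain ⟨k, hk, h⟩ := p.2.2 n
    exact ⟨k + 1, by omega, h⟩⟩

theorem cons_zero (e : E) (p : IPath s r v₀) (h : r e = s (p.1 0)) : (cons e p h).1 0 = e := rfl

theorem tail_cons (e : E) (p : IPath s r v₀) (h : r e = s (p.1 0)) : tail (cons e p h) = p := rfl

theorem cons_tail (p : IPath s r v₀) (h : r (p.1 0) = s (p.tail.1 0)) :
    cons (p.1 0) p.tail h = p := by
  apply Subtype.ext
  funext i
  cases i <;> rfl

theorem tail_iter (p : IPath s r v₀) (n i : ℕ) : (tail^[n] p).1 i = p.1 (n + i) := by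
  induction n generalizing p with
  | zero => simp
  | succ n ih =>
    rw [Function.iterate_succ_apply, ih]
    show p.1 (n + i + 1) = _
    exact congrArg p.1 (by omega)

end IPath

section Rep

variable {V E : Type} {s r : E → V} {v₀ : V} {R : Type} [CommRing R]

open Classical in
/-- the action of a vertex -/
noncomputable def opV (R : Type) [CommRing R] (v₀ : V) (s r : E → V) (u : V) :
    Module.End R (IPath s r v₀ → R) where
  toFun φ p := if s (p.1 0) = u then φ p else 0
  map_add' φ ψ := by funext p; simp only [Pi.add_apply]; split_ifs <;> simp
  map_smul' c φ := by funext p; simp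

open Classical in
/-- the action of an edge -/
noncomputable def opE (v₀ : V) (s r : E → V) (wt : E → R) (f : E) :
    Module.End R (IPath s r v₀ → R) where
  toFun φ p := if p.1 0 = f then wt f * φ p.tail else 0
  map_add' φ ψ := by funext p; simp only [Pi.add_apply]; split_ifs <;> simp [mul_add]
  map_smul' c φ := by funext p; simp [mul_left_comm]

open Classical in
/-- the action of a ghost edge -/
noncomputable def opG (v₀ : V) (s r : E → V) (wt : E → R) (f : E) :
    Module.End R (IPath s r v₀ → R) where
  toFun φ p := if h : r f = s (p.1 0) then wt f * φ (p.cons f h) else 0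
  map_add' φ ψ := by funext p; simp only [Pi.add_apply]; split_ifs <;> simp [mul_add]
  map_smul' c φ := by
    funext p
    simp only [Pi.smul_apply, smul_eq_mul, RingHom.id_apply]
    split_ifs <;> simp [mul_left_comm]

theorem opE_opG (wt wti : E → R) (hw : ∀ f, wt f * wti f = 1) (f : E) (φ : IPath s r v₀ → R)
    (p : IPath s r v₀) [Decidable (p.1 0 = f)] :
    (opE v₀ s r wt f * opG v₀ s r wti f) φ p = if p.1 0 = f then φ p else 0 := by
  rw [Module.End.mul_apply]
  simp only [opE, opG, LinearMap.coe_mk, AddHom.coe_mk]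
  by_cases h : p.1 0 = f
  · subst h
    have h' : r (p.1 0) = s (p.tail.1 0) := p.2.1 0
    rw [if_pos rfl, if_pos rfl, dif_pos h', IPath.cons_tail, ← mul_assoc, hw, one_mul]
  · rw [if_neg h, if_neg h]

/-- images of the generators -/
noncomputable def repGen (v₀ : V) (s r : E → V) (wt wti : E → R) :
    LPAGen V E → Module.End R (IPath s r v₀ → R)
  | .vertex u => opV R v₀ s r u
  | .edge f => opE v₀ s r wt f
  | .ghost f => opG v₀ s r wti f

theorem rep_rel {K : Type} [Field K] [Algebra K R] [Fintype V] (wt wti : E → R)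
    (hw : ∀ f, wt f * wti f = 1) ⦃x y : FreeAlgebra K (LPAGen V E)⦄ (h : LPARel K V E s r x y) :
    FreeAlgebra.lift K (repGen v₀ s r wt wti) x = FreeAlgebra.lift K (repGen v₀ s r wt wti) y := by
  classical
  cases h with
  | vertex_orth u w h =>
    simp only [map_mul, FreeAlgebra.lift_ι_apply, map_zero, repGen]
    refine LinearMap.ext fun φ => funext fun p => ?_
    rw [Module.End.mul_apply]
    simp only [opV, LinearMap.coe_mk, AddHom.coe_mk, LinearMap.zero_apply, Pi.zero_apply]
    grind
  | vertex_idem u =>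
    simp only [map_mul, FreeAlgebra.lift_ι_apply, repGen]
    refine LinearMap.ext fun φ => funext fun p => ?_
    rw [Module.End.mul_apply]
    simp only [opV, LinearMap.coe_mk, AddHom.coe_mk]
    grind
  | edge_src f =>
    simp only [map_mul, FreeAlgebra.lift_ι_apply, repGen]
    refine LinearMap.ext fun φ => funext fun p => ?_
    rw [Module.End.mul_apply]
    simp only [opV, opE, LinearMap.coe_mk, AddHom.coe_mk]
    grind
  | edge_rng f =>
    simp only [map_mul, FreeAlgebra.lift_ι_apply, repGen]
    refine LinearMap.ext fun φ => funext fun p => ?_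
    rw [Module.End.mul_apply]
    simp only [opV, opE, LinearMap.coe_mk, AddHom.coe_mk]
    have h' : r (p.1 0) = s (p.tail.1 0) := p.2.1 0
    grind
  | ghost_rng f =>
    simp only [map_mul, FreeAlgebra.lift_ι_apply, repGen]
    refine LinearMap.ext fun φ => funext fun p => ?_
    rw [Module.End.mul_apply]
    simp only [opV, opG, LinearMap.coe_mk, AddHom.coe_mk]
    grind
  | ghost_src f =>
    simp only [map_mul, FreeAlgebra.lift_ι_apply, repGen]
    refine LinearMap.ext fun φ => funext fun p => ?_
    rw [Module.End.mul_apply]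
    simp only [opV, opG, LinearMap.coe_mk, AddHom.coe_mk, IPath.cons_zero, if_true]
  | ck1_distinct f f' h =>
    simp only [map_mul, FreeAlgebra.lift_ι_apply, repGen, map_zero]
    refine LinearMap.ext fun φ => funext fun p => ?_
    rw [Module.End.mul_apply]
    simp only [opE, opG, LinearMap.coe_mk, AddHom.coe_mk, IPath.cons_zero]
    simp [h]
  | ck1_same f =>
    simp only [map_mul, FreeAlgebra.lift_ι_apply, repGen, map_zero]
    refine LinearMap.ext fun φ => funext fun p => ?_
    rw [Module.End.mul_apply]
    simp only [opV, opE, opG, LinearMap.coe_mk, AddHom.coe_mk, IPath.cons_zero, IPath.tail_cons,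
      if_true, ← mul_assoc, mul_comm (wti f), hw, one_mul]
    grind
  | ck2 u h hne =>
    simp only [map_sum, map_mul, FreeAlgebra.lift_ι_apply, repGen]
    refine LinearMap.ext fun φ => funext fun p => ?_
    rw [LinearMap.sum_apply, Finset.sum_apply]
    simp only [opE_opG wt wti hw]
    rw [Finset.sum_ite_eq]
    simp [opV]
  | unit =>
    simp only [map_sum, FreeAlgebra.lift_ι_apply, repGen, map_one]
    refine LinearMap.ext fun φ => funext fun p => ?_
    rw [LinearMap.sum_apply, Finset.sum_apply]
    simp [opV]

/-- The representation of the Leavitt path algebra on functions on infinite paths. -/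
noncomputable def rep {K : Type} [Field K] [Algebra K R] [Fintype V] (v₀ : V) (s r : E → V)
    (wt wti : E → R) (hw : ∀ f, wt f * wti f = 1) :
    LeavittPathAlgebra K V E s r →ₐ[K] Module.End R (IPath s r v₀ → R) :=
  RingQuot.liftAlgHom K ⟨FreeAlgebra.lift K (repGen v₀ s r wt wti), rep_rel wt wti hw⟩

theorem rep_v {K : Type} [Field K] [Algebra K R] [Fintype V]
    (wt wti : E → R) (hw : ∀ f, wt f * wti f = 1) (u : V) :
    rep v₀ s r wt wti hw ((lpaFam K V E s r).v u) = opV R v₀ s r u := by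
  unfold rep lpaFam
  rw [RingQuot.liftAlgHom_mkAlgHom_apply, FreeAlgebra.lift_ι_apply]
  rfl

theorem rep_e {K : Type} [Field K] [Algebra K R] [Fintype V]
    (wt wti : E → R) (hw : ∀ f, wt f * wti f = 1) (f : E) :
    rep v₀ s r wt wti hw ((lpaFam K V E s r).e f) = opE v₀ s r wt f := by
  unfold rep lpaFam
  rw [RingQuot.liftAlgHom_mkAlgHom_apply, FreeAlgebra.lift_ι_apply]
  rfl

theorem rep_P {K : Type} [Field K] [Algebra K R] [Fintype V]
    (wt wti : E → R) (hw : ∀ f, wt f * wti f = 1) (l : List E) (φ : IPath s r v₀ → R)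
    (p : IPath s r v₀) (h : ∀ (i : ℕ) (hi : i < l.length), p.1 i = l[i]) :
    rep v₀ s r wt wti hw ((lpaFam K V E s r).P l) φ p =
      (l.map wt).prod * φ (IPath.tail^[l.length] p) := by
  induction l generalizing p with
  | nil => simp [LFam.P]
  | cons f l ih =>
    have h0 : p.1 0 = f := h 0 (by simp)
    have h1 : ∀ (i : ℕ) (hi : i < l.length), p.tail.1 i = l[i] := fun i hi =>
      h (i + 1) (by simpa using hi)
    rw [LFam.P, map_mul, Module.End.mul_apply, rep_e]
    simp only [opE, LinearMap.coe_mk, AddHom.coe_mk]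
    rw [if_pos h0, ih _ h1, List.map_cons, List.prod_cons, mul_assoc, List.length_cons,
      Function.iterate_succ_apply]

end Rep

theorem isP_seq {V E : Type} {s r : E → V} (k : ℕ) (p : ℕ → E)
    (hp : ∀ i, r (p i) = s (p (i + 1))) :
    IsP s r (s (p 0)) ((List.range k).map p) (s (p k)) := by
  induction k generalizing p with
  | zero => rfl
  | succ k ih =>
    rw [List.range_succ_eq_map, List.map_cons, List.map_map]
    refine ⟨rfl, ?_⟩
    rw [hp 0]
    exact ih (fun i => p (i + 1)) (fun i => hp (i + 1))

theorem starts_with {V E : Type} {s r : E → V} {v₀ : V} {c : List E}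
    (huniq : ∀ d, SC s r v₀ d → d = c) (p : IPath s r v₀) (h : s (p.1 0) = v₀) :
    (∀ (i : ℕ) (hi : i < c.length), p.1 i = (c)[i]) ∧ s (p.1 c.length) = v₀ := by
  classical
  have hex : ∃ k, 0 < k ∧ s (p.1 k) = v₀ := by
    obtain ⟨k, hk, h⟩ := p.2.2 1
    exact ⟨k, hk, h⟩
  obtain ⟨hk0, hk⟩ := Nat.find_spec hex
  have hmin := fun i => Nat.find_min hex (m := i)
  generalize Nat.find hex = k at hk0 hk hmin
  have hP := isP_seq k p.1 p.2.1
  rw [h, hk] at hP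
  have hsc : SC s r v₀ ((List.range k).map p.1) := by
    obtain ⟨k, rfl⟩ : ∃ j, k = j + 1 := ⟨k - 1, by omega⟩
    refine ⟨hP, by simp, ?_⟩
    rw [List.range_succ_eq_map, List.map_cons, List.map_map, List.tail_cons]
    intro f hf
    rw [List.mem_map] at hf
    obtain ⟨i, hi, rfl⟩ := hf
    intro hh
    exact hmin (i + 1) (by have := List.mem_range.1 hi; omega) ⟨by omega, hh⟩
  have := huniq _ hsc
  subst this
  constructor
  · intro i hi
    simp
  · simpa using hk

theorem drop_eq {V E : Type} {s r : E → V} {v₀ : V} {c : List E} (hc : c ≠ [])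
    (huniq : ∀ d, SC s r v₀ d → d = c) (p : IPath s r v₀) (h : s (p.1 0) = v₀) :
    IPath.tail^[c.length] p = p := by
  have hlen := List.length_pos_iff.2 hc
  have key : ∀ (i : ℕ) (p p' : IPath s r v₀), s (p.1 0) = v₀ → s (p'.1 0) = v₀ →
      p.1 i = p'.1 i := by
    intro i
    induction i using Nat.strong_induction_on with
    | _ i ih =>
      intro p p' h h'
      obtain ⟨h1, h2⟩ := starts_with huniq p h
      obtain ⟨h1', h2'⟩ := starts_with huniq p' h'
      by_cases hi : i < c.length
      · rw [h1 i hi, h1' i hi]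
      · have := ih (i - c.length) (by omega) (IPath.tail^[c.length] p) (IPath.tail^[c.length] p')
          (by rw [IPath.tail_iter]; exact h2) (by rw [IPath.tail_iter]; exact h2')
        rw [IPath.tail_iter, IPath.tail_iter, Nat.add_sub_cancel' (by omega)] at this
        exact this
  apply Subtype.ext
  funext i
  refine key i _ _ ?_ h
  rw [IPath.tail_iter]
  exact (starts_with huniq p h).2

theorem exists_ipath {V E : Type} {s r : E → V} {v₀ : V} {c : List E} (hc : SC s r v₀ c) :
    ∃ p : IPath s r v₀, s (p.1 0) = v₀ := by
  obtain ⟨hne, h1, h2, h3, -⟩ := sc_iff.1 hc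
  have hlen := List.length_pos_iff.2 hne
  have hm : ∀ i, i % c.length < c.length := fun i => Nat.mod_lt _ hlen
  have hhead : s ((c)[0]'hlen) = v₀ := by rw [← h3, List.head_eq_getElem]
  have hz : ∀ j (hj : j < c.length), j = 0 → s ((c)[j]) = v₀ := by
    rintro j hj rfl; exact hhead
  refine ⟨⟨fun i => (c)[i % c.length]'(hm i), fun i => ?_, fun n => ?_⟩, ?_⟩
  · by_cases hi : i % c.length + 1 < c.length
    · have := h1 (i % c.length) hi
      rw [this]
      congr 2
      rw [Nat.add_mod, Nat.mod_eq_of_lt (a := 1) (by omega), Nat.mod_eq_of_lt hi]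
    · have hi' : i % c.length = c.length - 1 := by have := hm i; omega
      have e0 : (i + 1) % c.length = 0 := by
        have := Nat.div_add_mod i c.length
        rw [← this, hi', add_assoc, Nat.sub_add_cancel hlen, Nat.mul_add_mod, Nat.mod_self]
      rw [hz _ _ e0, ← h3, ← h2, List.getLast_eq_getElem]
      simp only [hi']
  · refine ⟨c.length * n, Nat.le_mul_of_pos_left n hlen, hz _ _ (by simp)⟩
  · exact hz _ _ (by simp)

theorem eps_kill {R M : Type} [CommRing R] [AddCommGroup M] [Module R M] {ε : R}
    (h : ε * ε = 0) (x y T : Module.End R M) : x * -(ε • T) * (y * -(ε • T)) = 0 := by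
  rw [mul_neg, mul_neg, neg_mul_neg, mul_smul_comm, mul_smul_comm, smul_mul_assoc,
    mul_smul_comm, smul_smul, h, zero_smul]

theorem lpa_reverse (K V E : Type) [Field K] [Fintype V] (s r : E → V)
    (h : ∀ I : Submodule (LeavittPathAlgebra K V E s r) (LeavittPathAlgebra K V E s r),
      AddSubgroup.closure {z | ∃ x ∈ I, ∃ y ∈ I, z = x * y} = I.toAddSubgroup) :
    ConditionK s r := by
  classical
  rintro v₀ ⟨c, hc⟩
  by_contra hcon
  have huniq : ∀ d, SC s r v₀ d → d = c := by
    intro d hd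
    by_contra hdc
    exact hcon ⟨d, c, hdc, sc_iff.1 hd, hc⟩
  rw [← sc_iff] at hc
  obtain ⟨e₀, c', rfl⟩ := List.exists_cons_of_ne_nil hc.2.1
  let R := DualNumber K
  let ε : R := DualNumber.eps
  have hεε : ε * ε = 0 := DualNumber.eps_mul_eps
  let wt : E → R := fun f => if f = e₀ then 1 + ε else 1
  let wti : E → R := fun f => if f = e₀ then 1 - ε else 1
  have hw : ∀ f, wt f * wti f = 1 := by
    intro f
    simp only [wt, wti]
    split_ifs
    · linear_combination -hεε
    · simp
  let F := lpaFam K V E s r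
  let ρ := rep (K := K) v₀ s r wt wti hw
  let a := F.v v₀ - F.v v₀ * F.P (e₀ :: c')
  have hprod : ((e₀ :: c').map wt).prod = 1 + ε := by
    have : (c'.map wt).prod = 1 := by
      apply List.prod_eq_one
      intro x hx
      obtain ⟨f, hf, rfl⟩ := List.mem_map.1 hx
      have h1 : s f ≠ v₀ := hc.2.2 f hf
      have h2 : v₀ = s e₀ := hc.1.1
      have : f ≠ e₀ := by
        rintro rfl
        exact h1 h2.symm
      simp [wt, this]
    rw [List.map_cons, List.prod_cons, this]
    simp [wt]
  have hρa : ρ a = -(ε • opV R v₀ s r v₀) := by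
    refine LinearMap.ext fun φ => funext fun p => ?_
    have e1 : ρ a = opV R v₀ s r v₀ - opV R v₀ s r v₀ * ρ (F.P (e₀ :: c')) := by
      simp only [a, ρ, F, map_sub, map_mul, rep_v]
    rw [e1, LinearMap.sub_apply, Module.End.mul_apply, LinearMap.neg_apply, LinearMap.smul_apply]
    simp only [Pi.sub_apply, Pi.neg_apply, Pi.smul_apply, smul_eq_mul]
    simp only [opV, LinearMap.coe_mk, AddHom.coe_mk]
    split_ifs with hp
    · have e2 : ρ (F.P (e₀ :: c')) φ p = _ :=
        rep_P wt wti hw (e₀ :: c') φ p (starts_with huniq p hp).1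
      rw [e2, hprod, drop_eq hc.2.1 huniq p hp]
      ring
    · simp
  have hz : ρ a = 0 := by
    have ha : a ∈ AddSubgroup.closure {z | ∃ x ∈ Submodule.span (LeavittPathAlgebra K V E s r) {a},
        ∃ y ∈ Submodule.span (LeavittPathAlgebra K V E s r) {a}, z = x * y} := by
      rw [h]
      exact Submodule.mem_span_singleton_self a
    suffices key : ∀ z ∈ AddSubgroup.closure {z | ∃ x ∈ Submodule.span
        (LeavittPathAlgebra K V E s r) {a},
        ∃ y ∈ Submodule.span (LeavittPathAlgebra K V E s r) {a}, z = x * y}, ρ z = 0 from key a ha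
    intro z hz
    induction hz using AddSubgroup.closure_induction with
    | mem z hz =>
      obtain ⟨x, hx, y, hy, rfl⟩ := hz
      obtain ⟨b, rfl⟩ := Submodule.mem_span_singleton.1 hx
      obtain ⟨d, rfl⟩ := Submodule.mem_span_singleton.1 hy
      rw [smul_eq_mul, smul_eq_mul, map_mul, map_mul, map_mul, hρa]
      exact eps_kill hεε _ _ _
    | zero => exact map_zero _
    | add x y _ _ hx hy => rw [map_add, hx, hy, add_zero]
    | neg x _ hx => rw [map_neg, hx, neg_zero]
  obtain ⟨p, hp⟩ := exists_ipath hc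
  rw [hρa] at hz
  have := congrFun (LinearMap.congr_fun hz (fun _ => 1)) p
  rw [LinearMap.neg_apply, LinearMap.smul_apply] at this
  simp only [Pi.neg_apply, Pi.smul_apply, smul_eq_mul] at this
  simp only [opV, LinearMap.coe_mk, AddHom.coe_mk, if_pos hp] at this
  have h2 : ε = 0 := by simpa using this
  have h3 := congrArg TrivSqZeroExt.snd h2
  simp [ε] at h3

/-- For a directed graph `E` with finitely many vertices and a field `K`,
the Leavitt path algebra `L = L_K(E)` satisfies: `E` has Condition (K) if and only if `L`
is left and right weakly regular, i.e. `I² = I` (as additive span of products) for every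
left ideal and every right ideal `I` of `L`. -/
theorem lpa_conditionK_iff_weaklyRegular (K V E : Type) [Field K] [Fintype V]
    (s r : E → V) :
    ConditionK s r ↔
      ((∀ I : Submodule (LeavittPathAlgebra K V E s r) (LeavittPathAlgebra K V E s r),
          AddSubgroup.closure {z | ∃ x ∈ I, ∃ y ∈ I, z = x * y} = I.toAddSubgroup) ∧
        (∀ I : Submodule (LeavittPathAlgebra K V E s r)ᵐᵒᵖ (LeavittPathAlgebra K V E s r),
          AddSubgroup.closure {z | ∃ x ∈ I, ∃ y ∈ I, z = x * y} = I.toAddSubgroup)) := by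
  exact ⟨fun hK => ⟨lpa_forward_left K V E s r hK, lpa_forward_right K V E s r hK⟩,
    fun h => lpa_reverse K V E s r h.1⟩
end

section
/- Let E be a directed graph with E⁰ finite and K a field, and let L = L_K(E) be the (unital) Leavitt path algebra. Then the following are equivalent: (i) E satisfies Condition (L), i.e., every cycle in E has an exit; (ii) L is a Zorn ring, i.e., every left ideal of L containing a non-nilpotent element contains a nonzero idempotent; (iii) every nonzero element of L is the von Neumann inverse of another nonzero element, i.e., for every nonzero a ∈ L there exists a nonzero b ∈ L with bab = b. -/
/-- Condition (L): every cycle in the graph has an exit. -/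
def ConditionL {V E : Type} (s r : E → V) : Prop :=
  ∀ es : List E, IsCycle s r es → HasExit s r es


namespace LPAProof

/-- Paths from `v` to `w` as lists of edges. -/
def Pth {V E : Type} (s r : E → V) : V → List E → V → Prop
  | v, [], w => v = w
  | v, e :: l, w => s e = v ∧ Pth s r (r e) l w

/-- A generating Cuntz-Krieger family with nonzero vertices. -/
structure Fam (K : Type) {V E A : Type} [Field K] [Fintype V] [Ring A] [Algebra K A]
    (s r : E → V) (vx : V → A) (ed gh : E → A) : Prop where
  orth : ∀ v w, v ≠ w → vx v * vx w = 0
  idem : ∀ v, vx v * vx v = vx v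
  es : ∀ e, vx (s e) * ed e = ed e
  er : ∀ e, ed e * vx (r e) = ed e
  gr : ∀ e, vx (r e) * gh e = gh e
  gs : ∀ e, gh e * vx (s e) = gh e
  c1 : ∀ e f, e ≠ f → gh e * ed f = 0
  c2 : ∀ e, gh e * ed e = vx (r e)
  ck2 : ∀ v (h : {e : E | s e = v}.Finite), {e : E | s e = v}.Nonempty →
    vx v = ∑ e ∈ h.toFinset, ed e * gh e
  unit : 1 = ∑ v, vx v
  gen : ∀ S : Submodule K A, 1 ∈ S → (∀ v x, x ∈ S → vx v * x ∈ S) →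
    (∀ e x, x ∈ S → ed e * x ∈ S) → (∀ e x, x ∈ S → gh e * x ∈ S) → ∀ x, x ∈ S
  nz : ∀ v, vx v ≠ 0

/-- Product of the edges of a list. -/
def PP {E A : Type} [Ring A] (ed : E → A) : List E → A
  | [] => 1
  | e :: l => ed e * PP ed l

/-- Product of the ghost edges of a list, in reversed order. -/
def GG {E A : Type} [Ring A] (gh : E → A) : List E → A
  | [] => 1
  | e :: l => GG gh l * gh e

section Words
variable {E A : Type} [Ring A]

theorem PP_append (ed : E → A) (l m : List E) : PP ed (l ++ m) = PP ed l * PP ed m := by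
  induction l with
  | nil => simp [PP]
  | cons e l ih => simp [PP, ih, mul_assoc]

theorem GG_append (gh : E → A) (l m : List E) : GG gh (l ++ m) = GG gh m * GG gh l := by
  induction l with
  | nil => simp [GG]
  | cons e l ih => simp [GG, ih, mul_assoc]

end Words

section Paths
variable {V E : Type} {s r : E → V}

theorem Pth_append {v w : V} {l m : List E} :
    Pth s r v (l ++ m) w ↔ ∃ u, Pth s r v l u ∧ Pth s r u m w := by
  induction l generalizing v with
  | nil => simp [Pth]
  | cons e l ih => simp [Pth, ih, and_assoc]

theorem Pth_split {v w : V} {l : List E} (h : Pth s r v l w) (i : ℕ) (hi : i < l.length) :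
    Pth s r v (l.take i) (s l[i]) ∧ Pth s r (s l[i]) (l.drop i) w := by
  have h2 : l = l.take i ++ l.drop i := (List.take_append_drop i l).symm
  rw [h2, Pth_append] at h
  obtain ⟨u, h3, h4⟩ := h
  have h5 : l.drop i = l[i] :: l.drop (i+1) := List.drop_eq_getElem_cons hi
  have h6 : s l[i] = u := by
    rw [h5] at h4
    exact h4.1
  rw [h6]
  exact ⟨h3, h4⟩

theorem Pth_chain {v w : V} {l : List E} (h : Pth s r v l w) : IsPathChain s r l := by
  induction l generalizing v with
  | nil => intro i hi; simp at hi
  | cons e l ih =>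
    intro i hi
    cases i with
    | zero =>
      cases l with
      | nil => simp at hi
      | cons f l => exact h.2.1.symm
    | succ i => exact ih h.2 i (by simpa using hi)

theorem Pth_head {v w : V} {l : List E} (h : Pth s r v l w) (hne : l ≠ []) :
    s (l.head hne) = v := by
  cases l with
  | nil => simp at hne
  | cons e l => exact h.1

theorem Pth_last {v w : V} {l : List E} (h : Pth s r v l w) (hne : l ≠ []) :
    r (l.getLast hne) = w := by
  induction l generalizing v with
  | nil => simp at hne
  | cons e l ih =>
    cases l with
    | nil => exact h.2
    | cons f l => simpa using ih h.2 (by simp)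

/-- A vertex on a closed path is the base of a cycle. -/
theorem exists_cycle {v : V} {p : List E} (hp : p ≠ []) (h : Pth s r v p v) :
    ∃ es : List E, ∃ hne : es ≠ [], IsCycle s r es ∧ s (es.head hne) = v := by
  classical
  have hex : ∃ n, ∃ p : List E, p ≠ [] ∧ Pth s r v p v ∧ p.length = n := ⟨_, p, hp, h, rfl⟩
  obtain ⟨q, hq, hqv, hql⟩ := Nat.find_spec hex
  have hmin : ∀ q' : List E, q' ≠ [] → Pth s r v q' v → q.length ≤ q'.length := by
    intro q' h1 h2
    rw [hql]
    exact Nat.find_min' hex ⟨q', h1, h2, rfl⟩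
  refine ⟨q, hq, ⟨hq, Pth_chain hqv, ?_, ?_⟩, Pth_head hqv hq⟩
  · rw [Pth_last hqv hq, Pth_head hqv hq]
  · by_contra hnd
    rw [List.nodup_iff_getElem?_ne_getElem?] at hnd
    push Not at hnd
    obtain ⟨i, j, hij, hj, heq⟩ := hnd
    have hj' : j < q.length := by simpa using hj
    have hi' : i < q.length := by omega
    have heq' : s q[i] = s q[j] := by
      simpa [hi', hj'] using heq
    have h1 := (Pth_split hqv i hi').1
    have h2 := (Pth_split hqv j hj').2
    rw [heq'] at h1
    have h3 := hmin (q.take i ++ q.drop j) (by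
      intro h0
      have := congrArg List.length h0
      simp at this
      omega) (Pth_append.2 ⟨_, h1, h2⟩)
    simp at h3
    omega

/-- Periodic parametrization of a cycle. -/
theorem cycle_seq {es : List E} (hne : es ≠ []) (h : IsCycle s r es) :
    ∃ (n : ℕ) (c : ℕ → E), 0 < n ∧ n = es.length ∧ s (c 0) = s (es.head hne) ∧
      (∀ i, r (c i) = s (c (i+1))) ∧ (∀ i j, s (c i) = s (c j) → i % n = j % n) ∧
      (∀ i j, i % n = j % n → c i = c j) ∧ (∀ i (hi : i < es.length), c i = es[i]) ∧
      (∀ i, ∃ j, ∃ hj : j < es.length, c i = es[j]) := by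
  have hn : 0 < es.length := List.length_pos_iff.2 hne
  obtain ⟨_, hch, hcl, hnd⟩ := h
  refine ⟨es.length, fun i => es[i % es.length]'(Nat.mod_lt _ hn), hn, rfl, ?_, ?_, ?_, ?_, ?_, ?_⟩
  · simp [List.head_eq_getElem]
  · intro i
    dsimp only
    by_cases hi : i % es.length + 1 < es.length
    · have h1 : (i+1) % es.length = i % es.length + 1 := by
        rw [Nat.add_mod]
        by_cases h2 : es.length = 1
        · omega
        · rw [Nat.mod_eq_of_lt (show 1 < es.length by omega), Nat.mod_eq_of_lt hi]
      simp only [h1]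
      exact hch _ hi
    · have h0 := Nat.mod_lt i hn
      have h1 : i % es.length = es.length - 1 := by omega
      have h2 : (i+1) % es.length = 0 := by
        have := Nat.div_add_mod i es.length
        rw [h1] at this
        have h3 : i + 1 = es.length * (i / es.length + 1) := by
          rw [Nat.mul_add]; omega
        rw [h3]; simp
      simp only [h1, h2]
      rw [List.getLast_eq_getElem, List.head_eq_getElem] at hcl
      exact hcl
  · intro i j hij
    dsimp only at hij
    have := (List.nodup_iff_injective_getElem.1 hnd)
      (a₁ := ⟨i % es.length, by simpa using Nat.mod_lt _ hn⟩)
      (a₂ := ⟨j % es.length, by simpa using Nat.mod_lt _ hn⟩) (by simpa using hij)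
    simpa using this
  · intro i j hij
    simp [hij]
  · intro i hi
    simp [Nat.mod_eq_of_lt hi]
  · intro i
    exact ⟨i % es.length, Nat.mod_lt _ hn, rfl⟩

end Paths

set_option linter.unusedSectionVars false

section Main
variable {K V E A : Type} [Field K] [Fintype V] [Ring A] [Algebra K A]
  {s r : E → V} {vx : V → A} {ed gh : E → A}

theorem es0 (H : Fam K s r vx ed gh) {e : E} {v : V} (h : s e ≠ v) : vx v * ed e = 0 := by
  rw [← H.es e, ← mul_assoc, H.orth _ _ (Ne.symm h), zero_mul]

theorem er0 (H : Fam K s r vx ed gh) {e : E} {v : V} (h : r e ≠ v) : ed e * vx v = 0 := by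
  rw [← H.er e, mul_assoc, H.orth _ _ h, mul_zero]

theorem gs0 (H : Fam K s r vx ed gh) {e : E} {v : V} (h : s e ≠ v) : gh e * vx v = 0 := by
  rw [← H.gs e, mul_assoc, H.orth _ _ h, mul_zero]

theorem gr0 (H : Fam K s r vx ed gh) {e : E} {v : V} (h : r e ≠ v) : vx v * gh e = 0 := by
  rw [← H.gr e, ← mul_assoc, H.orth _ _ (Ne.symm h), zero_mul]

/-- Left multiplication of a real path by a vertex. -/
theorem vx_PP (H : Fam K s r vx ed gh) (v w : V) (l : List E) :
    vx v * (PP ed l * vx w) = 0 ∨ vx v * (PP ed l * vx w) = PP ed l * vx w := by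
  cases l with
  | nil =>
    by_cases h : v = w
    · right; subst h; simp [PP, H.idem]
    · left; simp [PP, H.orth _ _ h]
  | cons e l =>
    by_cases h : s e = v
    · right; subst h; simp only [PP]; rw [mul_assoc, ← mul_assoc, H.es]
    · left; simp only [PP]; rw [mul_assoc, ← mul_assoc, es0 H h, zero_mul]

theorem not_Pth (H : Fam K s r vx ed gh) {v w : V} {l : List E} (h : ¬ Pth s r v l w) :
    vx v * PP ed l * vx w = 0 := by
  induction l generalizing v with
  | nil => simp [PP]; exact H.orth _ _ h
  | cons e l ih =>
    simp only [PP]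
    by_cases h1 : s e = v
    · have h2 : ¬ Pth s r (r e) l w := fun h3 => h ⟨h1, h3⟩
      rw [← H.er e, mul_assoc (ed e), ← mul_assoc (vx v), mul_assoc, ih h2, mul_zero]
    · rw [← mul_assoc, es0 H h1, zero_mul, zero_mul]

theorem GG_PP (H : Fam K s r vx ed gh) {v w : V} {l : List E} (h : Pth s r v l w) :
    GG gh l * vx v * PP ed l = vx w := by
  induction l generalizing v with
  | nil => simp [GG, PP]; rw [show v = w from h]
  | cons e l ih =>
    obtain ⟨rfl, h⟩ := h
    simp only [GG, PP]
    rw [← ih h, ← H.c2 e, mul_assoc (GG gh l), H.gs]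
    simp only [mul_assoc]

theorem GG_PP_zero (H : Fam K s r vx ed gh) {q l : List E} (h1 : ¬ q <+: l) (h2 : ¬ l <+: q) :
    GG gh q * PP ed l = 0 := by
  induction q generalizing l with
  | nil => simp at h1
  | cons e q ih =>
    cases l with
    | nil => simp at h2
    | cons f l =>
      simp only [GG, PP]
      by_cases hef : e = f
      · subst hef
        have h1' : ¬ q <+: l := fun h => h1 (by simpa [List.cons_prefix_cons] using h)
        have h2' : ¬ l <+: q := fun h => h2 (by simpa [List.cons_prefix_cons] using h)
        have h3 : GG gh q * gh e * (ed e * PP ed l) = GG gh q * (vx (r e) * PP ed l) := by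
          rw [mul_assoc, ← mul_assoc (gh e), H.c2]
        rw [h3]
        cases l with
        | nil => simp at h2'
        | cons f l =>
          by_cases h4 : s f = r e
          · rw [← h4]
            have : vx (s f) * PP ed (f :: l) = PP ed (f :: l) := by
              simp only [PP]; rw [← mul_assoc, H.es]
            rw [this]
            exact ih h1' h2'
          · simp only [PP]
            rw [← mul_assoc (vx (r e)), es0 H h4]; simp
      · rw [mul_assoc, ← mul_assoc (gh e), H.c1 _ _ hef]; simp

/-- Left finiteness. -/
def FinL (ed gh : E → A) (b : A) : Prop :=
  ∃ F : Finset E, (∀ e ∉ F, gh e * b = 0) ∧ b = ∑ e ∈ F, ed e * (gh e * b)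

/-- Right finiteness. -/
def FinR (ed gh : E → A) (b : A) : Prop :=
  ∃ F : Finset E, (∀ e ∉ F, b * ed e = 0) ∧ b = ∑ e ∈ F, b * ed e * gh e

theorem FinL_add {b c : A} (hb : FinL ed gh b) (hc : FinL ed gh c) : FinL ed gh (b + c) := by
  classical
  obtain ⟨F, h1, h2⟩ := hb
  obtain ⟨F', h1', h2'⟩ := hc
  refine ⟨F ∪ F', ?_, ?_⟩
  · intro e he
    simp only [Finset.mem_union, not_or] at he
    rw [mul_add, h1 e he.1, h1' e he.2, add_zero]
  · simp only [mul_add, Finset.sum_add_distrib]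
    congr 1
    · conv_lhs => rw [h2]
      apply Finset.sum_subset Finset.subset_union_left
      intro e _ he
      rw [h1 e he, mul_zero]
    · conv_lhs => rw [h2']
      apply Finset.sum_subset Finset.subset_union_right
      intro e _ he
      rw [h1' e he, mul_zero]

theorem FinR_add {b c : A} (hb : FinR ed gh b) (hc : FinR ed gh c) : FinR ed gh (b + c) := by
  classical
  obtain ⟨F, h1, h2⟩ := hb
  obtain ⟨F', h1', h2'⟩ := hc
  refine ⟨F ∪ F', ?_, ?_⟩
  · intro e he
    simp only [Finset.mem_union, not_or] at he
    rw [add_mul, h1 e he.1, h1' e he.2, add_zero]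
  · simp only [add_mul, Finset.sum_add_distrib]
    congr 1
    · conv_lhs => rw [h2]
      apply Finset.sum_subset Finset.subset_union_left
      intro e _ he
      rw [h1 e he, zero_mul]
    · conv_lhs => rw [h2']
      apply Finset.sum_subset Finset.subset_union_right
      intro e _ he
      rw [h1' e he, zero_mul]

theorem FinL_smul {b : A} (k : K) (hb : FinL ed gh b) : FinL ed gh (k • b) := by
  obtain ⟨F, h1, h2⟩ := hb
  refine ⟨F, ?_, ?_⟩
  · intro e he
    rw [mul_smul_comm, h1 e he, smul_zero]
  · simp only [mul_smul_comm, ← Finset.smul_sum]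
    rw [← h2]

theorem FinR_smul {b : A} (k : K) (hb : FinR ed gh b) : FinR ed gh (k • b) := by
  obtain ⟨F, h1, h2⟩ := hb
  refine ⟨F, ?_, ?_⟩
  · intro e he
    rw [smul_mul_assoc, h1 e he, smul_zero]
  · simp only [smul_mul_assoc, ← Finset.smul_sum]
    rw [← h2]

theorem FinL_ed (H : Fam K s r vx ed gh) (e : E) (b : A) : FinL ed gh (ed e * b) := by
  refine ⟨{e}, ?_, ?_⟩
  · intro f hf
    rw [← mul_assoc, H.c1 f e (by simpa using hf), zero_mul]
  · rw [Finset.sum_singleton, ← mul_assoc (gh e), H.c2, ← mul_assoc, H.er]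

theorem FinR_gh (H : Fam K s r vx ed gh) (e : E) (b : A) : FinR ed gh (b * gh e) := by
  refine ⟨{e}, ?_, ?_⟩
  · intro f hf
    rw [mul_assoc, H.c1 e f (fun h => hf (by simp [h])), mul_zero]
  · rw [Finset.sum_singleton, mul_assoc b, H.c2, mul_assoc, H.gr]

theorem FinL_zero : FinL ed gh (0 : A) := ⟨∅, by simp, by simp⟩
theorem FinR_zero : FinR ed gh (0 : A) := ⟨∅, by simp, by simp⟩

/-- Real elements. -/
def RS (K : Type) [Field K] [Algebra K A] (vx : V → A) (ed : E → A) : Submodule K A :=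
  Submodule.span K {x | ∃ l w, x = PP ed l * vx w}

/-- Real elements of bounded length ending in `v`. -/
def AN (K : Type) [Field K] [Algebra K A] (vx : V → A) (ed : E → A) (N : ℕ) (v : V) :
    Submodule K A :=
  Submodule.span K {x | ∃ l : List E, l.length ≤ N ∧ x = PP ed l * vx v}

/-- Real elements of bounded positive length ending in `v`. -/
def BN (K : Type) [Field K] [Algebra K A] (vx : V → A) (ed : E → A) (N : ℕ) (v : V) :
    Submodule K A :=
  Submodule.span K {x | ∃ l : List E, l ≠ [] ∧ l.length ≤ N ∧ x = PP ed l * vx v}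

/-- Elements of bounded ghost length. -/
def GS (K : Type) [Field K] [Algebra K A] (vx : V → A) (ed gh : E → A) (N : ℕ) :
    Submodule K A :=
  Submodule.span K {x | ∃ l w, ∃ l' : List E, l'.length ≤ N ∧ x = PP ed l * vx w * GG gh l'}

theorem exists_vx (H : Fam K s r vx ed gh) {x : A} (hx : x ≠ 0) : ∃ v, x * vx v ≠ 0 := by
  by_contra h
  push Not at h
  apply hx
  rw [← mul_one x, H.unit, Finset.mul_sum]
  exact Finset.sum_eq_zero fun v _ => h v

theorem GS_mono {m n : ℕ} (h : m ≤ n) : GS K vx ed gh m ≤ GS K vx ed gh n := by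
  apply Submodule.span_mono
  rintro x ⟨l, w, l', h1, rfl⟩
  exact ⟨l, w, l', h1.trans h, rfl⟩

theorem AN_mono {m n : ℕ} (v : V) (h : m ≤ n) : AN K vx ed m v ≤ AN K vx ed n v := by
  apply Submodule.span_mono
  rintro x ⟨l, h1, rfl⟩
  exact ⟨l, h1.trans h, rfl⟩

theorem vx_RS (H : Fam K s r vx ed gh) (v : V) {x : A} (hx : x ∈ RS K vx ed) :
    vx v * x ∈ RS K vx ed := by
  induction hx using Submodule.span_induction with
  | mem x h =>
    obtain ⟨l, w, rfl⟩ := h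
    rcases vx_PP H v w l with h | h
    · rw [h]; exact zero_mem _
    · rw [h]; exact Submodule.subset_span ⟨l, w, rfl⟩
  | zero => simp
  | add x y _ _ hx hy => rw [mul_add]; exact add_mem hx hy
  | smul k x _ hx => rw [mul_smul_comm]; exact Submodule.smul_mem _ _ hx

theorem ed_RS (e : E) {x : A} (hx : x ∈ RS K vx ed) :
    ed e * x ∈ RS K vx ed := by
  induction hx using Submodule.span_induction with
  | mem x h =>
    obtain ⟨l, w, rfl⟩ := h
    exact Submodule.subset_span ⟨e :: l, w, by simp [PP, mul_assoc]⟩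
  | zero => simp
  | add x y _ _ hx hy => rw [mul_add]; exact add_mem hx hy
  | smul k x _ hx => rw [mul_smul_comm]; exact Submodule.smul_mem _ _ hx

theorem RS_vx (H : Fam K s r vx ed gh) (v : V) {x : A} (hx : x ∈ RS K vx ed) :
    x * vx v ∈ RS K vx ed := by
  induction hx using Submodule.span_induction with
  | mem x h =>
    obtain ⟨l, w, rfl⟩ := h
    by_cases h : w = v
    · subst h; rw [mul_assoc, H.idem]; exact Submodule.subset_span ⟨l, w, rfl⟩
    · rw [mul_assoc, H.orth _ _ h, mul_zero]; exact zero_mem _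
  | zero => simp
  | add x y _ _ hx hy => rw [add_mul]; exact add_mem hx hy
  | smul k x _ hx => rw [smul_mul_assoc]; exact Submodule.smul_mem _ _ hx

theorem RS_ed (H : Fam K s r vx ed gh) (e : E) {x : A} (hx : x ∈ RS K vx ed) :
    x * ed e ∈ RS K vx ed := by
  induction hx using Submodule.span_induction with
  | mem x h =>
    obtain ⟨l, w, rfl⟩ := h
    by_cases h : s e = w
    · subst h
      refine Submodule.subset_span ⟨l ++ [e], r e, ?_⟩
      rw [mul_assoc, H.es, PP_append]
      simp [PP, mul_assoc, H.er]
    · rw [mul_assoc, es0 H h, mul_zero]; exact zero_mem _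
  | zero => simp
  | add x y _ _ hx hy => rw [add_mul]; exact add_mem hx hy
  | smul k x _ hx => rw [smul_mul_assoc]; exact Submodule.smul_mem _ _ hx

theorem gh_RS_ed (H : Fam K s r vx ed gh) (e f : E) {x : A} (hx : x ∈ RS K vx ed) :
    gh e * (x * ed f) ∈ RS K vx ed := by
  induction hx using Submodule.span_induction with
  | mem x h =>
    obtain ⟨l, w, rfl⟩ := h
    by_cases h : s f = w
    · subst h
      have h1 : PP ed l * vx (s f) * ed f = PP ed (l ++ [f]) * vx (r f) := by
        rw [mul_assoc, H.es, PP_append]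
        simp [PP, mul_assoc, H.er]
      rw [h1]
      obtain ⟨g, m, hgm⟩ := List.exists_cons_of_ne_nil (show l ++ [f] ≠ [] by simp)
      rw [hgm]
      simp only [PP]
      by_cases hg : e = g
      · subst hg
        rw [mul_assoc (ed e), ← mul_assoc (gh e), H.c2]
        exact vx_RS H _ (Submodule.subset_span ⟨m, r f, rfl⟩)
      · rw [mul_assoc (ed g), ← mul_assoc (gh e), H.c1 _ _ hg, zero_mul]
        exact zero_mem _
    · rw [mul_assoc, es0 H h, mul_zero, mul_zero]; exact zero_mem _
  | zero => simp
  | add x y _ _ hx hy => rw [add_mul, mul_add]; exact add_mem hx hy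
  | smul k x _ hx => rw [smul_mul_assoc, mul_smul_comm]; exact Submodule.smul_mem _ _ hx

theorem RS_AN (H : Fam K s r vx ed gh) (v : V) {x : A} (hx : x ∈ RS K vx ed) :
    ∃ N, x * vx v ∈ AN K vx ed N v := by
  induction hx using Submodule.span_induction with
  | mem x h =>
    obtain ⟨l, w, rfl⟩ := h
    refine ⟨l.length, ?_⟩
    by_cases h : w = v
    · subst h; rw [mul_assoc, H.idem]; exact Submodule.subset_span ⟨l, le_rfl, rfl⟩
    · rw [mul_assoc, H.orth _ _ h, mul_zero]; exact zero_mem _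
  | zero => exact ⟨0, by simp⟩
  | add x y _ _ hx hy =>
    obtain ⟨N, hN⟩ := hx
    obtain ⟨M, hM⟩ := hy
    refine ⟨max N M, ?_⟩
    rw [add_mul]
    exact add_mem (AN_mono v (le_max_left _ _) hN) (AN_mono v (le_max_right _ _) hM)
  | smul k x _ hx =>
    obtain ⟨N, hN⟩ := hx
    exact ⟨N, by rw [smul_mul_assoc]; exact Submodule.smul_mem _ _ hN⟩

theorem mem_GS (H : Fam K s r vx ed gh) (x : A) : ∃ N, x ∈ GS K vx ed gh N := by
  let S : Submodule K A := Submodule.span K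
    {x | ∃ l w, ∃ l' : List E, x = PP ed l * vx w * GG gh l'}
  have hvx : ∀ v x, x ∈ S → vx v * x ∈ S := by
    intro v x hx
    induction hx using Submodule.span_induction with
    | mem x h =>
      obtain ⟨l, w, l', rfl⟩ := h
      rw [← mul_assoc]
      rcases vx_PP H v w l with h | h
      · rw [h, zero_mul]; exact zero_mem _
      · rw [h]; exact Submodule.subset_span ⟨l, w, l', rfl⟩
    | zero => simp
    | add x y _ _ hx hy => rw [mul_add]; exact add_mem hx hy
    | smul k x _ hx => rw [mul_smul_comm]; exact Submodule.smul_mem _ _ hx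
  have hS : x ∈ S := by
    apply H.gen S
    · rw [H.unit]
      exact sum_mem fun w _ => Submodule.subset_span ⟨[], w, [], by simp [PP, GG]⟩
    · exact hvx
    · intro e x hx
      induction hx using Submodule.span_induction with
      | mem x h =>
        obtain ⟨l, w, l', rfl⟩ := h
        exact Submodule.subset_span ⟨e :: l, w, l', by simp [PP, mul_assoc]⟩
      | zero => simp
      | add x y _ _ hx hy => rw [mul_add]; exact add_mem hx hy
      | smul k x _ hx => rw [mul_smul_comm]; exact Submodule.smul_mem _ _ hx
    · intro e x hx
      induction hx using Submodule.span_induction with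
      | mem x h =>
        obtain ⟨l, w, l', rfl⟩ := h
        cases l with
        | nil =>
          by_cases h : s e = w
          · subst h
            refine Submodule.subset_span ⟨[], r e, l' ++ [e], ?_⟩
            simp only [PP, one_mul, GG_append, GG]
            rw [← mul_assoc, H.gs, ← mul_assoc, H.gr]
          · simp only [PP, one_mul]
            rw [← mul_assoc, gs0 H h, zero_mul]; exact zero_mem _
        | cons f l =>
          by_cases h : e = f
          · subst h
            have : gh e * (PP ed (e :: l) * vx w * GG gh l') =
                vx (r e) * (PP ed l * vx w * GG gh l') := by
              rw [← H.c2]; simp only [PP, mul_assoc]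
            rw [this]
            exact hvx _ _ (Submodule.subset_span ⟨l, w, l', rfl⟩)
          · have : gh e * (PP ed (f :: l) * vx w * GG gh l') =
                gh e * ed f * (PP ed l * vx w * GG gh l') := by
              simp only [PP, mul_assoc]
            rw [this, H.c1 _ _ h, zero_mul]; exact zero_mem _
      | zero => simp
      | add x y _ _ hx hy => rw [mul_add]; exact add_mem hx hy
      | smul k x _ hx => rw [mul_smul_comm]; exact Submodule.smul_mem _ _ hx
  induction hS using Submodule.span_induction with
  | mem x h =>
    obtain ⟨l, w, l', rfl⟩ := h
    exact ⟨l'.length, Submodule.subset_span ⟨l, w, l', le_rfl, rfl⟩⟩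
  | zero => exact ⟨0, zero_mem _⟩
  | add x y _ _ hx hy =>
    obtain ⟨N, hN⟩ := hx
    obtain ⟨M, hM⟩ := hy
    exact ⟨max N M, add_mem (GS_mono (le_max_left _ _) hN) (GS_mono (le_max_right _ _) hM)⟩
  | smul k x _ hx =>
    obtain ⟨N, hN⟩ := hx
    exact ⟨N, Submodule.smul_mem _ _ hN⟩

theorem AN_split {N : ℕ} {v : V} {y : A} (hy : y ∈ AN K vx ed N v) :
    ∃ k : K, ∃ b ∈ BN K vx ed N v, y = k • vx v + b := by
  induction hy using Submodule.span_induction with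
  | mem x h =>
    obtain ⟨l, hl, rfl⟩ := h
    by_cases h : l = []
    · subst h
      exact ⟨1, 0, zero_mem _, by simp [PP]⟩
    · exact ⟨0, _, Submodule.subset_span ⟨l, h, hl, rfl⟩, by simp⟩
  | zero => exact ⟨0, 0, zero_mem _, by simp⟩
  | add x y _ _ hx hy =>
    obtain ⟨k, b, hb, rfl⟩ := hx
    obtain ⟨k', b', hb', rfl⟩ := hy
    exact ⟨k + k', b + b', add_mem hb hb', by rw [add_smul]; abel⟩
  | smul c x _ hx =>
    obtain ⟨k, b, hb, rfl⟩ := hx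
    exact ⟨c * k, c • b, Submodule.smul_mem _ _ hb, by rw [smul_add, smul_smul]⟩

theorem BN_FinL (H : Fam K s r vx ed gh) {N : ℕ} {v : V} {b : A} (hb : b ∈ BN K vx ed N v) :
    FinL ed gh b := by
  induction hb using Submodule.span_induction with
  | mem x h =>
    obtain ⟨l, hne, hl, rfl⟩ := h
    cases l with
    | nil => simp at hne
    | cons e l => simp only [PP, mul_assoc]; exact FinL_ed H _ _
  | zero => exact FinL_zero
  | add x y _ _ hx hy => exact FinL_add hx hy
  | smul c x _ hx => exact FinL_smul c hx

theorem gh_BN (H : Fam K s r vx ed gh) {N : ℕ} {v : V} {b : A} (e : E)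
    (hb : b ∈ BN K vx ed (N+1) v) : gh e * b ∈ AN K vx ed N v := by
  induction hb using Submodule.span_induction with
  | mem x h =>
    obtain ⟨l, hne, hl, rfl⟩ := h
    cases l with
    | nil => simp at hne
    | cons f l =>
      simp only [PP, mul_assoc]
      rw [← mul_assoc (gh e)]
      by_cases h : e = f
      · subst h
        rw [H.c2]
        rcases vx_PP H (r e) v l with h | h
        · rw [h]; exact zero_mem _
        · rw [h]; exact Submodule.subset_span ⟨l, by simpa using hl, rfl⟩
      · rw [H.c1 _ _ h, zero_mul]; exact zero_mem _
  | zero => simp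
  | add x y _ _ hx hy => rw [mul_add]; exact add_mem hx hy
  | smul k x _ hx => rw [mul_smul_comm]; exact Submodule.smul_mem _ _ hx

theorem lemR (H : Fam K s r vx ed gh) (v : V) (N : ℕ) :
    ∀ y ∈ AN K vx ed N v, y ≠ 0 →
      ∃ (α : A) (m : ℕ) (k : K), k ≠ 0 ∧ ∃ b ∈ BN K vx ed m v, α * y = k • vx v + b := by
  induction N with
  | zero =>
    intro y hy hne
    obtain ⟨k, b, hb, rfl⟩ := AN_split hy
    refine ⟨1, 0, k, ?_, b, hb, one_mul _⟩
    rintro rfl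
    apply hne
    have : BN K vx ed 0 v = ⊥ := by
      unfold BN
      rw [Submodule.span_eq_bot]
      rintro x ⟨l, h1, h2, -⟩
      exact absurd (List.length_eq_zero_iff.1 (Nat.le_zero.1 h2)) h1
    rw [this] at hb
    simpa using hb
  | succ N ih =>
    intro y hy hne
    obtain ⟨k, b, hb, rfl⟩ := AN_split hy
    by_cases hk : k = 0
    · subst hk
      rw [zero_smul, zero_add] at hne
      obtain ⟨F, hF, hbF⟩ := BN_FinL H hb
      have : ∃ e, gh e * b ≠ 0 := by
        by_contra h
        push Not at h
        apply hne
        rw [hbF]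
        exact Finset.sum_eq_zero fun e _ => by rw [h e, mul_zero]
      obtain ⟨e, he⟩ := this
      obtain ⟨α, m, k, hk, b', hb', h⟩ := ih _ (gh_BN H e hb) he
      exact ⟨α * gh e, m, k, hk, b', hb', by rw [zero_smul, zero_add, mul_assoc, h]⟩
    · exact ⟨1, _, k, hk, b, hb, one_mul _⟩

theorem lemR' (H : Fam K s r vx ed gh) (v : V) {y : A} (hy : y ∈ RS K vx ed)
    (hne : y * vx v ≠ 0) :
    ∃ (α : A) (m : ℕ) (k : K), k ≠ 0 ∧ ∃ b ∈ BN K vx ed m v,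
      α * (y * vx v) = k • vx v + b := by
  obtain ⟨N, hN⟩ := RS_AN H v hy
  exact lemR H v N _ hN hne

theorem lemD (H : Fam K s r vx ed gh) {n : ℕ} {x : A} (hx : x ∈ GS K vx ed gh n) :
    ∃ y ∈ RS K vx ed, ∃ z, FinR ed gh z ∧ x = y + z := by
  induction hx using Submodule.span_induction with
  | mem x h =>
    obtain ⟨l, w, l', _, rfl⟩ := h
    cases l' with
    | nil => exact ⟨_, Submodule.subset_span ⟨l, w, rfl⟩, 0, FinR_zero, by simp [GG]⟩
    | cons e l' =>
      refine ⟨0, zero_mem _, _, ?_, (zero_add _).symm⟩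
      simp only [GG, ← mul_assoc]
      exact FinR_gh H _ _
  | zero => exact ⟨0, zero_mem _, 0, FinR_zero, by simp⟩
  | add x y _ _ hx hy =>
    obtain ⟨k, hk, b, hb, rfl⟩ := hx
    obtain ⟨k', hk', b', hb', rfl⟩ := hy
    exact ⟨k + k', add_mem hk hk', b + b', FinR_add hb hb', by abel⟩
  | smul c x _ hx =>
    obtain ⟨k, hk, b, hb, rfl⟩ := hx
    exact ⟨c • k, Submodule.smul_mem _ _ hk, c • b, FinR_smul c hb, smul_add _ _ _⟩

theorem GS_zero_le : GS K vx ed gh 0 ≤ RS K vx ed := by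
  apply Submodule.span_le.2
  rintro x ⟨l, w, l', h, rfl⟩
  have : l' = [] := List.length_eq_zero_iff.1 (Nat.le_zero.1 h)
  subst this
  exact Submodule.subset_span ⟨l, w, by simp [GG]⟩

theorem RS_le_GS (n : ℕ) : RS K vx ed ≤ GS K vx ed gh n := by
  apply Submodule.span_le.2
  rintro x ⟨l, w, rfl⟩
  exact Submodule.subset_span ⟨l, w, [], by simp, by simp [GG]⟩

theorem GS_vx (H : Fam K s r vx ed gh) {n : ℕ} (v : V) {x : A} (hx : x ∈ GS K vx ed gh n) :
    x * vx v ∈ GS K vx ed gh n := by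
  induction hx using Submodule.span_induction with
  | mem x h =>
    obtain ⟨l, w, l', hl, rfl⟩ := h
    cases l' with
    | nil =>
      simp only [GG, mul_one]
      exact RS_le_GS _ (RS_vx H v (Submodule.subset_span ⟨l, w, rfl⟩))
    | cons f l' =>
      simp only [GG, mul_assoc]
      by_cases h : s f = v
      · subst h
        rw [H.gs]
        exact Submodule.subset_span ⟨l, w, f :: l', hl, by simp [GG, mul_assoc]⟩
      · rw [gs0 H h]; simp
  | zero => simp
  | add x y _ _ hx hy => rw [add_mul]; exact add_mem hx hy
  | smul k x _ hx => rw [smul_mul_assoc]; exact Submodule.smul_mem _ _ hx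

theorem lemE (H : Fam K s r vx ed gh) {n : ℕ} (e : E) {x : A}
    (hx : x ∈ GS K vx ed gh (n+1)) : x * ed e ∈ GS K vx ed gh n := by
  induction hx using Submodule.span_induction with
  | mem x h =>
    obtain ⟨l, w, l', hl, rfl⟩ := h
    cases l' with
    | nil =>
      simp only [GG, mul_one]
      exact RS_le_GS _ (RS_ed H e (Submodule.subset_span ⟨l, w, rfl⟩))
    | cons f l' =>
      have h1 : PP ed l * vx w * GG gh (f :: l') * ed e =
          PP ed l * vx w * GG gh l' * (gh f * ed e) := by simp only [GG, mul_assoc]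
      rw [h1]
      by_cases h : f = e
      · subst h
        rw [H.c2]
        exact GS_vx H _ (Submodule.subset_span ⟨l, w, l', by simpa using hl, rfl⟩)
      · rw [H.c1 _ _ h, mul_zero]; exact zero_mem _
  | zero => simp
  | add x y _ _ hx hy => rw [add_mul]; exact add_mem hx hy
  | smul k x _ hx => rw [smul_mul_assoc]; exact Submodule.smul_mem _ _ hx

theorem step1 (H : Fam K s r vx ed gh) (n : ℕ) :
    ∀ x ∈ GS K vx ed gh n, x ≠ 0 → ∃ β, x * β ∈ RS K vx ed ∧ x * β ≠ 0 := by
  classical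
  induction n with
  | zero => exact fun x hx hne => ⟨1, by simpa using GS_zero_le hx, by simpa using hne⟩
  | succ n ih =>
    intro x hx hne
    by_cases hex : ∃ e, x * ed e ≠ 0
    · obtain ⟨e, he⟩ := hex
      obtain ⟨β, h1, h2⟩ := ih _ (lemE H e hx) he
      exact ⟨ed e * β, by rwa [← mul_assoc], by rwa [← mul_assoc]⟩
    · push Not at hex
      obtain ⟨v, hv⟩ := exists_vx H hne
      obtain ⟨y, hy, z, ⟨F, hF, hzF⟩, rfl⟩ := lemD H hx
      have hz : ∀ e, z * ed e = - (y * ed e) := by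
        intro e
        have := hex e
        rw [add_mul] at this
        exact eq_neg_of_add_eq_zero_right this
      have hzv : y * vx v = 0 ∨ {e : E | s e = v} = ∅ → z * vx v = 0 := by
        intro h0
        rw [hzF, Finset.sum_mul]
        apply Finset.sum_eq_zero
        intro e _
        by_cases hs : s e = v
        · rcases h0 with h0 | h0
          · rw [hz, ← H.es e, ← mul_assoc y, hs, h0]; simp
          · exact absurd hs (fun h => by
              have : e ∈ {e : E | s e = v} := h
              rw [h0] at this; exact this)
        · rw [mul_assoc, gs0 H hs, mul_zero]
      by_cases hfin : {e : E | s e = v}.Finite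
      · rcases Set.eq_empty_or_nonempty {e : E | s e = v} with h0 | h0
        · refine ⟨vx v, ?_, hv⟩
          rw [add_mul, hzv (Or.inr h0), add_zero]
          exact RS_vx H v hy
        · exfalso
          apply hv
          rw [H.ck2 v hfin h0, Finset.mul_sum]
          exact Finset.sum_eq_zero fun e _ => by rw [← mul_assoc, hex, zero_mul]
      · exfalso
        by_cases hyv : y * vx v = 0
        · apply hv
          rw [add_mul, hyv, hzv (Or.inl hyv), add_zero]
        · obtain ⟨α, m, k, hk, b, hb, hα⟩ := lemR' H v hy hyv
          obtain ⟨F2, hF2, -⟩ := BN_FinL H hb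
          obtain ⟨f, hf, hfF⟩ := (show {e : E | s e = v}.Infinite from hfin).exists_notMem_finset
            (F ∪ F2)
          simp only [Finset.mem_union, not_or] at hfF
          have hf : s f = v := hf
          have h1 : y * vx v * ed f = 0 := by
            rw [mul_assoc, ← hf, H.es]
            have := hz f
            rw [hF f hfF.1] at this
            simpa using this.symm
          have h2 : gh f * (α * (y * vx v)) * ed f = 0 := by
            simp only [mul_assoc] at h1 ⊢
            rw [h1]; simp
          rw [hα, mul_add, hF2 f hfF.2, add_zero, mul_smul_comm, ← hf, H.gs, smul_mul_assoc,
            H.c2] at h2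
          exact (smul_ne_zero hk (H.nz _)) h2

/-- Aperiodic path. -/
theorem exists_q (H : Fam K s r vx ed gh) (hL : ConditionL s r) (v : V) (m : ℕ) :
    ∃ q w, Pth s r v q w ∧
      ∀ b ∈ BN K vx ed m v, GG gh q * vx v * b * vx v * PP ed q = 0 := by
  by_cases hcl : ∃ p, p ≠ [] ∧ Pth s r v p v
  · obtain ⟨p, hp, hpv⟩ := hcl
    obtain ⟨es, hne, hcyc, hs⟩ := exists_cycle hp hpv
    obtain ⟨f, i0, hi0, hsf, hfne⟩ := hL es hcyc
    obtain ⟨n, c, hn, hnl, hc0, hr, hinj, hper, hget, -⟩ := cycle_seq hne hcyc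
    rw [hs] at hc0
    rw [← hget i0 hi0] at hsf hfne
    have hP : ∀ M, Pth s r v ((List.range M).map c) (s (c M)) := by
      intro M
      induction M with
      | zero => exact hc0.symm
      | succ M ih =>
        rw [List.range_succ, List.map_append, Pth_append]
        exact ⟨_, ih, rfl, hr M⟩
    set q := (List.range (m * n + i0)).map c ++ [f] with hq
    have hqlen : q.length = m * n + i0 + 1 := by simp [hq]
    have hcs : c (m * n + i0) = c i0 := hper _ _ (by simp)
    have hqP : Pth s r v q (r f) := by
      rw [hq, Pth_append]
      exact ⟨_, hP _, by rw [hcs]; exact hsf, rfl⟩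
    have hmn : m ≤ m * n := Nat.le_mul_of_pos_right m hn
    have hvq : vx v * PP ed q = PP ed q := by
      have : q ≠ [] := by simp [hq]
      obtain ⟨e, l, hel⟩ := List.exists_cons_of_ne_nil this
      rw [hel] at hqP ⊢
      simp only [PP]
      rw [← hqP.1, ← mul_assoc, H.es]
    have hqv : GG gh q * vx v = GG gh q := by
      have : q ≠ [] := by simp [hq]
      obtain ⟨e, l, hel⟩ := List.exists_cons_of_ne_nil this
      rw [hel] at hqP ⊢
      simp only [GG]
      rw [← hqP.1, mul_assoc, H.gs]
    refine ⟨q, r f, hqP, ?_⟩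
    intro b hb
    rw [hqv, mul_assoc, hvq]
    induction hb using Submodule.span_induction with
    | mem x h =>
      obtain ⟨l, hlne, hl, rfl⟩ := h
      have hlpos : 0 < l.length := List.length_pos_iff.2 hlne
      rw [mul_assoc, mul_assoc (PP ed l), hvq, ← PP_append]
      apply GG_PP_zero H
      · intro hpre
        apply hfne
        have hi1 : m * n + i0 < q.length := by omega
        have h1 := hpre.getElem hi1
        have h2 : q[m * n + i0] = f := by simp [hq]
        rw [h2, List.getElem_append_right (by omega)] at h1
        have h3 : ∀ j (hj : j < q.length), j < m * n + i0 → q[j] = c j := by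
          intro j hj hj'
          simp only [hq]
          rw [List.getElem_append_left (by simpa using hj')]
          simp
        rw [h3 _ _ (by omega)] at h1
        have h4 := hinj _ _ (show s (c (m * n + i0 - l.length)) = s (c i0) by rw [← h1, hsf])
        rw [h1]
        exact hper _ _ h4
      · intro hpre
        have := hpre.length_le
        rw [List.length_append] at this
        omega
    | zero => simp
    | add x y _ _ hx hy => rw [mul_add, add_mul, hx, hy, add_zero]
    | smul k x _ hx => rw [mul_smul_comm, smul_mul_assoc, hx, smul_zero]
  · push Not at hcl
    refine ⟨[], v, rfl, ?_⟩
    intro b hb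
    simp only [GG, PP, one_mul, mul_one]
    induction hb using Submodule.span_induction with
    | mem x h =>
      obtain ⟨l, hlne, hl, rfl⟩ := h
      rw [← mul_assoc, not_Pth H (hcl l hlne), zero_mul]
    | zero => simp
    | add x y _ _ hx hy => rw [mul_add, add_mul, hx, hy, add_zero]
    | smul k x _ hx => rw [mul_smul_comm, smul_mul_assoc, hx, smul_zero]

theorem reduction (H : Fam K s r vx ed gh) (hL : ConditionL s r) (x : A) (hx : x ≠ 0) :
    ∃ α β w, α * x * β = vx w := by
  obtain ⟨n, hn⟩ := mem_GS H x
  obtain ⟨β, hβ, hne⟩ := step1 H n x hn hx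
  obtain ⟨v, hv⟩ := exists_vx H hne
  obtain ⟨α, m, k, hk, b, hb, hα⟩ := lemR' H v hβ hv
  obtain ⟨q, w, hq, hqb⟩ := exists_q H hL v m
  refine ⟨k⁻¹ • (GG gh q * vx v * α), β * vx v * (vx v * PP ed q), w, ?_⟩
  have h1 : k⁻¹ • (GG gh q * vx v * α) * x * (β * vx v * (vx v * PP ed q)) =
      k⁻¹ • (GG gh q * vx v * (α * (x * β * vx v)) * vx v * PP ed q) := by
    simp only [smul_mul_assoc, mul_assoc]
  rw [h1, hα, mul_add, add_mul, add_mul, hqb b hb, add_zero, mul_smul_comm, smul_mul_assoc,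
    smul_mul_assoc, smul_smul, inv_mul_cancel₀ hk, one_smul, mul_assoc (GG gh q), H.idem,
    mul_assoc (GG gh q), H.idem, GG_PP H hq]

theorem one_imp_three (H : Fam K s r vx ed gh) (hL : ConditionL s r) (a : A) (ha : a ≠ 0) :
    ∃ b : A, b ≠ 0 ∧ b * a * b = b := by
  obtain ⟨α, β, w, h⟩ := reduction H hL a ha
  refine ⟨β * vx w * α, ?_, ?_⟩
  · intro h0
    apply H.nz w
    have h1 : α * a * (β * vx w * α) * a * β = (α * a * β) * vx w * (α * a * β) := by
      simp only [mul_assoc]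
    rw [h0, h, H.idem, H.idem] at h1
    simpa using h1.symm
  · have h1 : β * vx w * α * a * (β * vx w * α) = β * vx w * (α * a * β) * vx w * α := by
      simp only [mul_assoc]
    rw [h1, h, mul_assoc β, H.idem, mul_assoc β, H.idem]

end Main

section Cyc
variable {K V E A : Type} [Field K] [Fintype V] [Ring A] [Algebra K A]
  {s r : E → V} {vx : V → A} {ed gh : E → A}

/-- Initial segments of the infinite path `c`. -/
def QQ (s : E → V) (vx : V → A) (ed : E → A) (c : ℕ → E) : ℕ → A
  | 0 => vx (s (c 0))
  | k + 1 => QQ s vx ed c k * ed (c k)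

/-- Adjoints of the initial segments. -/
def QS (s : E → V) (vx : V → A) (gh : E → A) (c : ℕ → E) : ℕ → A
  | 0 => vx (s (c 0))
  | k + 1 => gh (c k) * QS s vx gh c k

variable {c : ℕ → E} {n : ℕ}

theorem QQ_right (H : Fam K s r vx ed gh) (hr : ∀ i, r (c i) = s (c (i+1))) (k : ℕ) :
    QQ s vx ed c k * vx (s (c k)) = QQ s vx ed c k := by
  cases k with
  | zero => exact H.idem _
  | succ k => simp only [QQ]; rw [mul_assoc, ← hr, H.er]

theorem QQ_left (H : Fam K s r vx ed gh) (k : ℕ) :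
    vx (s (c 0)) * QQ s vx ed c k = QQ s vx ed c k := by
  induction k with
  | zero => exact H.idem _
  | succ k ih => simp only [QQ]; rw [← mul_assoc, ih]

theorem QQ_add (H : Fam K s r vx ed gh) (hr : ∀ i, r (c i) = s (c (i+1)))
    (hper : ∀ i j, i % n = j % n → c i = c j) (k : ℕ) :
    QQ s vx ed c (n + k) = QQ s vx ed c n * QQ s vx ed c k := by
  induction k with
  | zero =>
    have := QQ_right H hr n
    rw [hper n 0 (by simp)] at this
    exact this.symm
  | succ k ih =>
    rw [← add_assoc]
    simp only [QQ]
    rw [ih, hper (n + k) k (by simp), mul_assoc]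

theorem QQ_mul (H : Fam K s r vx ed gh) (hr : ∀ i, r (c i) = s (c (i+1)))
    (hper : ∀ i j, i % n = j % n → c i = c j) (k : ℕ) :
    QQ s vx ed c (n * k) = QQ s vx ed c n ^ k * vx (s (c 0)) := by
  induction k with
  | zero => simp [QQ]
  | succ k ih =>
    rw [Nat.mul_succ, add_comm, QQ_add H hr hper, ih, ← mul_assoc, pow_succ']

theorem QQ_QS (H : Fam K s r vx ed gh) (hr : ∀ i, r (c i) = s (c (i+1)))
    (hex : ∀ i f, s f = s (c i) → f = c i) (k : ℕ) :
    QQ s vx ed c k * QS s vx gh c k = vx (s (c 0)) := by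
  induction k with
  | zero => exact H.idem _
  | succ k ih =>
    simp only [QQ, QS]
    have hset : {e : E | s e = s (c k)} = {c k} := by
      ext f
      constructor
      · intro h; exact hex k f h
      · rintro rfl; rfl
    have hfin : {e : E | s e = s (c k)}.Finite := by rw [hset]; exact Set.finite_singleton _
    have h1 := H.ck2 (s (c k)) hfin ⟨c k, rfl⟩
    have h2 : hfin.toFinset = {c k} := by
      ext f
      rw [Set.Finite.mem_toFinset, hset]
      simp
    rw [h2, Finset.sum_singleton] at h1
    rw [mul_assoc, ← mul_assoc (ed (c k)), ← h1, ← mul_assoc, QQ_right H hr, ih]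

theorem vx_PP_QQ (H : Fam K s r vx ed gh) (hr : ∀ i, r (c i) = s (c (i+1)))
    (hex : ∀ i f, s f = s (c i) → f = c i) (l : List E) :
    vx (s (c 0)) * PP ed l = 0 ∨ vx (s (c 0)) * PP ed l = QQ s vx ed c l.length := by
  induction l using List.reverseRecOn with
  | nil => right; simp [PP, QQ]
  | append_singleton l e ih =>
    rw [PP_append, ← mul_assoc]
    rcases ih with h | h
    · left; rw [h, zero_mul]
    · rw [h]
      simp only [PP, mul_one, List.length_append, List.length_singleton, QQ]
      by_cases he : s e = s (c l.length)
      · right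
        rw [← hex _ _ he]
      · left
        rw [← QQ_right H hr, mul_assoc, es0 H he, mul_zero]

open Polynomial in
theorem RS_poly (H : Fam K s r vx ed gh) (hr : ∀ i, r (c i) = s (c (i+1)))
    (hper : ∀ i j, i % n = j % n → c i = c j)
    (hinj : ∀ i j, s (c i) = s (c j) → i % n = j % n)
    (hex : ∀ i f, s f = s (c i) → f = c i) {x : A} (hx : x ∈ RS K vx ed) :
    ∃ f : K[X], vx (s (c 0)) * x * vx (s (c 0)) =
      aeval (QQ s vx ed c n) f * vx (s (c 0)) := by
  induction hx using Submodule.span_induction with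
  | mem x h =>
    obtain ⟨l, w, rfl⟩ := h
    rw [← mul_assoc]
    rcases vx_PP_QQ H hr hex l with h | h
    · exact ⟨0, by rw [h]; simp⟩
    · rw [h]
      by_cases hw : w = s (c 0)
      · by_cases hl : s (c l.length) = s (c 0)
        · have h1 := hinj _ _ hl
          have h2 : l.length = n * (l.length / n) := by
            rw [Nat.zero_mod] at h1
            exact (Nat.mul_div_cancel' (Nat.dvd_of_mod_eq_zero h1)).symm
          refine ⟨X ^ (l.length / n), ?_⟩
          rw [h2, QQ_mul H hr hper, hw, mul_assoc, mul_assoc, H.idem, H.idem, ← h2]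
          simp
        · refine ⟨0, ?_⟩
          rw [← QQ_right H hr, hw, mul_assoc (QQ s vx ed c l.length), H.orth _ _ hl]
          simp
      · refine ⟨0, ?_⟩
        rw [mul_assoc, H.orth _ _ hw]
        simp
  | zero => exact ⟨0, by simp⟩
  | add x y _ _ hx hy =>
    obtain ⟨f, hf⟩ := hx
    obtain ⟨g, hg⟩ := hy
    exact ⟨f + g, by rw [mul_add, add_mul, hf, hg, map_add, add_mul]⟩
  | smul k x _ hx =>
    obtain ⟨f, hf⟩ := hx
    exact ⟨k • f, by rw [mul_smul_comm, smul_mul_assoc, hf, map_smul, smul_mul_assoc]⟩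

theorem mul_QQ_RS (H : Fam K s r vx ed gh) (c : ℕ → E) (x : A) :
    ∃ N, ∀ M, N ≤ M → x * QQ s vx ed c M ∈ RS K vx ed := by
  let S : Submodule K A :=
    { carrier := {x | ∃ N, ∀ M, N ≤ M → x * QQ s vx ed c M ∈ RS K vx ed}
      add_mem' := by
        rintro a b ⟨N, hN⟩ ⟨N', hN'⟩
        refine ⟨max N N', fun M hM => ?_⟩
        rw [add_mul]
        exact add_mem (hN M ((le_max_left _ _).trans hM)) (hN' M ((le_max_right _ _).trans hM))
      zero_mem' := ⟨0, fun M _ => by simp⟩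
      smul_mem' := by
        rintro k a ⟨N, hN⟩
        refine ⟨N, fun M hM => ?_⟩
        rw [smul_mul_assoc]
        exact Submodule.smul_mem _ _ (hN M hM) }
  apply H.gen S
  · refine ⟨0, fun M _ => ?_⟩
    rw [one_mul]
    induction M with
    | zero => exact Submodule.subset_span ⟨[], s (c 0), by simp [PP, QQ]⟩
    | succ M ih => exact RS_ed H _ (ih (Nat.zero_le _))
  · rintro v x ⟨N, hN⟩
    refine ⟨N, fun M hM => ?_⟩
    rw [mul_assoc]
    exact vx_RS H _ (hN M hM)
  · rintro v x ⟨N, hN⟩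
    refine ⟨N, fun M hM => ?_⟩
    rw [mul_assoc]
    exact ed_RS _ (hN M hM)
  · rintro e x ⟨N, hN⟩
    refine ⟨N + 1, fun M hM => ?_⟩
    obtain ⟨M, rfl⟩ : ∃ M', M = M' + 1 := ⟨M - 1, by omega⟩
    simp only [QQ]
    rw [mul_assoc, ← mul_assoc x]
    exact gh_RS_ed H _ _ (hN M (by omega))

open Polynomial in
theorem corner (H : Fam K s r vx ed gh) (hn : 0 < n) (hr : ∀ i, r (c i) = s (c (i+1)))
    (hper : ∀ i j, i % n = j % n → c i = c j)
    (hinj : ∀ i j, s (c i) = s (c j) → i % n = j % n)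
    (hex : ∀ i f, s f = s (c i) → f = c i) (x : A) :
    ∃ (N : ℕ) (f : K[X]) (D : A),
      (vx (s (c 0)) * x * vx (s (c 0))) * (QQ s vx ed c n ^ N * vx (s (c 0))) =
        aeval (QQ s vx ed c n) f * vx (s (c 0)) ∧
      QQ s vx ed c n ^ N * vx (s (c 0)) * D = vx (s (c 0)) := by
  obtain ⟨N, hN⟩ := mul_QQ_RS H c (x * vx (s (c 0)))
  obtain ⟨f, hf⟩ := RS_poly H hr hper hinj hex (hN (n * N) (Nat.le_mul_of_pos_left N hn))
  refine ⟨N, f, QS s vx gh c (n * N), ?_, ?_⟩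
  · rw [← hf, QQ_mul H hr hper]
    simp only [mul_assoc, H.idem]
  · rw [← QQ_mul H hr hper, QQ_QS H hr hex]

open Polynomial in
theorem not_zorn (H : Fam K s r vx ed gh) (hn : 0 < n) (hr : ∀ i, r (c i) = s (c (i+1)))
    (hper : ∀ i j, i % n = j % n → c i = c j)
    (hinj : ∀ i j, s (c i) = s (c j) → i % n = j % n)
    (hex : ∀ i f, s f = s (c i) → f = c i)
    {X : Type} (ρ : A →ₐ[K] Module.End K (X → RatFunc K)) (pt : ℕ → X)
    (hpt : pt n = pt 0) (wt : E → RatFunc K)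
    (hwt : ∏ i ∈ Finset.range n, wt (c i) = RatFunc.X)
    (hρv : ∀ g, ρ (vx (s (c 0))) g (pt 0) = g (pt 0))
    (hρe : ∀ i g, ρ (ed (c i)) g (pt i) = wt (c i) * g (pt (i+1)))
    (hZ : ∀ I : Submodule A A, (∃ a ∈ I, ¬ IsNilpotent a) → ∃ e ∈ I, e ≠ 0 ∧ e * e = e) :
    False := by
  set v0 := vx (s (c 0)) with hv0
  set C := QQ s vx ed c n with hC
  have hQ : ∀ k g, ρ (QQ s vx ed c k) g (pt 0) = (∏ i ∈ Finset.range k, wt (c i)) * g (pt k) := by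
    intro k
    induction k with
    | zero => intro g; simpa [QQ] using hρv g
    | succ k ih =>
      intro g
      simp only [QQ, map_mul, Module.End.mul_apply]
      rw [ih, hρe, Finset.prod_range_succ, mul_assoc]
  have hρC : ∀ g, ρ C g (pt 0) = RatFunc.X * g (pt 0) := by
    intro g; rw [hQ, hwt, hpt]
  have hρpow : ∀ k g, ρ (C ^ k) g (pt 0) = RatFunc.X ^ k * g (pt 0) := by
    intro k
    induction k with
    | zero => intro g; simp
    | succ k ih =>
      intro g
      rw [pow_succ, map_mul, Module.End.mul_apply, ih, hρC, pow_succ, mul_assoc]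
  have hρf : ∀ (f : K[X]) g, ρ (aeval C f * v0) g (pt 0) =
      algebraMap K[X] (RatFunc K) f * g (pt 0) := by
    intro f g
    rw [map_mul, Module.End.mul_apply]
    induction f using Polynomial.induction_on' with
    | add p q hp hq =>
      simp only [map_add, LinearMap.add_apply, Pi.add_apply, hp, hq, add_mul]
    | monomial k a =>
      rw [← Polynomial.C_mul_X_pow_eq_monomial]
      simp only [map_mul, aeval_C, map_pow, aeval_X, RatFunc.algebraMap_X, AlgHom.commutes]
      rw [Module.End.mul_apply, Module.algebraMap_end_apply, Pi.smul_apply, ← map_pow, hρpow, hρv]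
      simp [Algebra.smul_def, mul_assoc, RatFunc.algebraMap_eq_C]
  have hT : (RatFunc.X : RatFunc K) ≠ 0 := RatFunc.X_ne_zero
  have hv0C : v0 * C = C := QQ_left H n
  have hCv0 : C * v0 = C := by
    have := QQ_right H hr n
    rw [hper n 0 (by simp)] at this
    exact this
  have hθ : ∀ x, ∃ (N : ℕ) (f : K[X]) (θ : RatFunc K),
      (f = 0 → v0 * x * v0 = 0) ∧
      θ * RatFunc.X ^ N = algebraMap K[X] (RatFunc K) f ∧
      ∀ g, ρ (v0 * x * v0) g (pt 0) = θ * g (pt 0) := by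
    intro x
    obtain ⟨N, f, D, h1, h2⟩ := corner H hn hr hper hinj hex x
    rw [← hv0, ← hC] at h1 h2
    have h3 : v0 * x * v0 = aeval C f * v0 * D := by
      rw [← h1, mul_assoc (v0 * x * v0), h2, mul_assoc (v0 * x), H.idem]
    refine ⟨N, f, algebraMap K[X] (RatFunc K) f / RatFunc.X ^ N, ?_, ?_, ?_⟩
    · rintro rfl
      rw [h3]; simp
    · field_simp
    · intro g
      have h4 : RatFunc.X ^ N * ρ D g (pt 0) = g (pt 0) := by
        have h5 : ρ (C ^ N * v0 * D) g (pt 0) = g (pt 0) := by rw [h2, hρv]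
        rw [map_mul, map_mul, Module.End.mul_apply, Module.End.mul_apply, hρpow, hρv] at h5
        exact h5
      rw [h3, map_mul, Module.End.mul_apply, hρf, ← h4]
      field_simp
  have hsub : ∀ g, ρ (v0 - C) g (pt 0) = (1 - RatFunc.X) * g (pt 0) := by
    intro g
    rw [map_sub, LinearMap.sub_apply, Pi.sub_apply, hρv, hρC]
    ring
  have h1X : (1 - RatFunc.X : RatFunc K) = algebraMap K[X] (RatFunc K) (1 - Polynomial.X) := by
    simp
  have hne : (1 - RatFunc.X : RatFunc K) ≠ 0 := by
    rw [h1X]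
    intro h
    have h2 := (map_eq_zero_iff _ (RatFunc.algebraMap_injective K)).1 h
    have := congrArg (Polynomial.eval 0) h2
    simp at this
  obtain ⟨e, heI, he0, hee⟩ := hZ (Submodule.span A {v0 - C}) ⟨v0 - C, Submodule.mem_span_singleton_self _, by
    rintro ⟨k, hk⟩
    have h2 : ∀ k g, ρ ((v0 - C) ^ k) g (pt 0) = (1 - RatFunc.X) ^ k * g (pt 0) := by
      intro k
      induction k with
      | zero => intro g; simp
      | succ k ih =>
        intro g
        rw [pow_succ, map_mul, Module.End.mul_apply, ih, hsub, pow_succ, mul_assoc]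
    have h3 := h2 k 1
    rw [hk] at h3
    simp only [map_zero, LinearMap.zero_apply, Pi.zero_apply, Pi.one_apply, mul_one] at h3
    exact pow_ne_zero k hne h3.symm⟩
  obtain ⟨y, hy⟩ := Submodule.mem_span_singleton.1 heI
  rw [smul_eq_mul] at hy
  have hev : e * v0 = e := by
    rw [← hy, mul_assoc, sub_mul, H.idem, hCv0]
  have huv : v0 * e * v0 = v0 * e := by rw [mul_assoc, hev]
  have huy : v0 * e * v0 = v0 * y * v0 * (v0 - C) := by
    rw [huv, ← hy, mul_assoc (v0 * y), mul_sub v0, H.idem, hv0C, mul_assoc]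
  have huu : (v0 * e * v0) * (v0 * e * v0) = v0 * e * v0 := by
    rw [huv, mul_assoc, ← mul_assoc e, hev, hee]
  have hu0 : v0 * e * v0 ≠ 0 := by
    intro h
    apply he0
    rw [huv] at h
    have h5 : e * v0 * e = e := by rw [hev, hee]
    rw [← h5, mul_assoc, h, mul_zero]
  obtain ⟨N, f, θ, hf0, hθf, hθg⟩ := hθ e
  obtain ⟨M, p, η, -, hηp, hηg⟩ := hθ y
  have hsq : θ * θ = θ := by
    have := hθg (ρ (v0 * e * v0) 1)
    rw [← Module.End.mul_apply, ← map_mul, huu, hθg] at this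
    simpa using this.symm
  have h01 : θ = 0 ∨ θ = 1 := by
    have h5 : θ * (θ - 1) = 0 := by rw [mul_sub, hsq, mul_one, sub_self]
    rcases mul_eq_zero.1 h5 with h | h
    · exact Or.inl h
    · exact Or.inr (sub_eq_zero.1 h)
  rcases h01 with h | h
  · apply hu0
    apply hf0
    rw [h, zero_mul] at hθf
    exact (map_eq_zero_iff _ (RatFunc.algebraMap_injective K)).1 hθf.symm
  · have h1 := hθg 1
    rw [huy, map_mul, Module.End.mul_apply, hηg, hsub, h] at h1
    simp only [Pi.one_apply, mul_one] at h1
    have h2 : algebraMap K[X] (RatFunc K) (Polynomial.X ^ M) =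
        algebraMap K[X] (RatFunc K) (p * (1 - Polynomial.X)) := by
      rw [map_mul, ← hηp, ← h1X, map_pow, RatFunc.algebraMap_X]
      linear_combination (-RatFunc.X ^ M) * h1
    have h3 := congrArg (Polynomial.eval 1) (RatFunc.algebraMap_injective K h2)
    simp at h3

end Cyc

theorem exists_branch {V E : Type} (s : E → V) : ∃ (Y : Type) (_ : Y) (U : E → Y → Y),
    (∀ e e' y y', s e = s e' → U e y = U e' y' → e = e' ∧ y = y') ∧
    (∀ v, (∃ e, s e = v) → ∀ y, ∃ e y', s e = v ∧ U e y' = y) ∧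
    (∀ e, (∀ f, s f = s e → f = e) → ∀ y, U e y = y) := by
  classical
  have key : ∀ v, (∃ e, s e = v) → ∃ φ : ({e // s e = v} × (E ⊕ ℕ)) ≃ (E ⊕ ℕ),
      (∃ e, ∀ f, s f = v → f = e) → ∀ e y, φ (e, y) = y := by
    intro v hv
    by_cases hu : ∃ e, ∀ f, s f = v → f = e
    · obtain ⟨e, he⟩ := hu
      have : Unique {e // s e = v} :=
        { default := ⟨hv.choose, hv.choose_spec⟩
          uniq := fun f => Subtype.ext ((he _ f.2).trans (he _ hv.choose_spec).symm) }
      exact ⟨Equiv.uniqueProd _ _, fun _ _ _ => rfl⟩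
    · have h : Cardinal.mk ({e // s e = v} × (E ⊕ ℕ)) = Cardinal.mk (E ⊕ ℕ) := by
        have : Nonempty {e // s e = v} := let ⟨e, he⟩ := hv; ⟨⟨e, he⟩⟩
        rw [Cardinal.mk_prod, Cardinal.lift_id, Cardinal.lift_id]
        apply Cardinal.mul_eq_right
        · exact Cardinal.aleph0_le_mk _
        · exact Cardinal.mk_le_of_injective (f := fun e : {e // s e = v} => (Sum.inl e.1 : E ⊕ ℕ))
            (fun a b hab => Subtype.ext (Sum.inl_injective hab))
        · exact Cardinal.mk_ne_zero _
      obtain ⟨φ⟩ := Cardinal.eq.1 h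
      exact ⟨φ, fun h => absurd h hu⟩
  choose φ hφ using key
  refine ⟨E ⊕ ℕ, Sum.inr 0, fun e y => φ (s e) ⟨e, rfl⟩ (⟨e, rfl⟩, y), ?_, ?_, ?_⟩
  · intro e e' y y' hs h
    have gen : ∀ v (hv : s e' = v) (hv' : s e = v),
        φ (s e) ⟨e, rfl⟩ (⟨e, rfl⟩, y) = φ (s e') ⟨e', rfl⟩ (⟨e', rfl⟩, y') →
        φ v ⟨e, hv'⟩ (⟨e, hv'⟩, y) = φ v ⟨e, hv'⟩ (⟨e', hv⟩, y') := by
      intro v hv hv' h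
      subst hv'
      rw [h]
      have : ∀ w (hw : s e' = w) (h1 : ∃ e, s e = w),
          φ (s e') ⟨e', rfl⟩ (⟨e', rfl⟩, y') = φ w h1 (⟨e', hw⟩, y') := by
        intro w hw h1; subst hw; rfl
      exact this _ _ _
    have h2 := (φ _ _).injective (gen (s e) hs.symm rfl h)
    simp only [Prod.mk.injEq, Subtype.mk.injEq] at h2
    exact h2
  · intro v hv y
    obtain ⟨⟨⟨e, he⟩, y'⟩, h⟩ := (φ v hv).surjective y
    refine ⟨e, y', he, ?_⟩
    subst he
    exact h
  · intro e he y
    exact hφ (s e) ⟨e, rfl⟩ ⟨e, he⟩ _ _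

section Rep
variable {K V E Y R : Type} [Field K] [Field R] [Algebra K R]

open Classical in
/-- Action of a vertex. -/
noncomputable def opV (K : Type) [Field K] [Algebra K R] (v : V) : Module.End K (V × Y → R) where
  toFun g p := if p.1 = v then g p else 0
  map_add' g h := by ext p; by_cases hp : p.1 = v <;> simp [hp]
  map_smul' k g := by ext p; by_cases hp : p.1 = v <;> simp [hp]

open Classical in
/-- Action of an edge. -/
noncomputable def opE (K : Type) [Field K] [Algebra K R] (s r : E → V) (U : E → Y → Y)
    (wt : E → R) (e : E) : Module.End K (V × Y → R) where
  toFun g p := if h : ∃ y', p.1 = s e ∧ U e y' = p.2 then wt e * g (r e, h.choose) else 0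
  map_add' g h := by
    ext p
    by_cases hp : ∃ y', p.1 = s e ∧ U e y' = p.2
    · simp only [hp, dif_pos, Pi.add_apply, mul_add]
    · simp only [hp, dif_neg, Pi.add_apply, add_zero, not_false_eq_true]
  map_smul' k g := by
    ext p
    by_cases hp : ∃ y', p.1 = s e ∧ U e y' = p.2
    · simp only [hp, dif_pos, Pi.smul_apply, mul_smul_comm, RingHom.id_apply]
    · simp only [hp, dif_neg, Pi.smul_apply, smul_zero, not_false_eq_true]

open Classical in
/-- Action of a ghost edge. -/
noncomputable def opG (K : Type) [Field K] [Algebra K R] (s r : E → V) (U : E → Y → Y)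
    (wt : E → R) (e : E) : Module.End K (V × Y → R) where
  toFun g p := if p.1 = r e then (wt e)⁻¹ * g (s e, U e p.2) else 0
  map_add' g h := by ext p; by_cases hp : p.1 = r e <;> simp [hp, mul_add]
  map_smul' k g := by ext p; by_cases hp : p.1 = r e <;> simp [hp]

variable {s r : E → V} {U : E → Y → Y} {wt : E → R}

theorem opV_same (v : V) (y : Y) (g : V × Y → R) : opV K v g (v, y) = g (v, y) := by
  simp [opV]

theorem opV_ne {v w : V} (h : w ≠ v) (y : Y) (g : V × Y → R) : opV K v g (w, y) = 0 := by
  simp [opV, h]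

theorem opG_same (e : E) (y : Y) (g : V × Y → R) :
    opG K s r U wt e g (r e, y) = (wt e)⁻¹ * g (s e, U e y) := by
  simp [opG]

theorem opG_ne {e : E} {w : V} (h : w ≠ r e) (y : Y) (g : V × Y → R) :
    opG K s r U wt e g (w, y) = 0 := by
  simp [opG, h]

theorem opE_same (hU : ∀ e e' y y', s e = s e' → U e y = U e' y' → e = e' ∧ y = y')
    (e : E) (y : Y) (g : V × Y → R) :
    opE K s r U wt e g (s e, U e y) = wt e * g (r e, y) := by
  have h : ∃ y', s e = s e ∧ U e y' = U e y := ⟨y, rfl, rfl⟩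
  have h2 : h.choose = y := (hU _ _ _ _ rfl h.choose_spec.2).2
  refine (dif_pos h).trans ?_
  exact congrArg (fun t => wt e * g (r e, t)) h2

theorem opE_ne {e : E} {w : V} {y : Y} (h : ¬ ∃ y', w = s e ∧ U e y' = y) (g : V × Y → R) :
    opE K s r U wt e g (w, y) = 0 := by
  simp only [opE, LinearMap.coe_mk, AddHom.coe_mk]
  rw [dif_neg h]

/-- The action of generators. -/
noncomputable def opGen (K : Type) [Field K] [Algebra K R] (s r : E → V) (U : E → Y → Y)
    (wt : E → R) : LPAGen V E → Module.End K (V × Y → R)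
  | .vertex v => opV K v
  | .edge e => opE K s r U wt e
  | .ghost e => opG K s r U wt e

theorem exists_rep [Fintype V]
    (hU : ∀ e e' y y', s e = s e' → U e y = U e' y' → e = e' ∧ y = y')
    (hS : ∀ v, (∃ e, s e = v) → ∀ y, ∃ e y', s e = v ∧ U e y' = y)
    (hwt : ∀ e, wt e ≠ 0) :
    ∃ ρ : LeavittPathAlgebra K V E s r →ₐ[K] Module.End K (V × Y → R),
      ∀ a, ρ (RingQuot.mkAlgHom K (LPARel K V E s r) (FreeAlgebra.ι K a)) =
        opGen K s r U wt a := by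
  classical
  refine ⟨RingQuot.liftAlgHom K ⟨FreeAlgebra.lift K (opGen K s r U wt), ?_⟩, ?_⟩
  · intro a b hab
    induction hab with
    | vertex_orth v w h =>
      simp only [map_mul, FreeAlgebra.lift_ι_apply, opGen, map_zero]
      ext g ⟨u, y⟩
      rw [Module.End.mul_apply]
      by_cases h1 : u = v
      · subst h1
        rw [opV_same, opV_ne h]; rfl
      · rw [opV_ne h1]; rfl
    | vertex_idem v =>
      simp only [map_mul, FreeAlgebra.lift_ι_apply, opGen]
      ext g ⟨u, y⟩
      rw [Module.End.mul_apply]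
      by_cases h1 : u = v
      · subst h1
        rw [opV_same]
      · rw [opV_ne h1, opV_ne h1]
    | edge_src e =>
      simp only [map_mul, FreeAlgebra.lift_ι_apply, opGen]
      ext g ⟨u, y⟩
      rw [Module.End.mul_apply]
      by_cases h1 : u = s e
      · subst h1
        rw [opV_same]
      · rw [opV_ne h1, opE_ne (fun ⟨_, h, _⟩ => h1 h)]
    | edge_rng e =>
      simp only [map_mul, FreeAlgebra.lift_ι_apply, opGen]
      ext g ⟨u, y⟩
      rw [Module.End.mul_apply]
      by_cases h1 : ∃ y', u = s e ∧ U e y' = y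
      · obtain ⟨y', rfl, rfl⟩ := h1
        rw [opE_same hU, opE_same hU, opV_same]
      · rw [opE_ne h1, opE_ne h1]
    | ghost_rng e =>
      simp only [map_mul, FreeAlgebra.lift_ι_apply, opGen]
      ext g ⟨u, y⟩
      rw [Module.End.mul_apply]
      by_cases h1 : u = r e
      · subst h1
        rw [opV_same]
      · rw [opV_ne h1, opG_ne h1]
    | ghost_src e =>
      simp only [map_mul, FreeAlgebra.lift_ι_apply, opGen]
      ext g ⟨u, y⟩
      rw [Module.End.mul_apply]
      by_cases h1 : u = r e
      · subst h1
        rw [opG_same, opG_same, opV_same]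
      · rw [opG_ne h1, opG_ne h1]
    | ck1_distinct e f h =>
      simp only [map_mul, FreeAlgebra.lift_ι_apply, opGen, map_zero]
      ext g ⟨u, y⟩
      rw [Module.End.mul_apply]
      by_cases h1 : u = r e
      · subst h1
        rw [opG_same, opE_ne]
        · simp
        · rintro ⟨y', h2, h3⟩
          exact h (hU _ _ _ _ h2 h3.symm).1
      · rw [opG_ne h1]; rfl
    | ck1_same e =>
      simp only [map_mul, FreeAlgebra.lift_ι_apply, opGen]
      ext g ⟨u, y⟩
      rw [Module.End.mul_apply]
      by_cases h1 : u = r e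
      · subst h1
        rw [opG_same, opE_same hU, opV_same, inv_mul_cancel_left₀ (hwt e)]
      · rw [opG_ne h1, opV_ne h1]
    | ck2 v h hne =>
      simp only [map_mul, map_sum, FreeAlgebra.lift_ι_apply, opGen]
      ext g ⟨u, y⟩
      rw [LinearMap.sum_apply, Finset.sum_apply]
      simp only [Module.End.mul_apply]
      by_cases h1 : u = v
      · subst h1
        obtain ⟨e, y', he, rfl⟩ := hS u hne y
        subst he
        rw [opV_same, Finset.sum_eq_single e]
        · rw [opE_same hU, opG_same, mul_inv_cancel_left₀ (hwt e)]
        · intro f _ hf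
          apply opE_ne
          rintro ⟨y'', h2, h3⟩
          exact hf (hU _ _ _ _ h2.symm h3).1
        · intro h2
          exact absurd (h.mem_toFinset.2 rfl) h2
      · rw [opV_ne h1]
        symm
        apply Finset.sum_eq_zero
        intro e he
        have he : s e = v := h.mem_toFinset.1 he
        exact opE_ne (fun ⟨_, h2, _⟩ => h1 (h2.trans he)) _
    | unit =>
      simp only [map_one, map_sum, FreeAlgebra.lift_ι_apply, opGen]
      ext g ⟨u, y⟩
      rw [LinearMap.sum_apply, Finset.sum_apply, Finset.sum_eq_single u]
      · rw [opV_same]; rfl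
      · intro v _ hv
        exact opV_ne hv.symm _ _
      · simp
  · intro a
    rw [RingQuot.liftAlgHom_mkAlgHom_apply, FreeAlgebra.lift_ι_apply]

end Rep

section Final
variable (K V E : Type) [Field K] [Fintype V] (s r : E → V)

/-- Generators in the Leavitt path algebra. -/
noncomputable def lg (a : LPAGen V E) : LeavittPathAlgebra K V E s r :=
  RingQuot.mkAlgHom K (LPARel K V E s r) (FreeAlgebra.ι K a)

theorem fam : Fam K s r (fun v => lg K V E s r (.vertex v)) (fun e => lg K V E s r (.edge e))
    (fun e => lg K V E s r (.ghost e)) := by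
  have R : ∀ {a b}, LPARel K V E s r a b → RingQuot.mkAlgHom K (LPARel K V E s r) a =
    RingQuot.mkAlgHom K (LPARel K V E s r) b := fun h => RingQuot.mkAlgHom_rel K h
  constructor
  · intro v w h; simpa [lg] using R (.vertex_orth v w h)
  · intro v; simpa [lg] using R (.vertex_idem v)
  · intro v; simpa [lg] using R (.edge_src v)
  · intro v; simpa [lg] using R (.edge_rng v)
  · intro v; simpa [lg] using R (.ghost_rng v)
  · intro v; simpa [lg] using R (.ghost_src v)
  · intro v w h; simpa [lg] using R (.ck1_distinct v w h)
  · intro v; simpa [lg] using R (.ck1_same v)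
  · intro v h hne; simpa [lg] using R (.ck2 v h hne)
  · simpa [lg] using R (.unit)
  · intro S h1 hv he hg x
    have key : ∀ a : FreeAlgebra K (LPAGen V E), ∀ y ∈ S,
        RingQuot.mkAlgHom K (LPARel K V E s r) a * y ∈ S := by
      intro a
      induction a using FreeAlgebra.induction with
      | grade0 k =>
        intro y hy
        rw [AlgHom.commutes, ← Algebra.smul_def]
        exact S.smul_mem _ hy
      | grade1 a =>
        intro y hy
        cases a with
        | vertex v => exact hv v y hy
        | edge v => exact he v y hy
        | ghost v => exact hg v y hy
      | mul a b ha hb =>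
        intro y hy
        rw [map_mul, mul_assoc]
        exact ha _ (hb _ hy)
      | add a b ha hb =>
        intro y hy
        rw [map_add, add_mul]
        exact add_mem (ha _ hy) (hb _ hy)
    obtain ⟨a, rfl⟩ := RingQuot.mkAlgHom_surjective K (LPARel K V E s r) x
    simpa using key a 1 h1
  · intro v h
    obtain ⟨Y, y0, U, hU, hS, -⟩ := exists_branch s
    obtain ⟨ρ, hρ⟩ := exists_rep (K := K) (R := K) (r := r) (wt := fun _ => 1) hU hS (by simp)
    have h1 := hρ (.vertex v)
    change ρ (lg K V E s r (.vertex v)) = opV K v at h1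
    have h : lg K V E s r (.vertex v) = 0 := h
    rw [h, map_zero] at h1
    have h2 := opV_same (K := K) (R := K) v y0 (fun _ => 1)
    rw [← h1] at h2
    simp at h2

theorem two_imp_one
    (hZ : ∀ I : Submodule (LeavittPathAlgebra K V E s r) (LeavittPathAlgebra K V E s r),
          (∃ a ∈ I, ¬ IsNilpotent a) → ∃ e ∈ I, e ≠ 0 ∧ e * e = e) : ConditionL s r := by
  classical
  intro es hcyc
  by_contra hno
  have hne := hcyc.choose
  obtain ⟨n, c, hn, hnl, hc0, hr, hinj, hper, -, hmem⟩ := cycle_seq hne hcyc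
  have hex : ∀ i f, s f = s (c i) → f = c i := by
    intro i f hf
    by_contra h
    obtain ⟨j, hj, hcj⟩ := hmem i
    rw [hcj] at hf h
    exact hno ⟨f, j, hj, hf, h⟩
  obtain ⟨Y, y0, U, hU, hS, hU1⟩ := exists_branch s
  let wt : E → RatFunc K := fun e => if e = c 0 then RatFunc.X else 1
  obtain ⟨ρ, hρ⟩ := exists_rep (K := K) (R := RatFunc K) (r := r) (wt := wt) hU hS (by
    intro e
    by_cases h : e = c 0
    · simp only [wt, h, if_true]; exact RatFunc.X_ne_zero
    · simp [wt, h])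
  refine not_zorn (fam K V E s r) hn hr hper hinj hex ρ (fun i => (s (c i), y0)) ?_ wt ?_ ?_ ?_ hZ
  · rw [hper n 0 (by simp)]
  · rw [Finset.prod_eq_single 0]
    · simp [wt]
    · intro i hi hi0
      have : c i ≠ c 0 := by
        intro h
        have h2 := hinj _ _ (congrArg s h)
        rw [Finset.mem_range] at hi
        rw [Nat.mod_eq_of_lt hi, Nat.zero_mod] at h2
        exact hi0 h2
      simp [wt, this]
    · intro h
      exact absurd (Finset.mem_range.2 hn) h
  · intro g
    have h1 := hρ (.vertex (s (c 0)))
    change ρ (lg K V E s r (.vertex (s (c 0)))) = opV K _ at h1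
    rw [h1, opV_same]
  · intro i g
    have h1 := hρ (.edge (c i))
    change ρ (lg K V E s r (.edge (c i))) = opE K s r U wt (c i) at h1
    have h2 := opE_same (K := K) (r := r) (wt := wt) hU (c i) y0 g
    rw [hU1 (c i) (hex i)] at h2
    rw [← hr, h1]
    exact h2

end Final

end LPAProof

/-- For a directed graph `E` with finitely many vertices and a field `K`,
the following are equivalent for the Leavitt path algebra `L = L_K(E)`: (i) `E` satisfies
Condition (L); (ii) `L` is a Zorn ring (every left ideal containing a non-nilpotent
element contains a nonzero idempotent); (iii) every nonzero `a ∈ L` is the von Neumann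
inverse of some nonzero `b ∈ L`, i.e. `b * a * b = b`. -/
theorem lpa_conditionL_iff_Zorn (K V E : Type) [Field K] [Fintype V] (s r : E → V) :
    List.TFAE
      [ ConditionL s r,
        ∀ I : Submodule (LeavittPathAlgebra K V E s r) (LeavittPathAlgebra K V E s r),
          (∃ a ∈ I, ¬ IsNilpotent a) →
            ∃ e ∈ I, e ≠ 0 ∧ e * e = e,
        ∀ a : LeavittPathAlgebra K V E s r, a ≠ 0 →
          ∃ b : LeavittPathAlgebra K V E s r, b ≠ 0 ∧ b * a * b = b ] := by
  tfae_have 1 → 3 := fun h a ha => LPAProof.one_imp_three (LPAProof.fam K V E s r) h a ha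
  tfae_have 3 → 2 := by
    rintro h I ⟨a, haI, hnil⟩
    have ha : a ≠ 0 := by
      rintro rfl
      exact hnil IsNilpotent.zero
    obtain ⟨b, hb, hbab⟩ := h a ha
    refine ⟨b * a, I.smul_mem b haI, ?_, ?_⟩
    · intro h0
      apply hb
      rw [← hbab, h0, zero_mul]
    · rw [← mul_assoc, hbab]
  tfae_have 2 → 1 := LPAProof.two_imp_one K V E s r
  tfae_finish
end

section
/- Let E be a finite directed graph (E⁰ and E¹ both finite) and K a field, and let L = L_K(E) be the (unital) Leavitt path algebra. Then no cycle in E has an exit if and only if L is directly finite, i.e., for all x, y ∈ L, xy = 1 implies yx = 1. -/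
namespace LPAux

/-- Path from `v` to `w`. -/
def Pth {V E : Type} (s r : E → V) : V → List E → V → Prop
  | v, [], w => v = w
  | v, e :: p, w => s e = v ∧ Pth s r (r e) p w

theorem Pth.append {V E : Type} {s r : E → V} {p q : List E} : ∀ {u v w : V},
    Pth s r u p v → Pth s r v q w → Pth s r u (p ++ q) w := by
  induction p with
  | nil => intro u v w h1 h2; cases h1; exact h2
  | cons e p ih => intro u v w h1 h2; exact ⟨h1.1, ih h1.2 h2⟩

theorem Pth.split {V E : Type} {s r : E → V} {p q : List E} : ∀ {u w : V},
    Pth s r u (p ++ q) w → ∃ v, Pth s r u p v ∧ Pth s r v q w := by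
  induction p with
  | nil => intro u w h1; exact ⟨u, rfl, h1⟩
  | cons e p ih =>
    intro u w h1
    obtain ⟨v, h2, h3⟩ := ih h1.2
    exact ⟨v, ⟨h1.1, h2⟩, h3⟩

theorem Pth.chain {V E : Type} {s r : E → V} {p : List E} : ∀ {u w : V},
    Pth s r u p w → IsPathChain s r p := by
  induction p with
  | nil => intro u w _ i h; simp at h
  | cons e p ih =>
    intro u w h i hi
    cases i with
    | zero =>
      cases p with
      | nil => simp at hi
      | cons f p => exact h.2.1.symm
    | succ i => exact ih h.2 i (by simpa using hi)

theorem Pth.last {V E : Type} {s r : E → V} {p : List E} : ∀ {u w : V},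
    Pth s r u p w → ∀ hne : p ≠ [], r (p.getLast hne) = w := by
  induction p with
  | nil => intro u w _ h; exact absurd rfl h
  | cons e p ih =>
    intro u w h hne
    cases p with
    | nil => exact h.2
    | cons f p => simpa using ih h.2 (by simp)

theorem Pth.isCycle {V E : Type} {s r : E → V} {p : List E} {u : V}
    (h : Pth s r u p u) (hne : p ≠ []) (hn : (p.map s).Nodup) : IsCycle s r p := by
  refine ⟨hne, h.chain, ?_, hn⟩
  rw [h.last hne]
  cases p with
  | nil => exact absurd rfl hne
  | cons e p => exact h.1.symm

theorem pth_of_chain {V E : Type} {s r : E → V} {p : List E} (hne : p ≠ [])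
    (h : IsPathChain s r p) : Pth s r (s (p.head hne)) p (r (p.getLast hne)) := by
  induction p with
  | nil => exact absurd rfl hne
  | cons e p ih =>
    cases p with
    | nil => exact ⟨rfl, rfl⟩
    | cons f p =>
      refine ⟨rfl, ?_⟩
      have h0 : r e = s f := h 0 (by simp)
      rw [h0]
      have := ih (by simp) (fun i hi => h (i + 1) (by simpa using hi))
      simpa using this

/-- An edge which is the only one with its source. -/
def Sole {V E : Type} (s : E → V) (p : List E) : Prop :=
  ∀ e ∈ p, ∀ f, s f = s e → f = e

theorem sole_of_noExit {V E : Type} {s r : E → V} {p : List E}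
    (h : ¬ HasExit s r p) : Sole s p := by
  intro e he f hf
  obtain ⟨i, hi, rfl⟩ := List.getElem_of_mem he
  by_contra hne
  exact h ⟨f, i, hi, hf, hne⟩

theorem prefix_of_sole {V E : Type} {s r : E → V} {p : List E} : ∀ {q : List E} {v w w' : V},
    Sole s p → Pth s r v p w → Pth s r v q w' → (∃ t, q = p ++ t) ∨ (∃ t, p = q ++ t) := by
  induction p with
  | nil => intro q v w w' _ _ _; exact Or.inl ⟨q, rfl⟩
  | cons e p ih =>
    intro q v w w' hs hp hq
    cases q with
    | nil => exact Or.inr ⟨e :: p, rfl⟩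
    | cons f q =>
      have : f = e := hs e (by simp) f (by rw [hq.1, hp.1])
      subst this
      rcases ih (fun g hg => hs g (by simp [hg])) hp.2 hq.2 with ⟨t, ht⟩ | ⟨t, ht⟩
      · exact Or.inl ⟨t, by simp [ht]⟩
      · exact Or.inr ⟨t, by simp [ht]⟩

theorem append_nil_of_cycle {V E : Type} {s r : E → V} {p t : List E} {v : V} (hne : p ≠ [])
    (hp : Pth s r v p v) (hq : Pth s r v (p ++ t) v) (hn : ((p ++ t).map s).Nodup) : t = [] := by
  cases p with
  | nil => exact absurd rfl hne
  | cons e p =>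
    cases t with
    | nil => rfl
    | cons f t =>
      exfalso
      have hl := hq.chain (p.length) (by simp)
      have h2 := hp.last hne
      have h3 : ((e :: p ++ f :: t)[p.length]'(by simp)) = (e :: p).getLast hne := by
        rw [List.getLast_eq_getElem]
        rw [List.getElem_append_left (by simp)]
        simp
      have h4 : ((e :: p ++ f :: t)[p.length + 1]'(by simp)) = f := by simp
      rw [h3, h4, h2] at hl
      have h5 := hp.1
      simp at hn
      exact hn.1.2.1 (by rw [h5, hl])

theorem cycle_unique {V E : Type} {s r : E → V} {p q : List E} {v : V}
    (hs : Sole s p) (hp : Pth s r v p v) (hq : Pth s r v q v) (hpn : (p.map s).Nodup)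
    (hqn : (q.map s).Nodup) (hp0 : p ≠ []) (hq0 : q ≠ []) : q = p := by
  rcases prefix_of_sole hs hp hq with ⟨t, rfl⟩ | ⟨t, rfl⟩
  · rw [append_nil_of_cycle hp0 hp hq hqn, List.append_nil]
  · rw [append_nil_of_cycle hq0 hq hp hpn, List.append_nil]

/-- A Leavitt family. -/
structure Fam {V E A : Type} [Fintype V] [Ring A] (s r : E → V) (vx : V → A) (ed gh : E → A) :
    Prop where
  orth : ∀ v w, v ≠ w → vx v * vx w = 0
  idem : ∀ v, vx v * vx v = vx v
  es : ∀ e, vx (s e) * ed e = ed e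
  er : ∀ e, ed e * vx (r e) = ed e
  gr : ∀ e, vx (r e) * gh e = gh e
  gs : ∀ e, gh e * vx (s e) = gh e
  ck1 : ∀ e f, e ≠ f → gh e * ed f = 0
  ck1' : ∀ e, gh e * ed e = vx (r e)
  ck2 : ∀ v (h : {e : E | s e = v}.Finite), {e : E | s e = v}.Nonempty →
    vx v = ∑ e ∈ h.toFinset, ed e * gh e
  unit : 1 = ∑ v, vx v

section fam
variable {V E A : Type} [Fintype V] [Ring A] {s r : E → V} {vx : V → A} {ed gh : E → A}

/-- product of edges -/
def pe (ed : E → A) : List E → A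
  | [] => 1
  | e :: p => ed e * pe ed p

/-- product of ghost edges, reversed -/
def pg (gh : E → A) : List E → A
  | [] => 1
  | e :: p => pg gh p * gh e

theorem pe_append (ed : E → A) (p q : List E) : pe ed (p ++ q) = pe ed p * pe ed q := by
  induction p with
  | nil => simp [pe]
  | cons e p ih => simp [pe, ih, mul_assoc]

theorem pg_append (gh : E → A) (p q : List E) : pg gh (p ++ q) = pg gh q * pg gh p := by
  induction p with
  | nil => simp [pg]
  | cons e p ih => simp [pg, ih, mul_assoc]

theorem Fam.pe_vx (F : Fam s r vx ed gh) {p : List E} : ∀ {v w}, Pth s r v p w →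
    vx v * pe ed p * vx w = pe ed p * vx w := by
  induction p with
  | nil => intro v w h; cases h; simp [pe, F.idem]
  | cons e p ih =>
    intro v w h
    obtain ⟨rfl, h⟩ := h
    simp only [pe]
    rw [← mul_assoc, F.es]

theorem Fam.vx_pg (F : Fam s r vx ed gh) {p : List E} : ∀ {v w}, Pth s r v p w →
    vx w * pg gh p * vx v = vx w * pg gh p := by
  induction p with
  | nil => intro v w h; cases h; simp [pg, F.idem]
  | cons e p ih =>
    intro v w h
    obtain ⟨rfl, h⟩ := h
    simp only [pg]
    rw [mul_assoc, mul_assoc, F.gs]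

theorem Fam.pg_pe (F : Fam s r vx ed gh) {p : List E} : ∀ {v w}, Pth s r v p w →
    pg gh p * pe ed p * vx w = vx w := by
  induction p with
  | nil => intro v w h; cases h; simp [pg, pe]
  | cons e p ih =>
    intro v w h
    obtain ⟨rfl, h⟩ := h
    simp only [pg, pe]
    calc pg gh p * gh e * (ed e * pe ed p) * vx w
        = pg gh p * ((gh e * ed e) * pe ed p * vx w) := by noncomm_ring
      _ = _ := by rw [F.ck1', F.pe_vx h, ← mul_assoc, ih h]

theorem Fam.sole (F : Fam s r vx ed gh) {e : E} (h : ∀ f, s f = s e → f = e) :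
    ed e * gh e = vx (s e) := by
  have h1 : {f : E | s f = s e} = {e} := by
    ext f
    simp only [Set.mem_ofPred_eq, Set.mem_singleton_iff]
    exact ⟨h f, fun h => by rw [h]⟩
  have hf : {f : E | s f = s e}.Finite := by rw [h1]; exact Set.finite_singleton e
  rw [F.ck2 (s e) hf ⟨e, rfl⟩]
  have : hf.toFinset = {e} := by ext f; simp [← Set.mem_singleton_iff, ← h1]
  rw [this, Finset.sum_singleton]

theorem Fam.pe_pg (F : Fam s r vx ed gh) {p : List E} : ∀ {v w}, Sole s p → Pth s r v p w →
    pe ed p * vx w * pg gh p = vx v := by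
  induction p with
  | nil => intro v w _ h; cases h; simp [pg, pe]
  | cons e p ih =>
    intro v w hs h
    obtain ⟨rfl, h⟩ := h
    simp only [pg, pe]
    calc ed e * pe ed p * vx w * (pg gh p * gh e)
        = ed e * (pe ed p * vx w * pg gh p) * gh e := by noncomm_ring
      _ = _ := by
        rw [ih (fun g hg => hs g (by simp [hg])) h, F.er, F.sole (hs e (by simp))]

theorem Fam.unit_mul (F : Fam s r vx ed gh) {c c' w : A} (hw : w * w = w) (h1 : w * c = c)
    (h2 : c * w = c) (h3 : w * c' = c') (h4 : c' * w = c') (h5 : c * c' = w) :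
    (c + (1 - w)) * (c' + (1 - w)) = 1 := by
  simp [add_mul, mul_add, sub_mul, mul_sub, *]

theorem Fam.no_df (F : Fam s r vx ed gh) (hnz : ∀ v, vx v ≠ 0) {es : List E}
    (hc : IsCycle s r es) (hx : HasExit s r es) : ∃ x y : A, x * y = 1 ∧ y * x ≠ 1 := by
  obtain ⟨hne, hch, hcl, -⟩ := hc
  have hp := pth_of_chain hne hch
  rw [hcl] at hp
  set v := s (es.head hne)
  obtain ⟨f, i, hi, hf, hfe⟩ := hx
  set e := es[i] with he
  have hsplit : es = es.take i ++ (e :: es.drop (i + 1)) := by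
    simp [he]
  generalize es.take i = p1 at hsplit
  generalize es.drop (i+1) = p2 at hsplit
  have idem := F.idem v
  have a1 := F.pe_vx hp
  have a2 := F.vx_pg hp
  have a3 := F.pg_pe hp
  have b1 : vx v * (pe ed es * vx v) = pe ed es * vx v := by rw [← mul_assoc, a1]
  have b2 : (pe ed es * vx v) * vx v = pe ed es * vx v := by rw [mul_assoc, idem]
  have b3 : vx v * (vx v * pg gh es) = vx v * pg gh es := by rw [← mul_assoc, idem]
  have b5 : (vx v * pg gh es) * (pe ed es * vx v) = vx v := by
    rw [mul_assoc, ← mul_assoc (pg gh es), a3, idem]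
  refine ⟨vx v * pg gh es + (1 - vx v), pe ed es * vx v + (1 - vx v),
    F.unit_mul idem b3 a2 b1 b2 b5, fun h => ?_⟩
  have h1 : (pe ed es * vx v) * (vx v * pg gh es) = vx v := by
    have h' : (pe ed es * vx v + (1 - vx v)) * (vx v * pg gh es + (1 - vx v))
      = (pe ed es * vx v) * (vx v * pg gh es) + (1 - vx v) := by
      simp only [add_mul, mul_add, sub_mul, mul_sub, mul_one, one_mul, b1, b2, b3, a2, idem]
      abel
    rw [h'] at h
    have := sub_eq_zero.mpr h
    rw [← sub_eq_zero, ← this]; abel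
  rw [hsplit] at hp
  obtain ⟨u, hp1, hp2⟩ := hp.split
  have hp3 : Pth s r v (p1 ++ [f]) (r f) := hp1.append ⟨by rw [hf]; exact hp2.1, rfl⟩
  have key : pg gh (p1 ++ [f]) * pe ed es = 0 := by
    have hu : s e = u := hp2.1
    rw [hsplit, pg_append, pe_append]
    simp only [pg, pe, one_mul]
    have q := F.pg_pe hp1
    calc gh f * pg gh p1 * (pe ed p1 * (ed e * pe ed p2))
        = gh f * (pg gh p1 * pe ed p1 * (vx (s e) * ed e)) * pe ed p2 := by
          rw [F.es]; noncomm_ring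
      _ = gh f * (pg gh p1 * pe ed p1 * vx u) * ed e * pe ed p2 := by
          rw [hu]; noncomm_ring
      _ = 0 := by rw [q, ← hu, mul_assoc (gh f), F.es, F.ck1 _ _ hfe, zero_mul]
  apply hnz (r f)
  rw [← F.pg_pe hp3, mul_assoc, ← F.pe_vx hp3, ← h1]
  calc _ = (pg gh (p1 ++ [f]) * pe ed es) * (vx v * (vx v * pg gh es) * pe ed (p1 ++ [f]) * vx (r f)) := by
        noncomm_ring
    _ = 0 := by rw [key, zero_mul]

end fam

section forward
variable {K V E A : Type} [Field K] [Fintype V] [Fintype E] [Ring A] [Algebra K A]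
  {s r : E → V} {vx : V → A} {ed gh : E → A}

theorem finite_gens (s : E → V) : {p : List E | (p.map s).Nodup}.Finite := by
  classical
  have h0 : Finite {p : List E // p.Nodup} := @Finite.of_fintype _ fintypeNodupList
  have : {p : List E | p.Nodup}.Finite := h0
  exact this.subset fun p hp => List.Nodup.of_map s hp

theorem surj_inj {R : Type} [CommRing R] [Module R A]
    (hsm : ∀ (k : R) (a b : A), k • (a * b) = a * k • b) (G : Set A) (hG : G.Finite)
    (hcl : ∀ a : A, ∀ g ∈ G, a * g ∈ Submodule.span R G) (x y : A) (hxy : x * y = 1) :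
    ∀ n ∈ Submodule.span R G, y * x * n = n := by
  set N := Submodule.span R G with hN
  have hcl' : ∀ a : A, ∀ n ∈ N, a * n ∈ N := by
    intro a n hn
    induction hn using Submodule.span_induction with
    | mem g hg => exact hcl a g hg
    | zero => simp
    | add u v _ _ h1 h2 => rw [mul_add]; exact N.add_mem h1 h2
    | smul k u _ h1 => rw [← hsm]; exact N.smul_mem k h1
  haveI : Module.Finite R N := Module.Finite.iff_fg.mpr (Submodule.fg_span hG)
  let f : N →ₗ[R] N :=
    { toFun := fun n => ⟨x * n.1, hcl' x n.1 n.2⟩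
      map_add' := fun a b => by ext; simp [mul_add]
      map_smul' := fun k a => by ext; simp [hsm] }
  have hsurj : Function.Surjective f := by
    intro n
    refine ⟨⟨y * n.1, hcl' y n.1 n.2⟩, ?_⟩
    ext
    simp [f, ← mul_assoc, hxy]
  have hinj : Function.Injective f := OrzechProperty.injective_of_surjective_endomorphism f hsurj
  intro n hn
  have := @hinj ⟨y * x * n, hcl' _ _ hn⟩ ⟨n, hn⟩ (by
    ext
    simp only [f, LinearMap.coe_mk, AddHom.coe_mk]
    rw [← mul_assoc, ← mul_assoc, hxy, one_mul])
  exact congrArg Subtype.val this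

/-- the action hom -/
noncomputable def act (K : Type) [Field K] [Algebra K A] (u : Aᵐᵒᵖˣ) :
    MonoidAlgebra K (Multiplicative ℤ) →ₐ[K] Aᵐᵒᵖ :=
  MonoidAlgebra.lift K Aᵐᵒᵖ (Multiplicative ℤ)
    ((Units.coeHom Aᵐᵒᵖ).comp (zpowersHom _ u))

theorem act_gen (u : Aᵐᵒᵖˣ) (n : ℤ) :
    act K u (MonoidAlgebra.of K _ (Multiplicative.ofAdd n)) = ((u ^ n : Aᵐᵒᵖˣ) : Aᵐᵒᵖ) := by
  simp [act]

theorem df_of_unit (u : Aˣ) (G : Set A) (hG : G.Finite)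
    (hgen : ∀ S : Subalgebra K A, (∀ v, vx v ∈ S) → (∀ e, ed e ∈ S) → (∀ e, gh e ∈ S) → S = ⊤)
    (h : ∀ N : Submodule K A, G ⊆ N → (∀ n ∈ N, n * (u : A) ∈ N) →
      (∀ n ∈ N, n * ((u⁻¹ : Aˣ) : A) ∈ N) → ∀ g ∈ G,
      (∀ v, vx v * g ∈ N) ∧ (∀ e, ed e * g ∈ N) ∧ (∀ e, gh e * g ∈ N))
    (x y : A) (hxy : x * y = 1) : ∀ a : A, ∀ g ∈ G, y * x * (a * g) = a * g := by
  let uo : Aᵐᵒᵖˣ := ⟨MulOpposite.op u, MulOpposite.op ((u⁻¹ : Aˣ) : A),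
    by rw [← MulOpposite.op_mul]; simp, by rw [← MulOpposite.op_mul]; simp⟩
  let R := MonoidAlgebra K (Multiplicative ℤ)
  letI : Module R A := Module.compHom A (act K uo).toRingHom
  have smul_def : ∀ (k : R) (a : A), k • a = a * (act K uo k).unop := fun k a => rfl
  have hsm : ∀ (k : R) (a b : A), k • (a * b) = a * k • b := by
    intro k a b; rw [smul_def, smul_def, mul_assoc]
  let N := Submodule.span R G
  let S : Subalgebra K A :=
    { carrier := {a | ∀ n ∈ N, a * n ∈ N}
      mul_mem' := fun {a b} ha hb n hn => by rw [mul_assoc]; exact ha _ (hb _ hn)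
      add_mem' := fun {a b} ha hb n hn => by rw [add_mul]; exact N.add_mem (ha _ hn) (hb _ hn)
      algebraMap_mem' := fun k n hn => by
        have : algebraMap K A k * n = (algebraMap K R k) • n := by
          rw [smul_def, AlgHom.commutes]
          simp [MulOpposite.algebraMap_apply, Algebra.commutes]
        rw [this]
        exact N.smul_mem _ hn }
  have hcl' : ∀ a : A, (∀ g ∈ G, a * g ∈ N) → a ∈ S := by
    intro a ha n hn
    induction hn using Submodule.span_induction with
    | mem g hg => exact ha g hg
    | zero => simp
    | add u v _ _ h1 h2 => rw [mul_add]; exact N.add_mem h1 h2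
    | smul k u _ h1 => rw [← hsm]; exact N.smul_mem k h1
  let N' : Submodule K A :=
    { carrier := N
      add_mem' := fun ha hb => N.add_mem ha hb
      zero_mem' := N.zero_mem
      smul_mem' := fun k n hn => by
        have : k • n = (algebraMap K R k) • n := by
          rw [smul_def, AlgHom.commutes]
          simp [MulOpposite.algebraMap_apply, Algebra.smul_def, Algebra.commutes]
        rw [this]
        exact N.smul_mem _ hn }
  have hN' := h N' (Submodule.subset_span) (by
    intro n hn
    have : n * (u : A) = (MonoidAlgebra.of K _ (Multiplicative.ofAdd (1 : ℤ)) : R) • n := by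
      rw [smul_def, act_gen]; simp [uo]
    rw [this]; exact N.smul_mem _ hn) (by
    intro n hn
    have : n * ((u⁻¹ : Aˣ) : A) = (MonoidAlgebra.of K _ (Multiplicative.ofAdd (-1 : ℤ)) : R) • n := by
      rw [smul_def, act_gen, zpow_neg_one]; rfl
    rw [this]; exact N.smul_mem _ hn)
  have hS : S = ⊤ := hgen S (fun v => hcl' _ fun g hg => (hN' g hg).1 v)
    (fun v => hcl' _ fun g hg => (hN' g hg).2.1 v) (fun v => hcl' _ fun g hg => (hN' g hg).2.2 v)
  have hall : ∀ a : A, ∀ n ∈ N, a * n ∈ N := fun a => by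
    have : a ∈ S := by rw [hS]; trivial
    exact this
  intro a g hg
  exact surj_inj hsm G hG (fun a g hg => hall a g (Submodule.subset_span hg)) x y hxy _
    (hall a g (Submodule.subset_span hg))

theorem Fam.gh_gen (F : Fam s r vx ed gh) {w : V} {e f : E} {p : List E}
    (h : Pth s r (s f) (f :: p) w) : gh e * (pe ed (f :: p) * vx w) = 0 ∨
      (e = f ∧ gh e * (pe ed (f :: p) * vx w) = pe ed p * vx w) := by
  by_cases hef : e = f
  · right
    refine ⟨hef, ?_⟩
    subst hef
    rw [pe, mul_assoc, ← mul_assoc (gh e), F.ck1', ← mul_assoc, F.pe_vx h.2]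
  · left
    rw [pe, mul_assoc, ← mul_assoc (gh e), F.ck1 _ _ hef, zero_mul]

theorem Fam.vx_gen (F : Fam s r vx ed gh) {v v' w : V} {p : List E}
    (h : Pth s r v p w) : vx v' * (pe ed p * vx w) = 0 ∨
      vx v' * (pe ed p * vx w) = pe ed p * vx w := by
  by_cases hv : v' = v
  · right; subst hv; rw [← mul_assoc, F.pe_vx h]
  · left
    rw [← F.pe_vx h, ← mul_assoc, ← mul_assoc, F.orth _ _ hv, zero_mul, zero_mul]

/-- If adding an edge repeats a source then the path is a cycle at `w`. -/
theorem cons_dup (hno : ∀ es : List E, IsCycle s r es → ¬ HasExit s r es) {w : V} {e : E}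
    {p : List E} (hp : Pth s r (r e) p w) (hn : (p.map s).Nodup) (he : s e ∈ p.map s) :
    r e = w ∧ p ≠ [] := by
  obtain ⟨f, hf, hfe⟩ := List.mem_map.mp he
  obtain ⟨p1, p2, rfl⟩ := List.append_of_mem hf
  refine ⟨?_, by simp⟩
  obtain ⟨u, h1, h2⟩ := hp.split
  have hu : s f = u := h2.1
  have hc : Pth s r (s e) (e :: p1) (s e) := ⟨rfl, by rw [← hfe, hu]; exact h1⟩
  have hn1 : ((e :: p1).map s).Nodup := by
    rw [List.map_append, List.map_cons, List.nodup_append] at hn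
    rw [List.map_cons, List.nodup_cons]
    refine ⟨fun hm => hn.2.2 _ hm (s f) (by simp) hfe.symm, hn.1⟩
  have hs := sole_of_noExit (hno _ (hc.isCycle (by simp) hn1))
  have hfe' : f = e := hs e (by simp) f hfe
  subst hfe'
  cases p2 with
  | nil => exact h2.2
  | cons g p2 =>
    exfalso
    have hg : s g = r f := h2.2.1
    cases p1 with
    | nil =>
      have : r f = u := h1
      simp [hg, this, hu] at hn
    | cons g' p1 =>
      have : s g' = r f := h1.1
      simp [hg, this] at hn

theorem Fam.gen_edge (F : Fam s r vx ed gh)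
    (hno : ∀ es : List E, IsCycle s r es → ¬ HasExit s r es) {v w : V} {p : List E}
    (hp : Pth s r v p w) (hn : (p.map s).Nodup) (e : E) :
    ed e * (pe ed p * vx w) = 0 ∨
    (Pth s r (s e) (e :: p) w ∧ ((e :: p).map s).Nodup) ∨
    (r e = w ∧ p ≠ [] ∧ Pth s r w p w) := by
  by_cases hv : r e = v
  · subst hv
    right
    by_cases he : s e ∈ p.map s
    · right
      obtain ⟨h1, h2⟩ := cons_dup hno hp hn he
      exact ⟨h1, h2, by rwa [h1] at hp⟩
    · left
      exact ⟨⟨rfl, hp⟩, by rw [List.map_cons, List.nodup_cons]; exact ⟨he, hn⟩⟩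
  · left
    rw [← F.pe_vx hp, ← F.er e, mul_assoc, ← mul_assoc (vx (r e)), ← mul_assoc (vx (r e)),
      F.orth _ _ hv, zero_mul, zero_mul, mul_zero]

/-- the generators of `L w` -/
def gens (s r : E → V) (vx : V → A) (ed : E → A) (w : V) : Set A :=
  (fun p => pe ed p * vx w) '' {p : List E | (p.map s).Nodup ∧ ∃ v, Pth s r v p w}

theorem gens_finite (w : V) : (gens s r vx ed w).Finite :=
  ((finite_gens s).subset fun _ hp => hp.1).image _

theorem Fam.sink (F : Fam s r vx ed gh)
    (hno : ∀ es : List E, IsCycle s r es → ¬ HasExit s r es)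
    (hgen : ∀ S : Subalgebra K A, (∀ v, vx v ∈ S) → (∀ e, ed e ∈ S) → (∀ e, gh e ∈ S) → S = ⊤)
    (w : V) (hw : ∀ e, s e ≠ w)
    (x y : A) (hxy : x * y = 1) (a : A) : y * x * (a * vx w) = a * vx w := by
  refine df_of_unit (vx := vx) (ed := ed) (gh := gh) 1 (gens s r vx ed w) (gens_finite w)
    hgen ?_ x y hxy a _ ?_
  · rintro N hGN - - _ ⟨p, ⟨hn, v, hp⟩, rfl⟩
    have hmem : ∀ v p, Pth s r v p w → (p.map s).Nodup → pe ed p * vx w ∈ N :=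
      fun v p hp hn => hGN ⟨p, ⟨hn, v, hp⟩, rfl⟩
    refine ⟨fun v' => ?_, fun e => ?_, fun e => ?_⟩
    · rcases F.vx_gen (v' := v') hp with h | h
      · simp only [h, zero_mem]
      · simp only [h]; exact hmem v p hp hn
    · rcases F.gen_edge hno hp hn e with h | h | h
      · simp only [h, zero_mem]
      · have := hmem _ _ h.1 h.2
        rwa [pe, mul_assoc] at this
      · exfalso
        obtain ⟨-, h2, h3⟩ := h
        cases p with
        | nil => exact h2 rfl
        | cons f p => exact hw f h3.1
    · cases p with
      | nil =>
        simp only [pe, one_mul]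
        rw [← F.gs e, mul_assoc, F.orth _ _ (hw e), mul_zero]
        exact N.zero_mem
      | cons f p =>
        have hp' : Pth s r (s f) (f :: p) w := ⟨rfl, hp.2⟩
        rcases F.gh_gen (e := e) hp' with h | h
        · simp only [h, zero_mem]
        · simp only [h.2]
          exact hmem _ p hp.2 (by simp at hn; exact hn.2)
  · exact ⟨[], ⟨by simp, w, rfl⟩, by simp [pe]⟩

theorem Fam.cyc (F : Fam s r vx ed gh)
    (hno : ∀ es : List E, IsCycle s r es → ¬ HasExit s r es)
    (hgen : ∀ S : Subalgebra K A, (∀ v, vx v ∈ S) → (∀ e, ed e ∈ S) → (∀ e, gh e ∈ S) → S = ⊤)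
    (w : V) (c : List E) (hc : Pth s r w c w) (hc0 : c ≠ []) (hcn : (c.map s).Nodup)
    (x y : A) (hxy : x * y = 1) (a : A) : y * x * (a * vx w) = a * vx w := by
  have hs := sole_of_noExit (hno _ (hc.isCycle hc0 hcn))
  have idem := F.idem w
  have a1 := F.pe_vx hc
  have a2 := F.vx_pg hc
  have a3 := F.pg_pe hc
  have b1 : vx w * (pe ed c * vx w) = pe ed c * vx w := by rw [← mul_assoc, a1]
  have b2 : (pe ed c * vx w) * vx w = pe ed c * vx w := by rw [mul_assoc, idem]
  have b3 : vx w * (vx w * pg gh c) = vx w * pg gh c := by rw [← mul_assoc, idem]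
  have b5 : (vx w * pg gh c) * (pe ed c * vx w) = vx w := by
    rw [mul_assoc, ← mul_assoc (pg gh c), a3, idem]
  have b6 : (pe ed c * vx w) * (vx w * pg gh c) = vx w := by
    rw [← mul_assoc, b2, F.pe_pg hs hc]
  let u : Aˣ := ⟨pe ed c * vx w + (1 - vx w), vx w * pg gh c + (1 - vx w),
    F.unit_mul idem b1 b2 b3 a2 b6, F.unit_mul idem b3 a2 b1 b2 b5⟩
  have hu : vx w * (u : A) = pe ed c * vx w := by
    simp only [u, mul_add, mul_sub, mul_one, b1, idem, sub_self, add_zero]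
  have hu' : vx w * ((u⁻¹ : Aˣ) : A) = vx w * pg gh c := by
    simp only [u, Units.inv_mk, mul_add, mul_sub, mul_one, b3, idem, sub_self, add_zero]
  refine df_of_unit (vx := vx) (ed := ed) (gh := gh) u (gens s r vx ed w) (gens_finite w)
    hgen ?_ x y hxy a _ ?_
  · rintro N hGN hNu hNu' _ ⟨p, ⟨hn, v, hp⟩, rfl⟩
    have hmem : ∀ v p, Pth s r v p w → (p.map s).Nodup → pe ed p * vx w ∈ N :=
      fun v p hp hn => hGN ⟨p, ⟨hn, v, hp⟩, rfl⟩
    refine ⟨fun v' => ?_, fun e => ?_, fun e => ?_⟩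
    · rcases F.vx_gen (v' := v') hp with h | h
      · simp only [h, zero_mem]
      · simp only [h]; exact hmem v p hp hn
    · rcases F.gen_edge hno hp hn e with h | h | h
      · simp only [h, zero_mem]
      · have := hmem _ _ h.1 h.2
        rwa [pe, mul_assoc] at this
      · obtain ⟨h1, h2, h3⟩ := h
        have hpc : p = c := cycle_unique hs hc h3 hcn hn hc0 h2
        subst hpc
        have := hNu _ (hmem (s e) [e] ⟨rfl, h1⟩ (by simp))
        simpa only [pe, mul_one, mul_assoc, hu] using this
    · cases p with
      | nil =>
        simp only [pe, one_mul]
        by_cases hew : s e = w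
        · cases c with
          | nil => exact absurd rfl hc0
          | cons f c =>
            have : e = f := hs f (by simp) e (by rw [hew, hc.1])
            subst this
            have h1 := hNu' _ (hmem _ c hc.2 (by simp at hcn; exact hcn.2))
            rw [mul_assoc, hu'] at h1
            convert h1 using 1
            conv_lhs => rw [← F.pe_pg hs hc]
            simp only [pe, mul_assoc]
            rw [← mul_assoc (gh e), F.ck1', ← mul_assoc, ← mul_assoc, F.pe_vx hc.2, mul_assoc]
        · rw [← F.gs e, mul_assoc, F.orth _ _ hew, mul_zero]
          exact N.zero_mem
      | cons f p =>
        have hp' : Pth s r (s f) (f :: p) w := ⟨rfl, hp.2⟩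
        rcases F.gh_gen (e := e) hp' with h | h
        · simp only [h, zero_mem]
        · simp only [h.2]
          exact hmem _ p hp.2 (by simp at hn; exact hn.2)
  · exact ⟨[], ⟨by simp, w, rfl⟩, by simp [pe]⟩

theorem Fam.df (F : Fam s r vx ed gh)
    (hno : ∀ es : List E, IsCycle s r es → ¬ HasExit s r es)
    (hgen : ∀ S : Subalgebra K A, (∀ v, vx v ∈ S) → (∀ e, ed e ∈ S) → (∀ e, gh e ∈ S) → S = ⊤)
    (x y : A) (hxy : x * y = 1) : y * x = 1 := by
  classical
  let Bad : V → Prop := fun v => ∃ a, y * x * (a * vx v) ≠ a * vx v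
  have hcyc : ∀ v, Bad v → ∀ c, Pth s r v c v → c ≠ [] → ¬ (c.map s).Nodup := by
    rintro v ⟨a, ha⟩ c hc hc0 hcn
    exact ha (F.cyc hno hgen v c hc hc0 hcn x y hxy a)
  have hstep : ∀ v, Bad v → ∃ e, s e = v ∧ Bad (r e) := by
    rintro v ⟨a, ha⟩
    by_contra hcon
    push Not at hcon
    by_cases hsk : ∀ e, s e ≠ v
    · exact ha (F.sink hno hgen v hsk x y hxy a)
    · push Not at hsk
      obtain ⟨e0, he0⟩ := hsk
      apply ha
      rw [F.ck2 v (Set.toFinite _) ⟨e0, he0⟩]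
      simp only [Finset.mul_sum]
      refine Finset.sum_congr rfl fun e he => ?_
      have he' : s e = v := by simpa using he
      have h1 : ¬ Bad (r e) := hcon e he'
      have h2 : ∀ b, y * x * (b * vx (r e)) = b * vx (r e) := by
        intro b; by_contra hb; exact h1 ⟨b, hb⟩
      have h3 := h2 (a * ed e)
      rw [mul_assoc a, F.er] at h3
      rw [← mul_assoc a, ← mul_assoc (y * x), h3]
  have hnb : ∀ v, ¬ Bad v := by
    intro v hv
    have hlong : ∀ n : ℕ, ∃ (p : List E) (w : V), p.length = n ∧ Pth s r v p w ∧
        (p.map s).Nodup ∧ Bad w := by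
      intro n
      induction n with
      | zero => exact ⟨[], v, rfl, rfl, by simp, hv⟩
      | succ n ih =>
        obtain ⟨p, w, hl, hp, hn, hb⟩ := ih
        obtain ⟨e, he, hbe⟩ := hstep w hb
        refine ⟨p ++ [e], r e, by simp [hl], hp.append ⟨he, rfl⟩, ?_, hbe⟩
        rw [List.map_append, List.nodup_append]
        refine ⟨hn, by simp, ?_⟩
        intro b hb1 b' hb2 hbb
        subst hbb
        simp only [List.map_cons, List.map_nil, List.mem_singleton] at hb2
        subst hb2
        obtain ⟨f, hf, hfe⟩ := List.mem_map.mp hb1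
        obtain ⟨p1, p2, rfl⟩ := List.append_of_mem hf
        obtain ⟨u, h1, h2⟩ := hp.split
        have hu : s f = u := h2.1
        have huw : u = w := by rw [← hu, hfe, he]
        subst huw
        apply hcyc u hb _ h2 (by simp)
        rw [List.map_append, List.nodup_append] at hn
        exact hn.2.1
    obtain ⟨p, w, hl, -, hn, -⟩ := hlong (Fintype.card V + 1)
    have := hn.length_le_card
    simp [hl] at this
  have h1 : y * x * 1 = 1 := by
    rw [F.unit, Finset.mul_sum]
    refine Finset.sum_congr rfl fun v _ => ?_
    by_contra hb
    exact hnb v ⟨1, by simpa using hb⟩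
  simpa using h1

end forward

section concrete
variable (K V E : Type) [Field K] [Fintype V] (s r : E → V)

/-- image of a generator -/
noncomputable def gn (g : LPAGen V E) : LeavittPathAlgebra K V E s r :=
  RingQuot.mkAlgHom K (LPARel K V E s r) (FreeAlgebra.ι K g)

theorem lfam : Fam s r (fun v => gn K V E s r (.vertex v)) (fun e => gn K V E s r (.edge e))
    (fun e => gn K V E s r (.ghost e)) where
  orth v w h := by
    simpa [gn] using RingQuot.mkAlgHom_rel K (LPARel.vertex_orth (K := K) (s := s) (r := r) v w h)
  idem v := by
    simpa [gn] using RingQuot.mkAlgHom_rel K (LPARel.vertex_idem (K := K) (s := s) (r := r) v)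
  es e := by
    simpa [gn] using RingQuot.mkAlgHom_rel K (LPARel.edge_src (K := K) (s := s) (r := r) e)
  er e := by
    simpa [gn] using RingQuot.mkAlgHom_rel K (LPARel.edge_rng (K := K) (s := s) (r := r) e)
  gr e := by
    simpa [gn] using RingQuot.mkAlgHom_rel K (LPARel.ghost_rng (K := K) (s := s) (r := r) e)
  gs e := by
    simpa [gn] using RingQuot.mkAlgHom_rel K (LPARel.ghost_src (K := K) (s := s) (r := r) e)
  ck1 e f h := by
    simpa [gn] using RingQuot.mkAlgHom_rel K (LPARel.ck1_distinct (K := K) (s := s) (r := r) e f h)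
  ck1' e := by
    simpa [gn] using RingQuot.mkAlgHom_rel K (LPARel.ck1_same (K := K) (s := s) (r := r) e)
  ck2 v h hne := by
    have := RingQuot.mkAlgHom_rel K (LPARel.ck2 (K := K) (s := s) (r := r) v h hne)
    simpa only [gn, map_sum, map_mul] using this
  unit := by
    have := RingQuot.mkAlgHom_rel K (LPARel.unit (K := K) (E := E) (s := s) (r := r))
    simpa only [gn, map_sum, map_one] using this

theorem lgen (S : Subalgebra K (LeavittPathAlgebra K V E s r))
    (h : ∀ g, gn K V E s r g ∈ S) : S = ⊤ := by
  rw [eq_top_iff]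
  rintro x -
  obtain ⟨a, rfl⟩ := RingQuot.mkAlgHom_surjective K (LPARel K V E s r) x
  induction a using FreeAlgebra.induction with
  | grade0 k => rw [AlgHom.commutes]; exact S.algebraMap_mem k
  | grade1 g => exact h g
  | mul a b ha hb => rw [map_mul]; exact S.mul_mem ha hb
  | add a b ha hb => rw [map_add]; exact S.add_mem ha hb

variable {K V E s r}

/-- the map on generators -/
def genMap {A : Type} (vx : V → A) (ed gh : E → A) : LPAGen V E → A
  | .vertex v => vx v
  | .edge e => ed e
  | .ghost e => gh e

theorem vx_ne_zero {A : Type} [Ring A] [Algebra K A] {vx : V → A} {ed gh : E → A}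
    (F : Fam s r vx ed gh) (hnz : ∀ v, vx v ≠ 0) (v : V) : gn K V E s r (.vertex v) ≠ 0 := by
  let φ : LeavittPathAlgebra K V E s r →ₐ[K] A :=
    RingQuot.liftAlgHom K ⟨FreeAlgebra.lift K (genMap vx ed gh), by
      intro a b hab
      induction hab with
      | vertex_orth v w h => simpa [genMap] using F.orth v w h
      | vertex_idem v => simpa [genMap] using F.idem v
      | edge_src e => simpa [genMap] using F.es e
      | edge_rng e => simpa [genMap] using F.er e
      | ghost_rng e => simpa [genMap] using F.gr e
      | ghost_src e => simpa [genMap] using F.gs e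
      | ck1_distinct e f h => simpa [genMap] using F.ck1 e f h
      | ck1_same e => simpa [genMap] using F.ck1' e
      | ck2 v h hne =>
        have := F.ck2 v h hne
        simpa only [map_sum, map_mul, FreeAlgebra.lift_ι_apply, genMap] using this
      | unit =>
        have := F.unit
        simpa only [map_sum, map_one, FreeAlgebra.lift_ι_apply, genMap] using this⟩
  intro h
  apply hnz v
  have h1 : φ (gn K V E s r (.vertex v)) = vx v := by
    simp [φ, gn, genMap]
  rw [← h1, h, map_zero]

theorem exists_code [Finite E] (s : E → V) : ∃ (enc : E × ℕ → V × ℕ), Function.Injective enc ∧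
    (∀ x, (enc x).1 = s x.1) ∧ ∀ y, (∃ e, s e = y.1) → ∃ x, enc x = y := by
  classical
  have : ∀ v : V, (∃ e, s e = v) → Nonempty ({e : E // s e = v} × ℕ ≃ ℕ) := by
    rintro v ⟨e, he⟩
    haveI : Nonempty {e : E // s e = v} := ⟨⟨e, he⟩⟩
    exact nonempty_equiv_of_countable
  have φ := fun v h => Classical.choice (this v h)
  refine ⟨fun x => (s x.1, φ (s x.1) ⟨x.1, rfl⟩ (⟨x.1, rfl⟩, x.2)), ?_, fun x => rfl, ?_⟩
  · rintro ⟨e, m⟩ ⟨f, n⟩ h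
    simp only [Prod.mk.injEq] at h
    obtain ⟨h1, h2⟩ := h
    have aux : ∀ v (hv : s e = v) (hf : s f = v) (H : ∃ e, s e = v),
        φ v H (⟨e, hv⟩, m) = φ v H (⟨f, hf⟩, n) → (e, m) = (f, n) := by
      intro v hv hf H hh
      have := (φ v H).injective hh
      simpa using this
    apply aux (s f) h1 rfl ⟨f, rfl⟩
    rw [← h2]
    have aux2 : ∀ v (hv : s e = v) (H : ∃ e, s e = v),
        φ v H (⟨e, hv⟩, m) = φ (s e) ⟨e, rfl⟩ (⟨e, rfl⟩, m) := by
      intro v hv H; subst hv; rfl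
    exact aux2 _ h1 _
  · rintro ⟨v, n⟩ h
    obtain ⟨⟨⟨e, he⟩, m⟩, hx⟩ := (φ v h).surjective n
    refine ⟨(e, m), ?_⟩
    subst he
    simp [hx]

theorem exists_rep (K : Type) [Field K] [Finite E] (s r : E → V) :
    ∃ (vx : V → Module.End K (V × ℕ → K)) (ed gh : E → Module.End K (V × ℕ → K)),
      Fam s r vx ed gh ∧ ∀ v, vx v ≠ 0 := by
  classical
  obtain ⟨enc, hinj, h1, h2⟩ := exists_code s
  have hd : ∃ dec : V × ℕ → Option (E × ℕ), ∀ x y, dec y = some x ↔ enc x = y :=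
    ⟨Function.partialInv enc, fun x y => Function.Injective.isPartialInv hinj x y⟩
  obtain ⟨dec, hdec⟩ := hd
  have hde : ∀ x, dec (enc x) = some x := fun x => (hdec x _).2 rfl
  let vx : V → Module.End K (V × ℕ → K) := fun v =>
    { toFun := fun f x => if x.1 = v then f x else 0
      map_add' := fun f g => by ext x; simp only [Pi.add_apply]; split_ifs <;> simp
      map_smul' := fun k f => by ext x; simp }
  let gh : E → Module.End K (V × ℕ → K) := fun e =>
    { toFun := fun f x => if x.1 = r e then f (enc (e, x.2)) else 0
      map_add' := fun f g => by ext x; simp only [Pi.add_apply]; split_ifs <;> simp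
      map_smul' := fun k f => by ext x; simp }
  let ed : E → Module.End K (V × ℕ → K) := fun e =>
    { toFun := fun f x => (dec x).elim 0 (fun z => if z.1 = e then f (r e, z.2) else 0)
      map_add' := fun f g => by
        ext x; simp only [Pi.add_apply]
        cases dec x with
        | none => simp
        | some z => simp only [Option.elim]; split_ifs <;> simp
      map_smul' := fun k f => by
        ext x; simp only [Pi.smul_apply, RingHom.id_apply]
        cases dec x with
        | none => simp
        | some z => simp }
  have vxa : ∀ v f x, vx v f x = if x.1 = v then f x else 0 := fun _ _ _ => rfl
  have gha : ∀ e f x, gh e f x = if x.1 = r e then f (enc (e, x.2)) else 0 := fun _ _ _ => rfl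
  have eda : ∀ e f x, ed e f x =
    (dec x).elim 0 (fun z => if z.1 = e then f (r e, z.2) else 0) := fun _ _ _ => rfl
  have hsrc : ∀ x z, dec x = some z → x.1 = s z.1 := by
    intro x z h; rw [hdec] at h; rw [← h, h1]
  refine ⟨vx, ed, gh, ?_, ?_⟩
  · constructor
    · intro v w h
      refine LinearMap.ext fun f => funext fun x => ?_
      simp only [Module.End.mul_apply, vxa]
      split_ifs with h3 h4
      · exact absurd (h3.symm.trans h4) h
      · rfl
      · rfl
    · intro v
      refine LinearMap.ext fun f => funext fun x => ?_
      simp only [Module.End.mul_apply, vxa]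
      split_ifs <;> rfl
    · intro e
      refine LinearMap.ext fun f => funext fun x => ?_
      simp only [Module.End.mul_apply, vxa, eda]
      cases h : dec x with
      | none => simp
      | some z =>
        simp only [Option.elim, hsrc x z h]
        split_ifs with h3 h4 h4
        · rfl
        · rfl
        · exact absurd (by rw [h4]) h3
        · rfl
    · intro e
      refine LinearMap.ext fun f => funext fun x => ?_
      simp only [Module.End.mul_apply, vxa, eda, if_true]
    · intro e
      refine LinearMap.ext fun f => funext fun x => ?_
      simp only [Module.End.mul_apply, vxa, gha]
      split_ifs <;> rfl
    · intro e
      refine LinearMap.ext fun f => funext fun x => ?_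
      simp only [Module.End.mul_apply, vxa, gha, h1, if_true]
    · intro e f' h
      refine LinearMap.ext fun f => funext fun x => ?_
      simp only [Module.End.mul_apply, eda, gha, hde, Option.elim, if_neg h]
      simp
    · intro e
      refine LinearMap.ext fun f => funext fun x => ?_
      simp only [Module.End.mul_apply, eda, gha, vxa, hde, Option.elim, if_true]
      split_ifs with h
      · rw [← h]
      · rfl
    · intro v h hne
      refine LinearMap.ext fun f => funext fun x => ?_
      simp only [LinearMap.sum_apply, Finset.sum_apply, Module.End.mul_apply, eda, gha, vxa,
        if_true]
      cases hx : dec x with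
      | none =>
        simp only [Option.elim, Finset.sum_const_zero]
        split_ifs with hv
        · obtain ⟨e, he⟩ := hne
          obtain ⟨z, hz⟩ := h2 x ⟨e, by rw [hv]; exact he⟩
          rw [← hdec, hx] at hz
          cases hz
        · rfl
      | some z =>
        simp only [Option.elim, hsrc x z hx, Finset.sum_ite_eq, Set.Finite.mem_toFinset]
        have : enc (z.1, z.2) = x := (hdec z x).1 hx
        rw [this]
        rfl
    · refine LinearMap.ext fun f => funext fun x => ?_
      simp [LinearMap.sum_apply, Finset.sum_apply, vxa]
  · intro v h
    have := congrFun (LinearMap.congr_fun h (fun _ => 1)) (v, 0)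
    simp [vxa] at this

end concrete

end LPAux

/-- For a finite directed graph `E` and a field `K`, no cycle in `E` has
an exit if and only if the Leavitt path algebra `L_K(E)` is directly finite: `x * y = 1`
implies `y * x = 1`. -/
theorem lpa_noExitCycles_iff_directlyFinite (K V E : Type) [Field K] [Fintype V]
    [Fintype E] (s r : E → V) :
    (∀ es : List E, IsCycle s r es → ¬ HasExit s r es) ↔
      ∀ x y : LeavittPathAlgebra K V E s r, x * y = 1 → y * x = 1 := by
  constructor
  · intro hno
    exact (LPAux.lfam K V E s r).df (K := K) hno (fun S h1 h2 h3 => LPAux.lgen K V E s r S (by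
      rintro (v | e | e)
      · exact h1 v
      · exact h2 e
      · exact h3 e))
  · intro hdf es hc hx
    obtain ⟨vx, ed, gh, F, hnz⟩ := LPAux.exists_rep K s r
    obtain ⟨x, y, h1, h2⟩ := (LPAux.lfam K V E s r).no_df (LPAux.vx_ne_zero F hnz) hc hx
    exact h2 (hdf x y h1)
end
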